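/- There exist universal constants H_0 > 0 and 0 < c ≤ C < ∞ such that for all integers S ≥ 2, n ≥ 3 and all H with H_0 ≤ H ≤ ln S, the minimax squared L2 risk for entropy estimation satisfies: if S ln S ≤ e·n·H·ln n then c[S²/(n ln n)² + H ln S / n] ≤ R(S,n,H) ≤ C[S²/(n ln n)² + H ln S / n], while if S ln S > e·n·H·ln n then c[(H/ln S)·ln(S ln S/(nH ln n))]² ≤ R(S,n,H) ≤ C[(H/ln S)·ln(S ln S/(nH ln n))]². -/

import Mathlib

open scoped BigOperators ENNReal

/-- Shannon entropy of a vector `p : Fin S → ℝ` (with the convention `0 ln 0 = 0`,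
which holds automatically since `Real.log 0 = 0`). -/
noncomputable def entropy {S : ℕ} (p : Fin S → ℝ) : ℝ := ∑ i, -(p i * Real.log (p i))

/-- `p` is a discrete probability distribution on `S` symbols. -/
def IsDist {S : ℕ} (p : Fin S → ℝ) : Prop := (∀ i, 0 ≤ p i) ∧ ∑ i, p i = 1

/-- Probability of observing the i.i.d. sample sequence `x` under `p`. -/
noncomputable def multProb {S n : ℕ} (p : Fin S → ℝ) (x : Fin n → Fin S) : ℝ :=
  ∏ j, p (x j)

/-- Squared L2 risk of an estimator `est` (a function of the `n` i.i.d. samples) at `p`. -/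
noncomputable def estRisk (S n : ℕ) (est : (Fin n → Fin S) → ℝ) (p : Fin S → ℝ) : ℝ≥0∞ :=
  ∑ x : Fin n → Fin S,
    ENNReal.ofReal (multProb p x) * ENNReal.ofReal ((est x - entropy p) ^ 2)

/-- Minimax squared L2 risk for entropy estimation over
`M_S(H) = {p : IsDist p, entropy p ≤ H}` from `n` i.i.d. samples. -/
noncomputable def minimaxRisk (S n : ℕ) (H : ℝ) : ℝ≥0∞ :=
  ⨅ est : (Fin n → Fin S) → ℝ,
    ⨆ p : {p : Fin S → ℝ // IsDist p ∧ entropy p ≤ H}, estRisk S n est p.1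

/-- Product weight of a finite sequence of symbols under the weight vector `p`. -/
noncomputable def seqWeight {κ : Type*} {n : ℕ} (p : κ → ℝ) (x : Fin n → κ) : ℝ :=
  ∏ j, p (x j)

section SeqWeight
variable {κ : Type*} [Fintype κ]

theorem sum_fin_cons {n : ℕ} (F : (Fin (n + 1) → κ) → ℝ) :
    ∑ x, F x = ∑ a, ∑ y : Fin n → κ, F (Fin.cons a y) := by
  rw [← (Fin.consEquiv (fun _ : Fin (n + 1) => κ)).sum_comp, Fintype.sum_prod_type]
  rfl

theorem seqWeight_cons {κ : Type*} {n : ℕ} (p : κ → ℝ) (a : κ) (y : Fin n → κ) :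
    seqWeight p (Fin.cons a y : Fin (n + 1) → κ) = p a * seqWeight p y := by
  simp [seqWeight, Fin.prod_univ_succ]

theorem sum_seqWeight_cons {n : ℕ} (p : κ → ℝ) (F : (Fin (n + 1) → κ) → ℝ) :
    ∑ x, seqWeight p x * F x =
      ∑ a, p a * ∑ y : Fin n → κ, seqWeight p y * F (Fin.cons a y) := by
  rw [sum_fin_cons]
  refine Finset.sum_congr rfl fun a _ => ?_
  rw [Finset.mul_sum]
  refine Finset.sum_congr rfl fun y _ => ?_
  rw [seqWeight_cons]; ring

theorem sum_seqWeight_cons' {n : ℕ} (p : κ → ℝ) (F : (Fin (n + 1) → κ) → ℝ) :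
    ∑ x, seqWeight p x * F x =
      ∑ y : Fin n → κ, seqWeight p y * ∑ a, p a * F (Fin.cons a y) := by
  rw [sum_seqWeight_cons]
  simp_rw [Finset.mul_sum]
  rw [Finset.sum_comm]
  refine Finset.sum_congr rfl fun y _ => Finset.sum_congr rfl fun a _ => by ring

theorem sum_seqWeight (p : κ → ℝ) (n : ℕ) :
    ∑ x : Fin n → κ, seqWeight p x = (∑ a, p a) ^ n := by
  induction n with
  | zero => simp [seqWeight]
  | succ n ih =>
    have := sum_seqWeight_cons (n := n) p (fun _ => 1)
    simp only [mul_one] at this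
    rw [this, ih, ← Finset.sum_mul, pow_succ]; ring

theorem seqWeight_nonneg {κ : Type*} {p : κ → ℝ} (hp : ∀ a, 0 ≤ p a) {n : ℕ} (x : Fin n → κ) :
    0 ≤ seqWeight p x := Finset.prod_nonneg fun _ _ => hp _

theorem sum_sq_sub_mean {p : κ → ℝ} (h1 : ∑ a, p a = 1) (f : κ → ℝ) (c : ℝ) :
    ∑ a, p a * (f a - c) ^ 2 =
      ∑ a, p a * (f a - ∑ b, p b * f b) ^ 2 + ((∑ b, p b * f b) - c) ^ 2 := by
  set m := ∑ b, p b * f b with hm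
  have e1 : ∀ d : ℝ, ∑ a, p a * (f a - d) ^ 2 = ∑ a, p a * f a ^ 2 - 2 * d * m + d ^ 2 := by
    intro d
    have : ∀ a, p a * (f a - d) ^ 2 = p a * f a ^ 2 - 2 * d * (p a * f a) + d ^ 2 * p a := by
      intro a; ring
    simp_rw [this]
    rw [Finset.sum_add_distrib, Finset.sum_sub_distrib, ← Finset.mul_sum, ← Finset.mul_sum, h1]
    ring
  rw [e1, e1]; ring

theorem sq_mean_le {p : κ → ℝ} (hp : ∀ a, 0 ≤ p a) (h1 : ∑ a, p a = 1) (f : κ → ℝ) :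
    (∑ a, p a * f a) ^ 2 ≤ ∑ a, p a * f a ^ 2 := by
  have h := sum_sq_sub_mean h1 f 0
  have h2 : 0 ≤ ∑ a, p a * (f a - ∑ b, p b * f b) ^ 2 :=
    Finset.sum_nonneg fun a _ => mul_nonneg (hp a) (sq_nonneg _)
  simp only [sub_zero] at h
  linarith

/-- Efron–Stein type bound: the variance of a function of independent coordinates is at most
the sum of its mean squared distances to functions ignoring one coordinate. -/
theorem variance_le_sum_sq_sub {p : κ → ℝ} (hp : ∀ a, 0 ≤ p a) (h1 : ∑ a, p a = 1) {n : ℕ}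
    (f : (Fin n → κ) → ℝ) (h : Fin n → (Fin n → κ) → ℝ)
    (hh : ∀ j x a, h j (Function.update x j a) = h j x) :
    ∑ x, seqWeight p x * (f x - ∑ y, seqWeight p y * f y) ^ 2 ≤
      ∑ j, ∑ x, seqWeight p x * (f x - h j x) ^ 2 := by
  induction n with
  | zero =>
    simp [seqWeight]
  | succ n ih =>
    set μ := ∑ y, seqWeight p y * f y with hμ
    let fb : (Fin n → κ) → ℝ := fun y => ∑ a, p a * f (Fin.cons a y)
    have hμ' : μ = ∑ y, seqWeight p y * fb y := by rw [hμ, sum_seqWeight_cons']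
    have h0 : ∀ a b (y : Fin n → κ), h 0 (Fin.cons a y) = h 0 (Fin.cons b y) := by
      intro a b y
      have := hh 0 (Fin.cons b y) a
      rwa [Fin.update_cons_zero] at this
    rw [sum_seqWeight_cons', Fin.sum_univ_succ]
    have key : ∀ y : Fin n → κ, ∑ a, p a * (f (Fin.cons a y) - μ) ^ 2 ≤
        ∑ a, p a * (f (Fin.cons a y) - h 0 (Fin.cons a y)) ^ 2 + (fb y - μ) ^ 2 := by
      intro y
      rw [sum_sq_sub_mean h1]
      refine add_le_add ?_ le_rfl
      rcases isEmpty_or_nonempty κ with hκ | ⟨⟨b⟩⟩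
      · simp
      · have : ∀ a, h 0 (Fin.cons a y) = h 0 (Fin.cons b y) := fun a => h0 a b y
        simp_rw [this]
        rw [sum_sq_sub_mean h1 _ (h 0 (Fin.cons b y))]
        have := sq_nonneg ((∑ b, p b * f (Fin.cons b y)) - h 0 (Fin.cons b y : Fin (n + 1) → κ))
        linarith
    have s1 : ∑ y : Fin n → κ, seqWeight p y * ∑ a, p a * (f (Fin.cons a y) - μ) ^ 2 ≤
        ∑ x, seqWeight p x * (f x - h 0 x) ^ 2 +
          ∑ y : Fin n → κ, seqWeight p y * (fb y - μ) ^ 2 := by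
      rw [sum_seqWeight_cons', ← Finset.sum_add_distrib]
      refine Finset.sum_le_sum fun y _ => ?_
      rw [← mul_add]
      exact mul_le_mul_of_nonneg_left (key y) (seqWeight_nonneg hp y)
    refine s1.trans ?_
    gcongr
    have := ih fb (fun j y => ∑ a, p a * h j.succ (Fin.cons a y)) (by
      intro j y b
      refine Finset.sum_congr rfl fun a _ => ?_
      rw [Fin.cons_update, hh])
    rw [← hμ'] at this
    refine this.trans (Finset.sum_le_sum fun j _ => ?_)
    rw [sum_seqWeight_cons']
    refine Finset.sum_le_sum fun y _ => mul_le_mul_of_nonneg_left ?_ (seqWeight_nonneg hp y)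
    have := sq_mean_le hp h1 (fun a => f (Fin.cons a y) - h j.succ (Fin.cons a y))
    refine le_trans (le_of_eq ?_) this
    congr 1
    simp only [fb, mul_sub, Finset.sum_sub_distrib]

theorem sum_seqWeight_coord {p : κ → ℝ} (h1 : ∑ a, p a = 1) {n : ℕ} (f : κ → ℝ) (j : Fin n) :
    ∑ x : Fin n → κ, seqWeight p x * f (x j) = ∑ a, p a * f a := by
  induction n with
  | zero => exact j.elim0
  | succ n ih =>
    rw [sum_seqWeight_cons]
    refine Fin.cases ?_ (fun j => ?_) j
    · simp only [Fin.cons_zero]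
      simp_rw [← Finset.sum_mul, sum_seqWeight, h1, one_pow, one_mul]
    · simp only [Fin.cons_succ, ih]
      rw [← Finset.sum_mul, h1, one_mul]

theorem sum_seqWeight_sum {p : κ → ℝ} (h1 : ∑ a, p a = 1) {n : ℕ} (f : κ → ℝ) :
    ∑ x : Fin n → κ, seqWeight p x * ∑ j, f (x j) = n * ∑ a, p a * f a := by
  simp_rw [Finset.mul_sum]
  rw [Finset.sum_comm]
  simp_rw [sum_seqWeight_coord h1, ← Finset.mul_sum]
  simp

theorem variance_sum_le {p : κ → ℝ} (hp : ∀ a, 0 ≤ p a) (h1 : ∑ a, p a = 1) {n : ℕ}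
    (f : κ → ℝ) :
    ∑ x : Fin n → κ, seqWeight p x * ((∑ j, f (x j)) - n * ∑ a, p a * f a) ^ 2 ≤
      n * ∑ a, p a * f a ^ 2 := by
  have h := variance_le_sum_sq_sub hp h1 (fun x : Fin n → κ => ∑ j, f (x j))
    (fun j x => ∑ i ∈ Finset.univ.erase j, f (x i)) (by
      intro j x a
      refine Finset.sum_congr rfl fun i hi => ?_
      rw [Function.update_of_ne (Finset.ne_of_mem_erase hi)])
  rw [sum_seqWeight_sum h1] at h
  refine h.trans (le_of_eq ?_)
  have : ∀ (j : Fin n) (x : Fin n → κ),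
      (∑ i, f (x i)) - ∑ i ∈ Finset.univ.erase j, f (x i) = f (x j) := by
    intro j x
    rw [← Finset.add_sum_erase _ _ (Finset.mem_univ j)]; ring
  simp_rw [this]
  simp_rw [sum_seqWeight_coord h1 (fun a => f a ^ 2)]
  simp

theorem variance_decomp {p : κ → ℝ} (h1 : ∑ a, p a = 1) {n : ℕ}
    (f : (Fin n → κ) → ℝ) (c : ℝ) :
    ∑ x, seqWeight p x * (f x - c) ^ 2 =
      ∑ x, seqWeight p x * (f x - ∑ y, seqWeight p y * f y) ^ 2 +
        ((∑ y, seqWeight p y * f y) - c) ^ 2 :=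
  sum_sq_sub_mean (by rw [sum_seqWeight, h1, one_pow]) f c

/-- Chebyshev's inequality in finite form. -/
theorem sum_filter_le_of_sq {w : κ → ℝ} (hw : ∀ a, 0 ≤ w a) (f : κ → ℝ) {t V : ℝ} (ht : 0 < t)
    (hV : ∑ a, w a * f a ^ 2 ≤ V) (P : κ → Prop) [DecidablePred P]
    (hP : ∀ a, P a → t ≤ |f a|) :
    ∑ a with P a, w a ≤ V / t ^ 2 := by
  rw [le_div_iff₀ (by positivity), Finset.sum_mul]
  refine le_trans ?_ hV
  refine le_trans (Finset.sum_le_sum (g := fun a => w a * f a ^ 2) ?_)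
    (Finset.sum_le_univ_sum_of_nonneg fun a => mul_nonneg (hw a) (sq_nonneg _))
  intro a ha
  have := hP a (Finset.mem_filter.mp ha).2
  refine mul_le_mul_of_nonneg_left ?_ (hw a)
  rw [← sq_abs (f a)]
  gcongr

end SeqWeight

theorem estRisk_eq_ofReal {S n : ℕ} (est : (Fin n → Fin S) → ℝ) {p : Fin S → ℝ}
    (hp : ∀ i, 0 ≤ p i) :
    estRisk S n est p =
      ENNReal.ofReal (∑ x, seqWeight p x * (est x - entropy p) ^ 2) := by
  rw [estRisk, ENNReal.ofReal_sum_of_nonneg fun x _ =>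
    mul_nonneg (seqWeight_nonneg hp x) (sq_nonneg _)]
  refine Finset.sum_congr rfl fun x _ => ?_
  rw [ENNReal.ofReal_mul (seqWeight_nonneg hp x)]
  rfl

theorem minimaxRisk_le_ofReal {S n : ℕ} {H B : ℝ} (est : (Fin n → Fin S) → ℝ)
    (h : ∀ p : Fin S → ℝ, IsDist p → entropy p ≤ H →
      ∑ x, seqWeight p x * (est x - entropy p) ^ 2 ≤ B) :
    minimaxRisk S n H ≤ ENNReal.ofReal B := by
  refine (iInf_le _ est).trans (iSup_le fun p => ?_)
  rw [estRisk_eq_ofReal est p.2.1.1]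
  exact ENNReal.ofReal_le_ofReal (h p.1 p.2.1 p.2.2)

theorem ofReal_le_minimaxRisk {S n : ℕ} {H b : ℝ}
    (h : ∀ (est : (Fin n → Fin S) → ℝ) (R : ℝ), 0 ≤ R →
      (∀ p : Fin S → ℝ, IsDist p → entropy p ≤ H →
        ∑ x, seqWeight p x * (est x - entropy p) ^ 2 ≤ R) → b ≤ R) :
    ENNReal.ofReal b ≤ minimaxRisk S n H := by
  refine le_iInf fun est => ?_
  by_contra hlt
  push Not at hlt
  set s := ⨆ p : {p : Fin S → ℝ // IsDist p ∧ entropy p ≤ H}, estRisk S n est p.1 with hs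
  have hfin : s ≠ ⊤ := (hlt.trans_le le_top).ne
  have := h est s.toReal ENNReal.toReal_nonneg (by
    intro p hp hpH
    have h1 : estRisk S n est p ≤ s :=
      le_iSup (fun p : {p : Fin S → ℝ // IsDist p ∧ entropy p ≤ H} => estRisk S n est p.1)
        ⟨p, hp, hpH⟩
    rw [estRisk_eq_ofReal est hp.1] at h1
    exact (ENNReal.ofReal_le_iff_le_toReal hfin).1 h1)
  exact absurd ((ENNReal.ofReal_le_ofReal this).trans (ENNReal.ofReal_toReal_le)) (not_le.2 hlt)

/-- Laguerre polynomial `∑ C(m,l) (-x)^l / l!`. -/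
noncomputable def laguerre (m : ℕ) (x : ℝ) : ℝ :=
  ∑ l ∈ Finset.range (m + 1), (m.choose l : ℝ) / (l.factorial : ℝ) * (-x) ^ l

noncomputable def laguerrePoly (m : ℕ) : Polynomial ℝ :=
  ∑ l ∈ Finset.range (m + 1),
    Polynomial.monomial l ((m.choose l : ℝ) / (l.factorial : ℝ) * (-1) ^ l)

theorem laguerrePoly_eval (m : ℕ) (x : ℝ) : (laguerrePoly m).eval x = laguerre m x := by
  simp only [laguerrePoly, laguerre, Polynomial.eval_finsetSum, Polynomial.eval_monomial]
  refine Finset.sum_congr rfl fun l _ => ?_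
  rw [neg_pow]; ring

theorem laguerrePoly_coeff (m l : ℕ) :
    (laguerrePoly m).coeff l = (m.choose l : ℝ) / (l.factorial : ℝ) * (-1) ^ l := by
  simp only [laguerrePoly, Polynomial.finsetSum_coeff, Polynomial.coeff_monomial]
  rw [Finset.sum_ite_eq' (Finset.range (m+1)) l]
  split_ifs with h
  · rfl
  · rw [Nat.choose_eq_zero_of_lt (by simpa using h)]; simp

open Polynomial in
theorem laguerrePoly_ode (m : ℕ) :
    X * derivative (derivative (laguerrePoly m)) + (1 - X) * derivative (laguerrePoly m)
      + C (m : ℝ) * laguerrePoly m = 0 := by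
  have key : ∀ l : ℕ, (m.choose (l+1) : ℝ) * (l + 1) = m.choose l * ((m : ℝ) - l) := by
    intro l
    rcases le_or_gt l m with h | h
    · have := Nat.choose_succ_right_eq m l
      rw [← Nat.cast_sub h]
      exact_mod_cast this
    · rw [Nat.choose_eq_zero_of_lt h, Nat.choose_eq_zero_of_lt (by omega)]; simp
  ext l
  rw [sub_mul, one_mul]
  simp only [coeff_add, coeff_sub, coeff_C_mul, coeff_zero]
  have e : ∀ l : ℕ, (laguerrePoly m).coeff (l+1) * ((l : ℝ)+1)^2
      = - ((laguerrePoly m).coeff l * ((m : ℝ) - l)) := by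
    intro l
    rw [laguerrePoly_coeff, laguerrePoly_coeff, Nat.factorial_succ]
    have h1 : (l.factorial : ℝ) ≠ 0 := by positivity
    have h2 : (l : ℝ) + 1 ≠ 0 := by positivity
    push_cast
    field_simp
    rw [pow_succ]
    linear_combination (- (-1) ^ l) * key l
  cases l with
  | zero =>
    simp only [coeff_X_mul_zero, coeff_derivative]
    have := e 0
    push_cast at this ⊢
    linarith
  | succ l =>
    simp only [coeff_X_mul, coeff_derivative]
    have := e (l+1)
    push_cast at this ⊢
    linarith

theorem laguerre_zero (m : ℕ) : laguerre m 0 = 1 := by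
  rw [laguerre, Finset.sum_eq_single 0]
  · simp
  · intro l _ hl; simp [hl]
  · simp

theorem abs_laguerre_le_exp {m : ℕ} (hm : 1 ≤ m) {x : ℝ} (hx : 0 ≤ x) :
    |laguerre m x| ≤ Real.exp x := by
  have hm0 : (0 : ℝ) < m := by exact_mod_cast hm
  set P := laguerrePoly m with hP
  set Q := Polynomial.derivative P with hQ
  set Q' := Polynomial.derivative Q with hQ'
  let V : ℝ → ℝ := fun x => P.eval x ^ 2 + x / m * Q.eval x ^ 2
  let W : ℝ → ℝ := fun x => V x * Real.exp (-(2 * x))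
  have hode : ∀ x : ℝ, x * Q'.eval x + (1 - x) * Q.eval x + m * P.eval x = 0 := by
    intro x
    have := congrArg (Polynomial.eval x) (laguerrePoly_ode m)
    simpa using this
  have hV : ∀ x, HasDerivAt V ((2 * x - 1) / m * Q.eval x ^ 2) x := by
    intro x
    have h1 : HasDerivAt (fun x => P.eval x ^ 2) (2 * P.eval x * Q.eval x) x := by
      exact ((P.hasDerivAt x).pow 2).congr_deriv (by simp [hQ])
    have h2 : HasDerivAt (fun x => Q.eval x ^ 2) (2 * Q.eval x * Q'.eval x) x := by
      exact ((Q.hasDerivAt x).pow 2).congr_deriv (by simp [hQ'])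
    have h3 : HasDerivAt (fun x : ℝ => x / m) (1 / m) x := (hasDerivAt_id x).div_const _
    have := h1.add (h3.mul h2)
    refine this.congr_deriv ?_
    have := hode x
    have h4 : Q'.eval x * x = -((1 - x) * Q.eval x + m * P.eval x) := by linarith
    field_simp
    linear_combination 2 * Q.eval x * h4
  have hW : ∀ x, HasDerivAt W (((2 * x - 1) / m * Q.eval x ^ 2 - 2 * V x)
      * Real.exp (-(2 * x))) x := by
    intro x
    have h1 : HasDerivAt (fun x : ℝ => Real.exp (-(2 * x))) (Real.exp (-(2 * x)) * (-(2 * 1))) x :=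
      ((hasDerivAt_id x).const_mul 2).neg.exp
    exact ((hV x).mul h1).congr_deriv (by ring)
  have hanti : AntitoneOn W (Set.Ici 0) := by
    refine antitoneOn_of_deriv_nonpos (convex_Ici 0)
      (fun x _ => (hW x).continuousAt.continuousWithinAt)
      (fun x _ => (hW x).differentiableAt.differentiableWithinAt) ?_
    intro x hx
    rw [interior_Ici] at hx
    rw [(hW x).deriv]
    refine mul_nonpos_of_nonpos_of_nonneg ?_ (Real.exp_pos _).le
    have : (2 * x - 1) / m * Q.eval x ^ 2 - 2 * V x
        = -(Q.eval x ^ 2 / m) - 2 * P.eval x ^ 2 := by simp only [V]; ring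
    rw [this]
    have : 0 ≤ Q.eval x ^ 2 / m := by positivity
    nlinarith [sq_nonneg (P.eval x)]
  have h0 := hanti (Set.mem_Ici.2 le_rfl) (Set.mem_Ici.2 hx) hx
  have hW0 : W 0 = 1 := by
    simp only [W, V, hP, laguerrePoly_eval, laguerre_zero]; simp
  rw [hW0] at h0
  have h1 : V x ≤ Real.exp x ^ 2 := by
    have : Real.exp (-(2 * x)) = (Real.exp x ^ 2)⁻¹ := by
      rw [Real.exp_neg, ← Real.exp_nat_mul]; norm_num
    simp only [W, this] at h0
    rwa [← div_eq_mul_inv, div_le_one (by positivity)] at h0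
  refine abs_le_of_sq_le_sq (le_trans ?_ h1) (Real.exp_pos _).le
  simp only [V, hP, laguerrePoly_eval]
  have : 0 ≤ x / m * Q.eval x ^ 2 := by positivity
  linarith

section

open MeasureTheory Set Filter Topology

theorem integral_Ioi_inv_one_add_pow {J : ℕ} (hJ : 2 ≤ J) :
    IntegrableOn (fun τ : ℝ => ((1 + τ) ^ J)⁻¹) (Ioi 0) ∧
      ∫ τ in Ioi (0 : ℝ), ((1 + τ) ^ J)⁻¹ = 1 / ((J : ℝ) - 1) := by
  obtain ⟨k, rfl⟩ : ∃ k, J = k + 2 := ⟨J - 2, by omega⟩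
  have hk : ((k : ℝ) + 1) ≠ 0 := by positivity
  have hd : ∀ τ ∈ Ioi (0 : ℝ), HasDerivAt
      (fun τ : ℝ => -((1 + τ) ^ (k + 1))⁻¹ / ((k : ℝ) + 1)) (((1 + τ) ^ (k + 2))⁻¹) τ := by
    intro τ hτ
    have hτ' : (1 + τ) ≠ 0 := by have : 0 < τ := hτ; positivity
    have h1 : HasDerivAt (fun τ : ℝ => (1 + τ) ^ (k + 1)) ((k + 1 : ℕ) * (1 + τ) ^ k * 1) τ := by
      exact (((hasDerivAt_id τ).const_add 1).pow (k + 1)).congr_deriv (by simp)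
    have h2 := ((h1.inv (pow_ne_zero _ hτ')).neg).div_const ((k : ℝ) + 1)
    refine h2.congr_deriv ?_
    push_cast
    field_simp
    ring
  have hc : ContinuousWithinAt (fun τ : ℝ => -((1 + τ) ^ (k + 1))⁻¹ / ((k : ℝ) + 1)) (Ici 0) 0 := by
    apply ContinuousAt.continuousWithinAt
    have : ((1 : ℝ) + 0) ^ (k + 1) ≠ 0 := by simp
    fun_prop (disch := simpa using this)
  have hlim : Tendsto (fun τ : ℝ => -((1 + τ) ^ (k + 1))⁻¹ / ((k : ℝ) + 1)) atTop (𝓝 0) := by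
    have : Tendsto (fun τ : ℝ => (1 + τ) ^ (k + 1)) atTop atTop :=
      (tendsto_pow_atTop (by omega)).comp (tendsto_atTop_add_const_left _ _ tendsto_id)
    simpa using (this.inv_tendsto_atTop.neg).div_const ((k : ℝ) + 1)
  have hpos : ∀ τ ∈ Ioi (0 : ℝ), 0 ≤ ((1 + τ) ^ (k + 2))⁻¹ := by
    intro τ hτ
    have : 0 < τ := hτ
    positivity
  refine ⟨integrableOn_Ioi_deriv_of_nonneg hc hd hpos hlim, ?_⟩
  rw [integral_Ioi_of_hasDerivAt_of_nonneg hc hd hpos hlim]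
  push_cast
  simp
  ring

theorem neg_log_sub_partial_sum {J : ℕ} (hJ : 1 ≤ J) {p : ℝ} (hp : 0 < p) (hp1 : p ≤ 1) :
    ∫ τ in Ioi (0 : ℝ), (1 - p) ^ J * (((1 + τ) ^ J)⁻¹ / (p + τ)) =
      -Real.log p - ∑ j ∈ Finset.Ico 1 J, (1 - p) ^ j / j := by
  set r := 1 - p with hr
  have hr0 : 0 ≤ r := by linarith
  let G : ℝ → ℝ := fun τ => Real.log (p + τ) - Real.log (1 + τ)
    + ∑ j ∈ Finset.Ico 1 J, r ^ j * ((1 + τ) ^ j)⁻¹ / j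
  have hd : ∀ τ ∈ Ici (0 : ℝ), HasDerivAt G (r ^ J * (((1 + τ) ^ J)⁻¹ / (p + τ))) τ := by
    intro τ hτ
    have hτ0 : (0 : ℝ) ≤ τ := hτ
    have h1 : (1 + τ) ≠ 0 := by positivity
    have h2 : (p + τ) ≠ 0 := by positivity
    have a1 : HasDerivAt (fun τ => Real.log (p + τ)) (1 / (p + τ)) τ := by
      simpa using ((hasDerivAt_id τ).const_add p).log h2
    have a2 : HasDerivAt (fun τ => Real.log (1 + τ)) (1 / (1 + τ)) τ := by
      simpa using ((hasDerivAt_id τ).const_add 1).log h1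
    have a3 : HasDerivAt (fun τ => ∑ j ∈ Finset.Ico 1 J, r ^ j * ((1 + τ) ^ j)⁻¹ / j)
        (∑ j ∈ Finset.Ico 1 J, -(r ^ j * ((1 + τ) ^ (j + 1))⁻¹)) τ := by
      refine HasDerivAt.fun_sum fun j hj => ?_
      have hj1 : 1 ≤ j := (Finset.mem_Ico.1 hj).1
      obtain ⟨i, rfl⟩ : ∃ i, j = i + 1 := ⟨j - 1, by omega⟩
      have h3 : HasDerivAt (fun τ : ℝ => (1 + τ) ^ (i + 1)) ((i + 1 : ℕ) * (1 + τ) ^ i * 1) τ := by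
        exact (((hasDerivAt_id τ).const_add 1).pow (i + 1)).congr_deriv (by simp)
      refine (((h3.inv (pow_ne_zero _ h1)).const_mul (r ^ (i + 1))).div_const _).congr_deriv ?_
      have : ((i : ℝ) + 1) ≠ 0 := by positivity
      push_cast
      field_simp
      ring
    refine ((a1.sub a2).add a3).congr_deriv ?_
    have key : ∀ K : ℕ, 1 ≤ K → 1 / (p + τ) - 1 / (1 + τ) +
        ∑ j ∈ Finset.Ico 1 K, -(r ^ j * ((1 + τ) ^ (j + 1))⁻¹)
          = r ^ K * (((1 + τ) ^ K)⁻¹ / (p + τ)) := by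
      intro K hK
      induction K, hK using Nat.le_induction with
      | base => simp; field_simp; rw [hr]; ring
      | succ K hK ih =>
        rw [Finset.sum_Ico_succ_top hK, ← add_assoc, ih]
        field_simp
        rw [hr]; ring
    exact key J hJ
  have hlim : Tendsto G atTop (𝓝 0) := by
    have e1 : Tendsto (fun τ : ℝ => Real.log (p + τ) - Real.log (1 + τ)) atTop (𝓝 0) := by
      have h1 : Tendsto (fun τ : ℝ => (p - 1) / (1 + τ)) atTop (𝓝 0) :=
        Tendsto.const_div_atTop (tendsto_atTop_add_const_left _ _ tendsto_id) _
      have h2 : Tendsto (fun τ : ℝ => Real.log (1 + (p - 1) / (1 + τ))) atTop (𝓝 0) := by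
        have := ((Real.continuousAt_log (one_ne_zero)).tendsto.comp
          (by simpa using h1.const_add 1 : Tendsto (fun τ : ℝ => 1 + (p - 1) / (1 + τ)) atTop (𝓝 1)))
        simpa [Function.comp_def] using this
      refine h2.congr' ?_
      filter_upwards [eventually_ge_atTop 0] with τ hτ
      rw [← Real.log_div (by positivity) (by positivity)]
      congr 1
      have : (1 + τ) ≠ 0 := by positivity
      field_simp
      ring
    have e2 : Tendsto (fun τ : ℝ => ∑ j ∈ Finset.Ico 1 J, r ^ j * ((1 + τ) ^ j)⁻¹ / j) atTop
        (𝓝 (∑ j ∈ Finset.Ico 1 J, r ^ j * 0 / j)) := by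
      refine tendsto_finsetSum _ fun j hj => ?_
      have hj1 : 1 ≤ j := (Finset.mem_Ico.1 hj).1
      have : Tendsto (fun τ : ℝ => (1 + τ) ^ j) atTop atTop :=
        (tendsto_pow_atTop (by omega)).comp (tendsto_atTop_add_const_left _ _ tendsto_id)
      exact (this.inv_tendsto_atTop.const_mul _).div_const _
    simpa using e1.add e2
  rw [integral_Ioi_of_hasDerivAt_of_nonneg
    (hd 0 self_mem_Ici).continuousAt.continuousWithinAt
    (fun τ hτ => hd τ (Ioi_subset_Ici_self hτ)) _ hlim]
  · simp [G]; ring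
  · intro τ hτ
    have : 0 < τ := hτ
    positivity

theorem integral_log_kernel_le {a p : ℝ} (ha : 0 < a) (hp : 0 < p) :
    IntegrableOn (fun τ : ℝ => 1 / ((1 + a * τ) ^ 2 * (p + τ))) (Ioi 0) ∧
    ∫ τ in Ioi (0 : ℝ), 1 / ((1 + a * τ) ^ 2 * (p + τ)) ≤ 2 * Real.log (1 + 1 / (a * p)) := by
  have hmeas : AEStronglyMeasurable (fun τ : ℝ => 1 / ((1 + a * τ) ^ 2 * (p + τ)))
      (volume.restrict (Ioi 0)) := by
    refine Measurable.aestronglyMeasurable ?_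
    fun_prop
  have main : ∀ (F f : ℝ → ℝ), (∀ τ ∈ Ici (0 : ℝ), HasDerivAt F (f τ) τ) →
      (∀ τ ∈ Ioi (0 : ℝ), 1 / ((1 + a * τ) ^ 2 * (p + τ)) ≤ f τ) → Tendsto F atTop (𝓝 0) →
      IntegrableOn (fun τ : ℝ => 1 / ((1 + a * τ) ^ 2 * (p + τ))) (Ioi 0) ∧
      ∫ τ in Ioi (0 : ℝ), 1 / ((1 + a * τ) ^ 2 * (p + τ)) ≤ - F 0 := by
    intro F f hF hf hlim
    have hnn : ∀ τ ∈ Ioi (0 : ℝ), 0 ≤ 1 / ((1 + a * τ) ^ 2 * (p + τ)) := by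
      intro τ hτ
      have : 0 < τ := hτ
      positivity
    have hpos : ∀ τ ∈ Ioi (0 : ℝ), 0 ≤ f τ := fun τ hτ => (hnn τ hτ).trans (hf τ hτ)
    have hcont := (hF 0 self_mem_Ici).continuousAt.continuousWithinAt (s := Ici (0 : ℝ))
    have hd := fun τ (hτ : τ ∈ Ioi (0 : ℝ)) => hF τ (Ioi_subset_Ici_self hτ)
    have hi := integrableOn_Ioi_deriv_of_nonneg hcont hd hpos hlim
    have hI : IntegrableOn (fun τ : ℝ => 1 / ((1 + a * τ) ^ 2 * (p + τ))) (Ioi 0) := by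
      refine Integrable.mono' hi hmeas ?_
      refine (ae_restrict_mem measurableSet_Ioi).mono fun τ hτ => ?_
      rw [Real.norm_of_nonneg (hnn τ hτ)]
      exact hf τ hτ
    refine ⟨hI, ?_⟩
    have := setIntegral_mono_on hI hi measurableSet_Ioi hf
    rw [integral_Ioi_of_hasDerivAt_of_nonneg hcont hd hpos hlim] at this
    simpa using this
  rcases le_or_gt (a * p) 1 with h | h
  · have := main (fun τ => -2 * (Real.log (p + 1 / a + τ) - Real.log (p + τ)))
      (fun τ => 2 * (1 / (p + τ) - 1 / (p + 1 / a + τ))) ?_ ?_ ?_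
    · refine ⟨this.1, this.2.trans (le_of_eq ?_)⟩
      rw [← Real.log_div (by positivity) (by positivity)]
      simp only [add_zero]
      have : (p + 1 / a) / p = 1 + 1 / (a * p) := by field_simp
      rw [this]; ring
    · intro τ hτ
      have hτ0 : (0 : ℝ) ≤ τ := hτ
      have a1 : HasDerivAt (fun τ => Real.log (p + τ)) (1 / (p + τ)) τ := by
        simpa using ((hasDerivAt_id τ).const_add p).log (by positivity)
      have a2 : HasDerivAt (fun τ => Real.log (p + 1 / a + τ)) (1 / (p + 1 / a + τ)) τ := by
        simpa using ((hasDerivAt_id τ).const_add (p + 1 / a)).log (by positivity)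
      exact ((a2.sub a1).const_mul (-2)).congr_deriv (by ring)
    · intro τ hτ
      have hτ0 : (0 : ℝ) < τ := hτ
      have : 2 * (1 / (p + τ) - 1 / (p + 1 / a + τ)) = 2 / ((p + τ) * (1 + a * p + a * τ)) := by
        field_simp; ring
      rw [this, div_le_div_iff₀ (by positivity) (by positivity)]
      have h1 : 0 ≤ a * τ := by positivity
      nlinarith [mul_nonneg h1 h1, mul_nonneg h1 (by positivity : 0 ≤ p + τ),
        mul_nonneg (mul_nonneg h1 h1) (by positivity : 0 ≤ p + τ),
        mul_nonneg (by positivity : 0 ≤ p + τ) (sub_nonneg.2 h)]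
    · have h1 : Tendsto (fun τ : ℝ => (1 / a) / (p + τ)) atTop (𝓝 0) :=
        Tendsto.const_div_atTop (tendsto_atTop_add_const_left _ _ tendsto_id) _
      have h2 : Tendsto (fun τ : ℝ => Real.log (1 + (1 / a) / (p + τ))) atTop (𝓝 0) := by
        have := ((Real.continuousAt_log (one_ne_zero)).tendsto.comp
          (by simpa using h1.const_add 1 :
            Tendsto (fun τ : ℝ => 1 + (1 / a) / (p + τ)) atTop (𝓝 1)))
        simpa [Function.comp_def] using this
      have h3 := h2.const_mul (-2)
      rw [mul_zero] at h3
      refine h3.congr' ?_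
      filter_upwards [eventually_ge_atTop 0] with τ hτ
      rw [← Real.log_div (by positivity) (by positivity)]
      congr 2
      field_simp
      ring
  · have := main (fun τ => -(1 / (a * p) * (1 + a * τ)⁻¹))
      (fun τ => 1 / (p * (1 + a * τ) ^ 2)) ?_ ?_ ?_
    · refine ⟨this.1, this.2.trans ?_⟩
      have hy : 1 / (a * p) ≤ 1 := by rw [div_le_one (by positivity)]; exact h.le
      have hy0 : 0 < 1 / (a * p) := by positivity
      set y := 1 / (a * p)
      have := Real.one_sub_inv_le_log_of_pos (x := 1 + y) (by positivity)
      have h2 : y / 2 ≤ 1 - (1 + y)⁻¹ := by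
        have : 1 - (1 + y)⁻¹ = y / (1 + y) := by field_simp; ring
        rw [this]
        gcongr
        linarith
      simp
      linarith
    · intro τ hτ
      have hτ0 : (0 : ℝ) ≤ τ := hτ
      have h0 : 1 + a * τ ≠ 0 := by positivity
      have h1 : HasDerivAt (fun τ => 1 + a * τ) a τ := by
        simpa using ((hasDerivAt_id τ).const_mul a).const_add 1
      refine ((h1.inv h0).const_mul (1 / (a * p))).neg.congr_deriv ?_
      field_simp
    · intro τ hτ
      have hτ0 : (0 : ℝ) < τ := hτ
      rw [mul_comm]
      gcongr
      linarith
    · have : Tendsto (fun τ : ℝ => 1 + a * τ) atTop atTop :=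
        tendsto_atTop_add_const_left _ _ (tendsto_id.const_mul_atTop ha)
      simpa using (this.inv_tendsto_atTop.const_mul (1 / (a * p))).neg

end

section

open MeasureTheory Set Filter Topology

/-- Coefficients (up to sign) of the rescaled Laguerre polynomial. -/
noncomputable def laguerreCoeff (m : ℕ) (b : ℝ) (l : ℕ) : ℝ :=
  (m.choose l : ℝ) * b ^ l / (l.factorial : ℝ)

noncomputable def laguerreAbs (m : ℕ) (b τ : ℝ) : ℝ :=
  ∑ l ∈ Finset.range (m + 1), laguerreCoeff m b l * τ ^ l

noncomputable def laguerreTail (m : ℕ) (b : ℝ) (i : ℕ) (τ : ℝ) : ℝ :=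
  ∑ r ∈ Finset.range (m - i), laguerreCoeff m b (i + 1 + r) * τ ^ r

theorem laguerreCoeff_nonneg {m : ℕ} {b : ℝ} (hb : 0 ≤ b) (l : ℕ) : 0 ≤ laguerreCoeff m b l := by
  unfold laguerreCoeff; positivity

theorem laguerre_eq_sum_coeff (m : ℕ) (b p : ℝ) :
    laguerre m (b * p) = ∑ l ∈ Finset.range (m + 1), laguerreCoeff m b l * (-p) ^ l := by
  unfold laguerre laguerreCoeff
  refine Finset.sum_congr rfl fun l _ => ?_
  rw [show -(b * p) = b * (-p) by ring, mul_pow]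
  ring

theorem laguerreAbs_sub (m : ℕ) (b p τ : ℝ) :
    laguerreAbs m b τ - laguerre m (b * p) =
      (p + τ) * ∑ i ∈ Finset.range m, (-p) ^ i * laguerreTail m b i τ := by
  rw [laguerre_eq_sum_coeff, laguerreAbs, ← Finset.sum_sub_distrib]
  have h1 : ∀ l, laguerreCoeff m b l * τ ^ l - laguerreCoeff m b l * (-p) ^ l =
      (p + τ) * ∑ i ∈ Finset.range l, (-p) ^ i * (laguerreCoeff m b l * τ ^ (l - 1 - i)) := by
    intro l
    have := geom_sum₂_mul (-p) τ l
    have h2 : ∑ i ∈ Finset.range l, (-p) ^ i * (laguerreCoeff m b l * τ ^ (l - 1 - i)) =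
        laguerreCoeff m b l * ∑ i ∈ Finset.range l, (-p) ^ i * τ ^ (l - 1 - i) := by
      rw [Finset.mul_sum]
      exact Finset.sum_congr rfl fun i _ => by ring
    rw [h2]
    linear_combination laguerreCoeff m b l * this
  simp_rw [h1, ← Finset.mul_sum]
  congr 1
  have h3 : ∀ i ∈ Finset.range m, (-p) ^ i * laguerreTail m b i τ =
      ∑ l ∈ Finset.Ico (i + 1) (m + 1), (-p) ^ i * (laguerreCoeff m b l * τ ^ (l - 1 - i)) := by
    intro i hi
    rw [laguerreTail, Finset.mul_sum, Finset.sum_Ico_eq_sum_range]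
    rw [show m + 1 - (i + 1) = m - i by omega]
    refine Finset.sum_congr rfl fun r _ => ?_
    rw [show i + 1 + r - 1 - i = r by omega]
  rw [Finset.sum_congr rfl h3]
  refine Finset.sum_comm' fun l i => ?_
  simp only [Finset.mem_range, Finset.mem_Ico]
  omega

theorem sq_le_laguerreAbs {m : ℕ} (hm : 2 ≤ m) {b τ : ℝ} (hb : 0 ≤ b) (hτ : 0 ≤ τ) :
    (1 + (m * b / 3) * τ) ^ 2 ≤ laguerreAbs m b τ := by
  have h : ∑ l ∈ Finset.range 3, laguerreCoeff m b l * τ ^ l ≤ laguerreAbs m b τ :=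
    Finset.sum_le_sum_of_subset_of_nonneg (by simp; omega) fun l _ _ =>
      mul_nonneg (laguerreCoeff_nonneg hb l) (by positivity)
  refine le_trans ?_ h
  have hm' : (2 : ℝ) ≤ m := by exact_mod_cast hm
  simp only [Finset.sum_range_succ, Finset.sum_range_zero, laguerreCoeff, Nat.cast_choose_two]
  simp
  have h1 : 0 ≤ m * b * τ := by positivity
  have h2 : 0 ≤ (b * τ) ^ 2 := by positivity
  have h3 : (0:ℝ) ≤ (m:ℝ) * (m - 1) / 4 - m ^ 2 / 9 := by nlinarith
  nlinarith [mul_nonneg h2 h3]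

theorem laguerreTail_le {m : ℕ} {b τ : ℝ} (hb : 0 ≤ b) (hτ : 0 ≤ τ) (i : ℕ) :
    laguerreTail m b i τ ≤
      2 ^ m * b ^ (i + 1) / ((i + 1).factorial : ℝ) * laguerreAbs m b τ := by
  have h : ∑ r ∈ Finset.range (m - i), laguerreCoeff m b r * τ ^ r ≤ laguerreAbs m b τ :=
    Finset.sum_le_sum_of_subset_of_nonneg (by intro x; simp; omega) fun l _ _ =>
      mul_nonneg (laguerreCoeff_nonneg hb l) (by positivity)
  refine le_trans ?_ (mul_le_mul_of_nonneg_left h (by positivity))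
  rw [laguerreTail, Finset.mul_sum]
  refine Finset.sum_le_sum fun r hr => ?_
  rw [← mul_assoc]
  refine mul_le_mul_of_nonneg_right ?_ (by positivity)
  unfold laguerreCoeff
  have h1 : (m.choose (i + 1 + r) : ℝ) ≤ 2 ^ m := by
    exact_mod_cast Nat.choose_le_two_pow m (i + 1 + r)
  have h2 : (1 : ℝ) ≤ m.choose r := by
    have : 0 < m.choose r := Nat.choose_pos (by simp at hr; omega)
    exact_mod_cast this
  have h3 : ((i + 1).factorial : ℝ) * r.factorial ≤ (i + 1 + r).factorial := by
    exact_mod_cast Nat.le_of_dvd (Nat.factorial_pos _)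
      (Nat.factorial_mul_factorial_dvd_factorial_add (i + 1) r)
  calc (m.choose (i + 1 + r) : ℝ) * b ^ (i + 1 + r) / ((i + 1 + r).factorial : ℝ)
      ≤ 2 ^ m * b ^ (i + 1 + r) / (((i + 1).factorial : ℝ) * r.factorial) := by
        gcongr
    _ = 2 ^ m * b ^ (i + 1) / ((i + 1).factorial : ℝ) * (1 * b ^ r / r.factorial) := by
        rw [pow_add]; field_simp
    _ ≤ _ := by gcongr

theorem exists_debias_coeffs {m J : ℕ} (hm : 2 ≤ m) (hJ : 2 ≤ J) {b : ℝ} (hb : 0 < b)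
    (hbJ : b ≤ J) :
    ∃ q : ℕ → ℝ,
      (∀ i, 0 ≤ q i ∧ q i ≤ 2 ^ m * b ^ (i + 1) / ((i + 1).factorial : ℝ) * (1 / ((J : ℝ) - 1))) ∧
      ∀ p : ℝ, 0 < p → p ≤ 1 →
        |-(p * Real.log p) - (∑ j ∈ Finset.Ico 1 J, p * (1 - p) ^ j / j +
          ∑ i ∈ Finset.range m, (-1) ^ i * q i * (p ^ (i + 1) * (1 - p) ^ J))| ≤
          2 * p * Real.log (1 + 1 / (m * b / 3 * p)) := by
  obtain ⟨hKi, hKv⟩ := integral_Ioi_inv_one_add_pow hJ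
  have hm0 : (0 : ℝ) < m := by exact_mod_cast (by omega : 0 < m)
  have hTpos : ∀ τ : ℝ, 0 ≤ τ → 0 < laguerreAbs m b τ := fun τ hτ =>
    lt_of_lt_of_le (by positivity) (sq_le_laguerreAbs hm hb.le hτ)
  have hcmeas : ∀ i, Measurable (laguerreTail m b i) := by
    intro i; unfold laguerreTail; fun_prop
  have hTmeas : Measurable (laguerreAbs m b) := by
    unfold laguerreAbs; fun_prop
  have hcnn : ∀ i τ, 0 ≤ τ → 0 ≤ laguerreTail m b i τ := fun i τ hτ =>
    Finset.sum_nonneg fun r _ => mul_nonneg (laguerreCoeff_nonneg hb.le _) (by positivity)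
  let g : ℕ → ℝ → ℝ := fun i τ => laguerreTail m b i τ / laguerreAbs m b τ * ((1 + τ) ^ J)⁻¹
  have hg0 : ∀ i, ∀ τ ∈ Ioi (0 : ℝ), 0 ≤ g i τ := fun i τ hτ => by
    have hτ : (0 : ℝ) < τ := hτ
    exact mul_nonneg (div_nonneg (hcnn i τ hτ.le) (hTpos τ hτ.le).le) (by positivity)
  have hg1 : ∀ i, ∀ τ ∈ Ioi (0 : ℝ),
      g i τ ≤ 2 ^ m * b ^ (i + 1) / ((i + 1).factorial : ℝ) * ((1 + τ) ^ J)⁻¹ := fun i τ hτ => by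
    have hτ : (0 : ℝ) < τ := hτ
    refine mul_le_mul_of_nonneg_right ?_ (by positivity)
    rw [div_le_iff₀ (hTpos τ hτ.le)]
    exact laguerreTail_le hb.le hτ.le i
  have hgi : ∀ i, IntegrableOn (g i) (Ioi 0) := fun i => by
    refine Integrable.mono'
      (hKi.const_mul (2 ^ m * b ^ (i + 1) / ((i + 1).factorial : ℝ))) ?_ ?_
    · refine Measurable.aestronglyMeasurable ?_
      exact ((hcmeas i).div hTmeas).mul (by fun_prop)
    · refine (ae_restrict_mem measurableSet_Ioi).mono fun τ hτ => ?_
      rw [Real.norm_of_nonneg (hg0 i τ hτ)]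
      exact hg1 i τ hτ
  refine ⟨fun i => ∫ τ in Ioi (0 : ℝ), g i τ, fun i => ⟨?_, ?_⟩, fun p hp hp1 => ?_⟩
  · exact setIntegral_nonneg measurableSet_Ioi (hg0 i)
  · rw [← hKv, ← integral_const_mul]
    exact setIntegral_mono_on (hgi i) (hKi.const_mul _) measurableSet_Ioi (hg1 i)
  · set a := m * b / 3 with ha
    have ha0 : 0 < a := by positivity
    obtain ⟨hLi, hLv⟩ := integral_log_kernel_le ha0 hp
    let e : ℝ → ℝ := fun τ => ((1 + τ) ^ J)⁻¹ / (laguerreAbs m b τ * (p + τ))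
    have he0 : ∀ τ ∈ Ioi (0 : ℝ), 0 ≤ e τ := fun τ hτ => by
      have hτ : (0 : ℝ) < τ := hτ
      have := hTpos τ hτ.le
      positivity
    have he1 : ∀ τ ∈ Ioi (0 : ℝ), e τ ≤ 1 / ((1 + a * τ) ^ 2 * (p + τ)) := fun τ hτ => by
      have hτ : (0 : ℝ) < τ := hτ
      have h1 : ((1 + τ) ^ J)⁻¹ ≤ 1 := inv_le_one_of_one_le₀ (one_le_pow₀ (by linarith))
      have h2 := sq_le_laguerreAbs hm hb.le hτ.le
      exact div_le_div₀ zero_le_one h1 (by positivity)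
        (mul_le_mul_of_nonneg_right h2 (by positivity))
    have hei : IntegrableOn e (Ioi 0) := by
      refine Integrable.mono' hLi ?_ ?_
      · refine Measurable.aestronglyMeasurable ?_
        exact Measurable.div (by fun_prop) (hTmeas.mul (by fun_prop))
      · refine (ae_restrict_mem measurableSet_Ioi).mono fun τ hτ => ?_
        rw [Real.norm_of_nonneg (he0 τ hτ)]
        exact he1 τ hτ
    have hev : ∫ τ in Ioi (0 : ℝ), e τ ≤ 2 * Real.log (1 + 1 / (a * p)) :=
      (setIntegral_mono_on hei hLi measurableSet_Ioi he1).trans hLv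
    have hev0 : 0 ≤ ∫ τ in Ioi (0 : ℝ), e τ := setIntegral_nonneg measurableSet_Ioi he0
    have hsplit : ∫ τ in Ioi (0 : ℝ), (1 - p) ^ J * (((1 + τ) ^ J)⁻¹ / (p + τ)) =
        (1 - p) ^ J * (laguerre m (b * p) * (∫ τ in Ioi (0 : ℝ), e τ) +
          ∑ i ∈ Finset.range m, (-p) ^ i * ∫ τ in Ioi (0 : ℝ), g i τ) := by
      rw [integral_const_mul]
      congr 1
      simp_rw [← integral_const_mul]
      rw [← integral_finsetSum _ fun i _ => (hgi i).const_mul _,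
        ← integral_add (hei.const_mul _) (integrable_finsetSum _ fun i _ => (hgi i).const_mul _)]
      refine setIntegral_congr_fun measurableSet_Ioi fun τ hτ => ?_
      have hτ : (0 : ℝ) < τ := hτ
      have hT := hTpos τ hτ.le
      have hpt : 0 < p + τ := by positivity
      have hid := laguerreAbs_sub m b p τ
      have h5 : ∑ i ∈ Finset.range m, (-p) ^ i * g i τ =
          (∑ i ∈ Finset.range m, (-p) ^ i * laguerreTail m b i τ) / laguerreAbs m b τ *
            ((1 + τ) ^ J)⁻¹ := by
        rw [Finset.sum_div, Finset.sum_mul]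
        exact Finset.sum_congr rfl fun i _ => by simp only [g]; ring
      simp only [e, h5]
      set s := ∑ i ∈ Finset.range m, (-p) ^ i * laguerreTail m b i τ
      have : laguerre m (b * p) = laguerreAbs m b τ - (p + τ) * s := by linarith
      rw [this]
      field_simp
      ring
    have hlog := neg_log_sub_partial_sum (by omega : 1 ≤ J) hp hp1
    rw [hsplit] at hlog
    have hmain : -(p * Real.log p) - (∑ j ∈ Finset.Ico 1 J, p * (1 - p) ^ j / j +
          ∑ i ∈ Finset.range m, (-1) ^ i * (∫ τ in Ioi (0 : ℝ), g i τ) *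
            (p ^ (i + 1) * (1 - p) ^ J)) =
        p * ((1 - p) ^ J * laguerre m (b * p)) * ∫ τ in Ioi (0 : ℝ), e τ := by
      have e1 : ∑ j ∈ Finset.Ico 1 J, p * (1 - p) ^ j / j =
          p * ∑ j ∈ Finset.Ico 1 J, (1 - p) ^ j / j := by
        rw [Finset.mul_sum]; exact Finset.sum_congr rfl fun j _ => by ring
      have e2 : ∑ i ∈ Finset.range m, (-1) ^ i * (∫ τ in Ioi (0 : ℝ), g i τ) *
            (p ^ (i + 1) * (1 - p) ^ J) =
          p * (1 - p) ^ J * ∑ i ∈ Finset.range m, (-p) ^ i * ∫ τ in Ioi (0 : ℝ), g i τ := by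
        rw [Finset.mul_sum]
        refine Finset.sum_congr rfl fun j _ => ?_
        rw [neg_pow p]; ring
      rw [e1, e2]
      linear_combination -p * hlog
    rw [hmain, abs_mul, abs_mul, abs_of_pos hp, abs_of_nonneg hev0]
    have hfac : |(1 - p) ^ J * laguerre m (b * p)| ≤ 1 := by
      rw [abs_mul, abs_of_nonneg (pow_nonneg (by linarith) J)]
      have h1 : (1 - p) ^ J ≤ Real.exp (-(J * p)) := by
        calc (1 - p) ^ J ≤ (Real.exp (-p)) ^ J :=
              pow_le_pow_left₀ (by linarith) (Real.one_sub_le_exp_neg p) J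
          _ = Real.exp (-(J * p)) := by rw [← Real.exp_nat_mul]; congr 1; ring
      have h2 := abs_laguerre_le_exp (by omega : 1 ≤ m) (by positivity : 0 ≤ b * p)
      calc (1 - p) ^ J * |laguerre m (b * p)| ≤ Real.exp (-(J * p)) * Real.exp (b * p) :=
            mul_le_mul h1 h2 (abs_nonneg _) (Real.exp_pos _).le
        _ = Real.exp ((b - J) * p) := by rw [← Real.exp_add]; congr 1; ring
        _ ≤ 1 := by
          rw [Real.exp_le_one_iff]
          exact mul_nonpos_of_nonpos_of_nonneg (by linarith) hp.le
    calc p * |(1 - p) ^ J * laguerre m (b * p)| * (∫ τ in Ioi (0 : ℝ), e τ)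
        ≤ p * 1 * (2 * Real.log (1 + 1 / (a * p))) := by gcongr
      _ = _ := by ring

end

/-- Number of occurrences of the symbol `a` in the sample `x`. -/
def symCount {κ : Type*} [DecidableEq κ] {n : ℕ} (a : κ) (x : Fin n → κ) : ℕ :=
  (Finset.univ.filter fun j => x j = a).card

section SymCount
variable {κ : Type*} [DecidableEq κ]

theorem symCount_le {n : ℕ} (a : κ) (x : Fin n → κ) : symCount a x ≤ n :=
  (Finset.card_le_univ _).trans (by simp)

theorem symCount_cons {n : ℕ} (a c : κ) (y : Fin n → κ) :
    symCount a (Fin.cons c y : Fin (n + 1) → κ) = symCount a y + if c = a then 1 else 0 := by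
  simp only [symCount, Finset.card_filter, Fin.sum_univ_succ, Fin.cons_zero, Fin.cons_succ]
  ring

theorem sum_symCount [Fintype κ] {n : ℕ} (x : Fin n → κ) : ∑ a, symCount a x = n := by
  simp only [symCount, Finset.card_filter]
  rw [Finset.sum_comm]
  simp

theorem sum_symCount_mul [Fintype κ] {n : ℕ} (x : Fin n → κ) (g : κ → ℝ) :
    ∑ a, (symCount a x : ℝ) * g a = ∑ j, g (x j) := by
  simp only [symCount, Finset.card_filter, Nat.cast_sum, Finset.sum_mul]
  rw [Finset.sum_comm]
  simp

theorem choose_mul_choose_succ (n a b : ℕ) :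
    (n + 1).choose (a + 1) * (n + 1 - (a + 1)).choose (b + 1) =
      n.choose (a + 1) * (n - (a + 1)).choose (b + 1) + n.choose a * (n - a).choose (b + 1)
        + n.choose (a + 1) * (n - (a + 1)).choose b := by
  rw [Nat.choose_succ_succ n a, show n + 1 - (a + 1) = n - a by omega]
  rcases le_or_gt (a + 1) n with h | h
  · rw [show n - a = (n - (a + 1)) + 1 by omega, Nat.choose_succ_succ (n - (a + 1)) b]
    ring
  · rw [Nat.choose_eq_zero_of_lt h]; ring

theorem sum_seqWeight_symCount_cons [Fintype κ] {p : κ → ℝ} (h1 : ∑ a, p a = 1) {n : ℕ} (s : κ)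
    (F : ℕ → ℝ) :
    ∑ x : Fin (n + 1) → κ, seqWeight p x * F (symCount s x) =
      p s * (∑ x : Fin n → κ, seqWeight p x * F (symCount s x + 1)) +
      (1 - p s) * ∑ x : Fin n → κ, seqWeight p x * F (symCount s x) := by
  rw [sum_seqWeight_cons p (fun x => F (symCount s x)), ← Finset.add_sum_erase _ _ (Finset.mem_univ s)]
  congr 1
  · simp [symCount_cons]
  · have : ∀ c ∈ Finset.univ.erase s, p c * ∑ y : Fin n → κ, seqWeight p y *
        F (symCount s (Fin.cons c y : Fin (n + 1) → κ)) =
        p c * ∑ x : Fin n → κ, seqWeight p x * F (symCount s x) := by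
      intro c hc
      simp [symCount_cons, Finset.ne_of_mem_erase hc]
    rw [Finset.sum_congr rfl this, ← Finset.sum_mul]
    congr 1
    rw [← h1, ← Finset.add_sum_erase _ _ (Finset.mem_univ s)]
    ring

theorem sum_seqWeight_choose_mul [Fintype κ] {p : κ → ℝ} (h1 : ∑ a, p a = 1) (s : κ) (n a b : ℕ) :
    ∑ x : Fin n → κ, seqWeight p x *
        (((symCount s x).choose a : ℝ) * ((n - symCount s x).choose b : ℝ)) =
      (n.choose a : ℝ) * ((n - a).choose b : ℝ) * (p s ^ a * (1 - p s) ^ b) := by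
  induction n generalizing a b with
  | zero =>
    have h0 : ∀ x : Fin 0 → κ, symCount s x = 0 := fun x => by
      have := symCount_le s x; omega
    simp only [h0, seqWeight]
    rcases a with _ | a <;> rcases b with _ | b <;> simp
  | succ n ih =>
    rw [sum_seqWeight_symCount_cons h1 s
      (fun k => ((k.choose a : ℝ) * ((n + 1 - k).choose b : ℝ)))]
    have hs : ∀ x : Fin n → κ, n + 1 - symCount s x = (n - symCount s x) + 1 := fun x => by
      have := symCount_le s x; omega
    simp only [Nat.add_sub_add_right, hs]
    rcases a with _ | a <;> rcases b with _ | b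
    · have := ih 0 0
      simp at this ⊢
      rw [this]; ring
    · have e1 := ih 0 (b + 1)
      have e2 := ih 0 b
      simp only [Nat.choose_zero_right, Nat.cast_one, one_mul, Nat.sub_zero, pow_zero] at e1 e2 ⊢
      simp only [Nat.choose_succ_succ, Nat.cast_add, mul_add, Finset.sum_add_distrib, e1, e2]
      ring
    · have e1 := ih (a + 1) 0
      have e2 := ih a 0
      simp only [Nat.choose_zero_right, Nat.cast_one, mul_one, pow_zero] at e1 e2 ⊢
      simp only [Nat.choose_succ_succ, Nat.cast_add, mul_add, Finset.sum_add_distrib, e2] at e1 ⊢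
      rw [e1]; ring
    · have e1 := ih (a + 1) (b + 1)
      have e2 := ih a (b + 1)
      have e3 := ih (a + 1) b
      have key : ∀ x : Fin n → κ, ((symCount s x + 1).choose (a + 1) : ℝ) =
          (symCount s x).choose a + (symCount s x).choose (a + 1) := fun x => by
        rw [Nat.choose_succ_succ]; push_cast; ring
      have key2 : ∀ x : Fin n → κ, ((n - symCount s x + 1).choose (b + 1) : ℝ) =
          (n - symCount s x).choose b + (n - symCount s x).choose (b + 1) := fun x => by
        rw [Nat.choose_succ_succ]; push_cast; ring
      simp only [key, key2, mul_add, add_mul, Finset.sum_add_distrib, e1, e2, e3]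
      have hM := congrArg (Nat.cast : ℕ → ℝ) (choose_mul_choose_succ n a b)
      push_cast at hM
      rw [show n + 1 - (a + 1) = n - a by omega, hM]
      ring

theorem variance_sum_symCount_le [Fintype κ] {p : κ → ℝ} (hp : ∀ a, 0 ≤ p a) (h1 : ∑ a, p a = 1)
    {n : ℕ} (g : ℕ → ℝ) :
    ∑ x : Fin n → κ, seqWeight p x * ((∑ a, g (symCount a x)) -
        ∑ y : Fin n → κ, seqWeight p y * ∑ a, g (symCount a y)) ^ 2 ≤
      ∑ x : Fin n → κ, seqWeight p x *
        ∑ a, (symCount a x : ℝ) * (g (symCount a x) - g (symCount a x - 1)) ^ 2 := by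
  have h := variance_le_sum_sq_sub hp h1 (fun x : Fin n → κ => ∑ a, g (symCount a x))
    (fun j x => ∑ a, g ((Finset.univ.erase j).filter fun i => x i = a).card) (by
      intro j x a
      refine Finset.sum_congr rfl fun c _ => ?_
      congr 2
      refine Finset.filter_congr fun i hi => ?_
      rw [Function.update_of_ne (Finset.ne_of_mem_erase hi)])
  refine h.trans (le_of_eq ?_)
  rw [Finset.sum_comm]
  refine Finset.sum_congr rfl fun x _ => ?_
  rw [← Finset.mul_sum, sum_symCount_mul x (fun a => (g (symCount a x) - g (symCount a x - 1)) ^ 2)]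
  congr 1
  refine Finset.sum_congr rfl fun j _ => ?_
  congr 1
  rw [← Finset.sum_sub_distrib, Finset.sum_eq_single (x j)]
  · have : ((Finset.univ.erase j).filter fun i => x i = x j).card = symCount (x j) x - 1 := by
      rw [Finset.filter_erase, Finset.card_erase_of_mem (by simp)]
      rfl
    rw [this]
  · intro b _ hb
    have : ((Finset.univ.erase j).filter fun i => x i = b).card = symCount b x := by
      rw [Finset.filter_erase, Finset.erase_eq_of_notMem (by simp [hb.symm])]
      rfl
    rw [this, sub_self]
  · simp

end SymCount

theorem choose_succ_mul_cast (A j : ℕ) :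
    (A.choose (j + 1) : ℝ) * (j + 1) = A.choose j * ((A : ℝ) - j) := by
  rcases le_or_gt j A with h | h
  · have := Nat.choose_succ_right_eq A j
    rw [← Nat.cast_sub h]
    exact_mod_cast this
  · rw [Nat.choose_eq_zero_of_lt h, Nat.choose_eq_zero_of_lt (by omega)]; simp

theorem choose_mul_pow_le {A B : ℕ} (h : A ≤ B) (j : ℕ) :
    (A.choose j : ℝ) * (B : ℝ) ^ j ≤ B.choose j * (A : ℝ) ^ j := by
  induction j with
  | zero => simp
  | succ j ih =>
    rcases le_or_gt A j with hj | hj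
    · rw [Nat.choose_eq_zero_of_lt (by omega : A < j + 1)]; simp; positivity
    · have e1 := choose_succ_mul_cast A j
      have e2 := choose_succ_mul_cast B j
      have hAj : (0 : ℝ) ≤ (A : ℝ) - j := by
        have : (j : ℝ) < A := by exact_mod_cast hj
        linarith
      have hAB : (A : ℝ) ≤ B := by exact_mod_cast h
      have hj0 : (0 : ℝ) < (j : ℝ) + 1 := by positivity
      have h3 : ((A : ℝ) - j) * B ≤ ((B : ℝ) - j) * A := by nlinarith [(j.cast_nonneg : (0:ℝ) ≤ j)]
      rw [← mul_le_mul_iff_left₀ hj0]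
      calc (A.choose (j + 1) : ℝ) * (B : ℝ) ^ (j + 1) * (j + 1)
          = (A.choose j * (B : ℝ) ^ j) * (((A : ℝ) - j) * B) := by
            rw [pow_succ]; linear_combination ((B : ℝ) ^ j * B) * e1
        _ ≤ (B.choose j * (A : ℝ) ^ j) * (((B : ℝ) - j) * A) := by
            apply mul_le_mul ih h3 (by positivity) (by positivity)
        _ = _ := by rw [pow_succ]; linear_combination -((A : ℝ) ^ j * A) * e2

noncomputable def zhangFactor (n J k : ℕ) : ℝ :=
  ∑ j ∈ Finset.Ico 1 J, ((n - k).choose j : ℝ) / ((n - 1).choose j : ℝ) / j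

/-- Zhang's estimator of the truncated entropy series, as a function of the symbol count. -/
noncomputable def zhangEst (n J k : ℕ) : ℝ := k / n * zhangFactor n J k

theorem sum_seqWeight_zhangEst {κ : Type*} [Fintype κ] [DecidableEq κ] {p : κ → ℝ}
    (h1 : ∑ a, p a = 1) (s : κ) {n J : ℕ} (hn : 1 ≤ n) (hJ : J ≤ n) :
    ∑ x : Fin n → κ, seqWeight p x * zhangEst n J (symCount s x) =
      ∑ j ∈ Finset.Ico 1 J, p s * (1 - p s) ^ j / j := by
  have e : ∀ k : ℕ, zhangEst n J k = ∑ j ∈ Finset.Ico 1 J,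
      ((k.choose 1 : ℝ) * ((n - k).choose j : ℝ)) * (1 / (n * (n - 1).choose j * j)) := fun k => by
    rw [zhangEst, zhangFactor, Finset.mul_sum]
    refine Finset.sum_congr rfl fun j _ => ?_
    rw [Nat.choose_one_right]
    field_simp
  simp_rw [e, Finset.mul_sum]
  rw [Finset.sum_comm]
  refine Finset.sum_congr rfl fun j hj => ?_
  rw [Finset.mem_Ico] at hj
  simp_rw [← mul_assoc, ← Finset.sum_mul]
  have := sum_seqWeight_choose_mul h1 s n 1 j
  simp_rw [← mul_assoc] at this
  rw [this]
  have h2 : ((n - 1).choose j : ℝ) ≠ 0 := by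
    have : 0 < (n - 1).choose j := Nat.choose_pos (by omega)
    exact_mod_cast this.ne'
  have h3 : (n : ℝ) ≠ 0 := by exact_mod_cast (by omega : n ≠ 0)
  have h4 : (j : ℝ) ≠ 0 := by exact_mod_cast (by omega : j ≠ 0)
  rw [Nat.choose_one_right]
  field_simp
  try simp

theorem choose_div_choose_le {n k : ℕ} (hk : 1 ≤ k) (hn : 2 ≤ n) {j : ℕ} (hj : j ≤ n - 1) :
    ((n - k).choose j : ℝ) / ((n - 1).choose j : ℝ) ≤ (((n - k : ℕ) : ℝ) / ((n - 1 : ℕ) : ℝ)) ^ j := by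
  have h2 : (0 : ℝ) < ((n - 1).choose j : ℝ) := by
    exact_mod_cast Nat.choose_pos hj
  have h3 : (0 : ℝ) < ((n - 1 : ℕ) : ℝ) := by exact_mod_cast (by omega : 0 < n - 1)
  rw [div_pow, div_le_div_iff₀ h2 (by positivity), mul_comm (((n - k : ℕ) : ℝ) ^ j)]
  exact choose_mul_pow_le (by omega) j

theorem zhangFactor_nonneg (n J k : ℕ) : 0 ≤ zhangFactor n J k :=
  Finset.sum_nonneg fun _ _ => by positivity

theorem zhangFactor_le {n J k : ℕ} (hk : 1 ≤ k) (hkn : k ≤ n) (hn : 2 ≤ n) (hJ : J ≤ n) :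
    zhangFactor n J k ≤ 1 + Real.log (2 * n / k) := by
  have hn0 : (0 : ℝ) < n := by exact_mod_cast (by omega : 0 < n)
  rcases Nat.eq_or_lt_of_le hk with h | h
  · subst h
    have h1 : zhangFactor n J 1 ≤ ((harmonic n : ℚ) : ℝ) := by
      have : ((harmonic n : ℚ) : ℝ) = ∑ j ∈ Finset.Icc 1 n, (1 : ℝ) / j := by
        rw [harmonic_eq_sum_Icc]; push_cast; simp
      rw [this, zhangFactor]
      refine (Finset.sum_le_sum fun j hj => ?_).trans
        (Finset.sum_le_sum_of_subset_of_nonneg (f := fun j : ℕ => (1 : ℝ) / j) (t := Finset.Icc 1 n) ?_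
          fun j _ _ => by positivity)
      · gcongr
        exact div_self_le_one _
      · intro j; simp only [Finset.mem_Ico, Finset.mem_Icc]; omega
    refine h1.trans ((harmonic_le_one_add_log n).trans ?_)
    gcongr
    simp
    linarith
  · have h1n : (0 : ℝ) < ((n - 1 : ℕ) : ℝ) := by exact_mod_cast (by omega : 0 < n - 1)
    have hc1 : ((n - 1 : ℕ) : ℝ) = n - 1 := by push_cast [Nat.cast_sub (by omega : 1 ≤ n)]; ring
    have hc2 : ((n - k : ℕ) : ℝ) = n - k := by push_cast [Nat.cast_sub hkn]; ring
    have hkr : (2 : ℝ) ≤ k := by exact_mod_cast h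
    have hknr : (k : ℝ) ≤ n := by exact_mod_cast hkn
    set q : ℝ := ((k : ℝ) - 1) / (n - 1) with hq
    have hn1 : (0 : ℝ) < (n : ℝ) - 1 := by linarith
    have hq0 : 0 < q := div_pos (by linarith) hn1
    have hq1 : q ≤ 1 := by rw [hq, div_le_one hn1]; linarith
    have hρ : ((n - k : ℕ) : ℝ) / ((n - 1 : ℕ) : ℝ) = 1 - q := by
      rw [hc1, hc2, hq]; field_simp; ring
    have h2 : zhangFactor n J k ≤ ∑ j ∈ Finset.Ico 1 J, (1 - q) ^ j / j := by
      refine Finset.sum_le_sum fun j hj => ?_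
      rw [Finset.mem_Ico] at hj
      gcongr
      rw [← hρ]
      exact choose_div_choose_le hk hn (by omega)
    have h3 : ∑ j ∈ Finset.Ico 1 J, (1 - q) ^ j / j ≤ -Real.log q := by
      rcases Nat.lt_or_ge J 1 with hJ0 | hJ0
      · have : J = 0 := by omega
        subst this
        simpa using Real.log_nonpos hq0.le hq1
      · have h4 := neg_log_sub_partial_sum hJ0 hq0 hq1
        have h5 : 0 ≤ ∫ τ in Set.Ioi (0 : ℝ), (1 - q) ^ J * (((1 + τ) ^ J)⁻¹ / (q + τ)) := by
          refine MeasureTheory.setIntegral_nonneg measurableSet_Ioi fun τ hτ => ?_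
          have : (0 : ℝ) < τ := hτ
          have : 0 ≤ 1 - q := by linarith
          positivity
        linarith
    have h6 : -Real.log q ≤ Real.log (2 * n / k) := by
      rw [← Real.log_inv]
      refine Real.log_le_log (by positivity) ?_
      rw [hq, inv_div, div_le_div_iff₀ (by linarith) (by linarith)]
      nlinarith
    linarith

theorem zhangFactor_diff {n J k : ℕ} (hk : 2 ≤ k) (hkn : k ≤ n) (hJ : 2 * J ≤ n) :
    0 ≤ ((k : ℝ) - 1) * (zhangFactor n J (k - 1) - zhangFactor n J k) ∧
    ((k : ℝ) - 1) * (zhangFactor n J (k - 1) - zhangFactor n J k) ≤ 2 := by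
  have hkr : (2 : ℝ) ≤ k := by exact_mod_cast hk
  have hknr : (k : ℝ) ≤ n := by exact_mod_cast hkn
  have hn1 : (0 : ℝ) < (n : ℝ) - 1 := by linarith
  have hc1 : ((n - 1 : ℕ) : ℝ) = n - 1 := by push_cast [Nat.cast_sub (by omega : 1 ≤ n)]; ring
  have hc2 : ((n - k : ℕ) : ℝ) = n - k := by push_cast [Nat.cast_sub hkn]; ring
  have e : zhangFactor n J (k - 1) - zhangFactor n J k = ∑ i ∈ Finset.range (J - 1),
      ((n - k).choose i : ℝ) / ((n - 1).choose i : ℝ) / ((n : ℝ) - 1 - i) := by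
    rw [zhangFactor, zhangFactor, ← Finset.sum_sub_distrib, Finset.sum_Ico_eq_sum_range]
    refine Finset.sum_congr rfl fun i hi => ?_
    rw [Finset.mem_range] at hi
    rw [show n - (k - 1) = (n - k) + 1 by omega, add_comm 1 i, Nat.choose_succ_succ]
    have h1 := choose_succ_mul_cast (n - 1) i
    rw [hc1] at h1
    have h2 : ((n - 1).choose (i + 1) : ℝ) ≠ 0 := by
      have : 0 < (n - 1).choose (i + 1) := Nat.choose_pos (by omega)
      exact_mod_cast this.ne'
    have h3 : ((n - 1).choose i : ℝ) ≠ 0 := by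
      have : 0 < (n - 1).choose i := Nat.choose_pos (by omega)
      exact_mod_cast this.ne'
    have h4 : ((n : ℝ) - 1 - i) ≠ 0 := by
      have : ((2 * (i + 2) : ℕ) : ℝ) ≤ n := by exact_mod_cast (by omega : 2 * (i + 2) ≤ n)
      push_cast at this
      have := (i.cast_nonneg : (0:ℝ) ≤ i)
      apply ne_of_gt; linarith
    have h5 : ((i : ℝ) + 1) ≠ 0 := by positivity
    push_cast
    rw [div_div, div_div, div_div, ← h1, ← sub_div]
    congr 1
    ring
  have hbound : ∀ i ∈ Finset.range (J - 1),
      ((n - k).choose i : ℝ) / ((n - 1).choose i : ℝ) / ((n : ℝ) - 1 - i) ≤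
        (((n : ℝ) - k) / (n - 1)) ^ i * (2 / n) ∧
      0 ≤ ((n - k).choose i : ℝ) / ((n - 1).choose i : ℝ) / ((n : ℝ) - 1 - i) := by
    intro i hi
    rw [Finset.mem_range] at hi
    have h1 : ((2 * (i + 1) : ℕ) : ℝ) ≤ n := by exact_mod_cast (by omega : 2 * (i + 1) ≤ n)
    push_cast at h1
    have h2 := choose_div_choose_le (by omega : 1 ≤ k) (by omega : 2 ≤ n) (by omega : i ≤ n - 1)
    rw [hc1, hc2] at h2
    have h3 : 0 < (n : ℝ) - 1 - i := by linarith
    refine ⟨?_, by positivity⟩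
    rw [div_eq_mul_inv]
    refine mul_le_mul h2 ?_ (by positivity) ?_
    · rw [← one_div, div_le_div_iff₀ h3 (by linarith)]; linarith
    · have : 0 ≤ (n : ℝ) - k := by linarith
      positivity
  constructor
  · rw [e]
    exact mul_nonneg (by linarith) (Finset.sum_nonneg fun i hi => (hbound i hi).2)
  · have h1 : zhangFactor n J (k - 1) - zhangFactor n J k ≤
        (∑ i ∈ Finset.range (J - 1), (((n : ℝ) - k) / (n - 1)) ^ i) * (2 / n) := by
      rw [e, Finset.sum_mul]
      exact Finset.sum_le_sum fun i hi => (hbound i hi).1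
    set ρ : ℝ := ((n : ℝ) - k) / (n - 1) with hρ
    have hρ0 : 0 ≤ ρ := div_nonneg (by linarith) hn1.le
    have hg := geom_sum_mul_neg ρ (J - 1)
    have h2 : ((k : ℝ) - 1) = (1 - ρ) * (n - 1) := by rw [hρ]; field_simp; ring
    calc ((k : ℝ) - 1) * (zhangFactor n J (k - 1) - zhangFactor n J k)
        ≤ ((k : ℝ) - 1) * ((∑ i ∈ Finset.range (J - 1), ρ ^ i) * (2 / n)) :=
          mul_le_mul_of_nonneg_left h1 (by linarith)
      _ = ((∑ i ∈ Finset.range (J - 1), ρ ^ i) * (1 - ρ)) * ((n - 1) * (2 / n)) := by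
          rw [h2]; ring
      _ = (1 - ρ ^ (J - 1)) * ((n - 1) * (2 / n)) := by rw [hg]
      _ ≤ 1 * 2 := by
          refine mul_le_mul ?_ ?_ ?_ zero_le_one
          · linarith [pow_nonneg hρ0 (J - 1)]
          · rw [mul_div_assoc', div_le_iff₀ (by linarith)]; linarith
          · have : (0:ℝ) < n := by linarith
            positivity
      _ = 2 := by norm_num

theorem abs_zhangEst_sub_le {n J k : ℕ} (hk : 1 ≤ k) (hkn : k ≤ n) (hn : 2 ≤ n) (hJ : 2 * J ≤ n) :
    |zhangEst n J k - zhangEst n J (k - 1)| ≤ (2 + Real.log (2 * n / k)) / n := by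
  have hn0 : (0 : ℝ) < n := by exact_mod_cast (by omega : 0 < n)
  have hk0 : (1 : ℝ) ≤ k := by exact_mod_cast hk
  have hknr : (k : ℝ) ≤ n := by exact_mod_cast hkn
  have e : zhangEst n J k - zhangEst n J (k - 1) = (zhangFactor n J k -
      ((k : ℝ) - 1) * (zhangFactor n J (k - 1) - zhangFactor n J k)) / n := by
    rw [zhangEst, zhangEst, Nat.cast_sub hk]; push_cast; field_simp; ring
  have h1 := zhangFactor_le (J := J) hk hkn hn (by omega)
  have h0 := zhangFactor_nonneg n J k
  have hl : 0 ≤ Real.log (2 * n / k) := by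
    apply Real.log_nonneg
    rw [le_div_iff₀ (by linarith)]; linarith
  have h2 : 0 ≤ ((k : ℝ) - 1) * (zhangFactor n J (k - 1) - zhangFactor n J k) ∧
    ((k : ℝ) - 1) * (zhangFactor n J (k - 1) - zhangFactor n J k) ≤ 2 := by
    rcases Nat.eq_or_lt_of_le hk with h | h
    · subst h; simp
    · exact zhangFactor_diff h hkn hJ
  rw [e, abs_div, abs_of_pos hn0]
  gcongr
  rw [abs_le]
  constructor <;> linarith [h2.1, h2.2]

/-- Correction term (with coefficients `q`) as a function of the symbol count. -/
noncomputable def tailEst (q : ℕ → ℝ) (n J m k : ℕ) : ℝ :=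
  ∑ i ∈ Finset.range m, (-1) ^ i * q i *
    (((k.choose (i + 1) : ℝ) * ((n - k).choose J : ℝ)) /
      ((n.choose (i + 1) : ℝ) * ((n - (i + 1)).choose J : ℝ)))

theorem sum_seqWeight_tailEst {κ : Type*} [Fintype κ] [DecidableEq κ] {p : κ → ℝ}
    (h1 : ∑ a, p a = 1) (s : κ) (q : ℕ → ℝ) {n J m : ℕ} (h : J + m ≤ n) :
    ∑ x : Fin n → κ, seqWeight p x * tailEst q n J m (symCount s x) =
      ∑ i ∈ Finset.range m, (-1) ^ i * q i * (p s ^ (i + 1) * (1 - p s) ^ J) := by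
  simp_rw [tailEst, Finset.mul_sum]
  rw [Finset.sum_comm]
  refine Finset.sum_congr rfl fun i hi => ?_
  rw [Finset.mem_range] at hi
  have e := sum_seqWeight_choose_mul h1 s n (i + 1) J
  have h2 : (n.choose (i + 1) : ℝ) ≠ 0 := by
    exact_mod_cast (Nat.choose_pos (by omega : i + 1 ≤ n)).ne'
  have h3 : ((n - (i + 1)).choose J : ℝ) ≠ 0 := by
    exact_mod_cast (Nat.choose_pos (by omega : J ≤ n - (i + 1))).ne'
  calc ∑ x : Fin n → κ, seqWeight p x * ((-1) ^ i * q i *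
        ((((symCount s x).choose (i + 1) : ℝ) * ((n - symCount s x).choose J : ℝ)) /
        ((n.choose (i + 1) : ℝ) * ((n - (i + 1)).choose J : ℝ))))
      = (-1) ^ i * q i / ((n.choose (i + 1) : ℝ) * ((n - (i + 1)).choose J : ℝ)) *
        ∑ x : Fin n → κ, seqWeight p x *
          (((symCount s x).choose (i + 1) : ℝ) * ((n - symCount s x).choose J : ℝ)) := by
        rw [Finset.mul_sum]
        exact Finset.sum_congr rfl fun x _ => by ring
    _ = _ := by rw [e]; field_simp

theorem pow_le_factorial_mul_choose {N J i : ℕ} (h : J + i ≤ N + 1) :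
    J ^ i ≤ i.factorial * N.choose i := by
  rw [← Nat.descFactorial_eq_factorial_mul_choose]
  exact (Nat.pow_le_pow_left (by omega) i).trans (Nat.pow_sub_le_descFactorial N i)

theorem sum_choose_succ_mul_le {m k : ℕ} {d : ℝ} (hd : 0 ≤ d) :
    ∑ i ∈ Finset.range m, (k.choose (i + 1) : ℝ) * d ^ (i + 1) ≤ (1 + d) ^ k := by
  have h1 : (1 + d) ^ k = ∑ i ∈ Finset.range (k + m + 1), (k.choose i : ℝ) * d ^ i := by
    rw [add_comm, add_pow]
    simp only [one_pow, mul_one]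
    rw [← Finset.sum_subset (Finset.range_mono (by omega : k + 1 ≤ k + m + 1))]
    · exact Finset.sum_congr rfl fun i _ => by ring
    · intro i _ hi
      rw [Nat.choose_eq_zero_of_lt (by simpa using hi)]; simp
  rw [h1, Finset.sum_range_succ']
  have : ∑ i ∈ Finset.range m, (k.choose (i + 1) : ℝ) * d ^ (i + 1) ≤
      ∑ i ∈ Finset.range (k + m), (k.choose (i + 1) : ℝ) * d ^ (i + 1) :=
    Finset.sum_le_sum_of_subset_of_nonneg (Finset.range_mono (by omega)) fun i _ _ => by positivity
  simp
  linarith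

theorem abs_tailEst_le {q : ℕ → ℝ} {n J m k : ℕ} {B : ℝ} (hB : 0 ≤ B)
    (hq : ∀ i, 0 ≤ q i ∧ q i ≤ B * ((J : ℝ) / 4) ^ (i + 1) / ((i + 1).factorial : ℝ))
    (hJ : 1 ≤ J) (hkn : k ≤ n) (h4 : n ≤ 4 * J) (h2 : 2 * J + m ≤ n) :
    |tailEst q n J m k| ≤ B * (15 / 16) ^ k := by
  have hn0 : (0 : ℝ) < n := by exact_mod_cast (by omega : 0 < n)
  have hJ0 : (0 : ℝ) < J := by exact_mod_cast hJ
  have hCJ : (0 : ℝ) < (n.choose J : ℝ) := by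
    exact_mod_cast Nat.choose_pos (by omega : J ≤ n)
  have hterm : ∀ i ∈ Finset.range m, |(-1) ^ i * q i *
      (((k.choose (i + 1) : ℝ) * ((n - k).choose J : ℝ)) /
      ((n.choose (i + 1) : ℝ) * ((n - (i + 1)).choose J : ℝ)))| ≤
      B * (((n - k).choose J : ℝ) / (n.choose J : ℝ)) *
        ((k.choose (i + 1) : ℝ) * (1 / 4) ^ (i + 1)) := by
    intro i hi
    rw [Finset.mem_range] at hi
    have hF : (0 : ℝ) < ((i + 1).factorial : ℝ) := by exact_mod_cast Nat.factorial_pos _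
    have e1 : (n.choose (i + 1) : ℝ) * ((n - (i + 1)).choose J : ℝ) =
        n.choose J * ((n - J).choose (i + 1) : ℝ) := by
      have a1 := Nat.choose_mul (n := n) (k := J + (i + 1)) (s := i + 1) (by omega)
      have a2 := Nat.choose_mul (n := n) (k := J + (i + 1)) (s := J) (by omega)
      rw [Nat.add_sub_cancel] at a1
      rw [Nat.add_sub_cancel_left] at a2
      have a3 : (J + (i + 1)).choose (i + 1) = (J + (i + 1)).choose J :=
        Nat.choose_symm_of_eq_add (by omega)
      rw [a3, a2] at a1
      exact_mod_cast a1.symm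
    have e2 : (J : ℝ) ^ (i + 1) ≤ ((i + 1).factorial : ℝ) * ((n - J).choose (i + 1) : ℝ) := by
      exact_mod_cast pow_le_factorial_mul_choose (by omega : J + (i + 1) ≤ n - J + 1)
    have hC : (0 : ℝ) < ((n - J).choose (i + 1) : ℝ) := by
      exact_mod_cast Nat.choose_pos (by omega : i + 1 ≤ n - J)
    rw [e1, abs_mul, abs_mul, abs_pow, abs_neg, abs_one, one_pow, one_mul, abs_of_nonneg (hq i).1,
      abs_of_nonneg (by positivity)]
    have e3 : B * ((J : ℝ) / 4) ^ (i + 1) / ((i + 1).factorial : ℝ) ≤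
        B * (1 / 4) ^ (i + 1) * ((n - J).choose (i + 1) : ℝ) := by
      rw [div_le_iff₀ hF, div_pow, div_pow, one_pow]
      calc B * ((J : ℝ) ^ (i + 1) / 4 ^ (i + 1))
          ≤ B * ((((i + 1).factorial : ℝ) * ((n - J).choose (i + 1) : ℝ)) / 4 ^ (i + 1)) := by
            gcongr
        _ = _ := by ring
    calc q i * ((k.choose (i + 1) : ℝ) * ((n - k).choose J : ℝ) /
          (n.choose J * ((n - J).choose (i + 1) : ℝ)))
        ≤ (B * (1 / 4) ^ (i + 1) * ((n - J).choose (i + 1) : ℝ)) *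
          ((k.choose (i + 1) : ℝ) * ((n - k).choose J : ℝ) /
          (n.choose J * ((n - J).choose (i + 1) : ℝ))) :=
          mul_le_mul_of_nonneg_right ((hq i).2.trans e3) (by positivity)
      _ = _ := by field_simp
  have hratio : ((n - k).choose J : ℝ) / (n.choose J : ℝ) ≤ (3 / 4 : ℝ) ^ k := by
    have a1 := choose_mul_pow_le (by omega : n - J ≤ n) k
    have hCk : (0 : ℝ) < (n.choose k : ℝ) := by exact_mod_cast Nat.choose_pos hkn
    have e1 : (n.choose k : ℝ) * ((n - k).choose J : ℝ) =
        n.choose J * ((n - J).choose k : ℝ) := by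
      rcases le_or_gt (J + k) n with h | h
      · have a1 := Nat.choose_mul (n := n) (k := J + k) (s := k) (by omega)
        have a2 := Nat.choose_mul (n := n) (k := J + k) (s := J) (by omega)
        rw [Nat.add_sub_cancel] at a1
        rw [Nat.add_sub_cancel_left] at a2
        have a3 : (J + k).choose k = (J + k).choose J := Nat.choose_symm_of_eq_add (by omega)
        rw [a3, a2] at a1
        exact_mod_cast a1.symm
      · rw [Nat.choose_eq_zero_of_lt (by omega : n - k < J),
          Nat.choose_eq_zero_of_lt (by omega : n - J < k)]
        simp
    have e2 : ((n - k).choose J : ℝ) / (n.choose J : ℝ) = ((n - J).choose k : ℝ) / n.choose k := by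
      rw [div_eq_div_iff hCJ.ne' hCk.ne']; linarith
    rw [e2, div_le_iff₀ hCk]
    have e3 : ((n - J : ℕ) : ℝ) ≤ 3 / 4 * n := by
      rw [Nat.cast_sub (by omega)]
      have : (n : ℝ) ≤ 4 * J := by exact_mod_cast h4
      linarith
    have e4 : ((n - J : ℕ) : ℝ) ^ k ≤ (3 / 4) ^ k * (n : ℝ) ^ k := by
      rw [← mul_pow]; gcongr
    have e5 : ((n - J).choose k : ℝ) * (n : ℝ) ^ k ≤ (3 / 4) ^ k * n.choose k * (n : ℝ) ^ k := by
      refine a1.trans ?_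
      calc (n.choose k : ℝ) * ((n - J : ℕ) : ℝ) ^ k ≤ n.choose k * ((3 / 4) ^ k * (n : ℝ) ^ k) := by
            gcongr
        _ = _ := by ring
    exact le_of_mul_le_mul_right e5 (by positivity)
  calc |tailEst q n J m k| ≤ ∑ i ∈ Finset.range m, B * (((n - k).choose J : ℝ) / (n.choose J : ℝ)) *
        ((k.choose (i + 1) : ℝ) * (1 / 4) ^ (i + 1)) :=
        (Finset.abs_sum_le_sum_abs _ _).trans (Finset.sum_le_sum hterm)
    _ = B * (((n - k).choose J : ℝ) / (n.choose J : ℝ)) *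
        ∑ i ∈ Finset.range m, (k.choose (i + 1) : ℝ) * (1 / 4) ^ (i + 1) := by
        rw [Finset.mul_sum]
    _ ≤ B * (3 / 4) ^ k * (1 + 1 / 4) ^ k := by
        gcongr
        exact sum_choose_succ_mul_le (by norm_num)
    _ = B * (15 / 16) ^ k := by
        rw [mul_assoc, ← mul_pow]; norm_num

theorem mul_tailEst_diff_sq_le {q : ℕ → ℝ} {n J m k : ℕ} {B : ℝ} (hB : 0 ≤ B)
    (hq : ∀ i, 0 ≤ q i ∧ q i ≤ B * ((J : ℝ) / 4) ^ (i + 1) / ((i + 1).factorial : ℝ))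
    (hJ : 1 ≤ J) (hkn : k ≤ n) (h4 : n ≤ 4 * J) (h2 : 2 * J + m ≤ n) :
    (k : ℝ) * (tailEst q n J m k - tailEst q n J m (k - 1)) ^ 2 ≤ 32 * B ^ 2 ∧
    (k : ℝ) * (tailEst q n J m k - tailEst q n J m (k - 1)) ^ 2 ≤ 4 * B ^ 2 * k := by
  rcases Nat.eq_zero_or_pos k with rfl | hk
  · simp; positivity
  obtain ⟨j, rfl⟩ : ∃ j, k = j + 1 := ⟨k - 1, by omega⟩
  rw [Nat.add_sub_cancel]
  have a1 := abs_tailEst_le hB hq hJ hkn h4 h2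
  have a2 := abs_tailEst_le (k := j) hB hq hJ (by omega) h4 h2
  have hr0 : (0 : ℝ) ≤ (15 / 16) ^ j := by positivity
  have hr1 : ((15 / 16 : ℝ)) ^ j ≤ 1 := pow_le_one₀ (by norm_num) (by norm_num)
  have a3 : |tailEst q n J m (j + 1) - tailEst q n J m j| ≤ 2 * B * (15 / 16) ^ j := by
    refine (abs_sub _ _).trans ?_
    have : B * (15 / 16 : ℝ) ^ (j + 1) ≤ B * (15 / 16) ^ j := by
      gcongr ?_ * ?_
      exact pow_le_pow_of_le_one (by norm_num) (by norm_num) (by omega)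
    linarith
  have a4 : (tailEst q n J m (j + 1) - tailEst q n J m j) ^ 2 ≤ 4 * B ^ 2 * ((15 / 16) ^ j) ^ 2 := by
    rw [← sq_abs]
    calc |tailEst q n J m (j + 1) - tailEst q n J m j| ^ 2 ≤ (2 * B * (15 / 16) ^ j) ^ 2 := by
          gcongr
      _ = _ := by ring
  have hbern : ((j + 1 : ℕ) : ℝ) * ((15 / 16 : ℝ) ^ j) ^ 2 ≤ 8 := by
    have h := one_add_mul_le_pow (by norm_num : (-2 : ℝ) ≤ 1 / 8) j
    have h' : (15 / 16 : ℝ) ^ j * (15 / 16 : ℝ) ^ j * (1 + 1 / 8) ^ j ≤ 1 := by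
      rw [← mul_pow, ← mul_pow]
      exact pow_le_one₀ (by norm_num) (by norm_num)
    push_cast
    nlinarith [mul_nonneg hr0 hr0]
  constructor
  · calc ((j + 1 : ℕ) : ℝ) * (tailEst q n J m (j + 1) - tailEst q n J m j) ^ 2
        ≤ ((j + 1 : ℕ) : ℝ) * (4 * B ^ 2 * ((15 / 16) ^ j) ^ 2) := by gcongr
      _ = 4 * B ^ 2 * (((j + 1 : ℕ) : ℝ) * ((15 / 16 : ℝ) ^ j) ^ 2) := by ring
      _ ≤ 4 * B ^ 2 * 8 := by gcongr
      _ = 32 * B ^ 2 := by ring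
  · calc ((j + 1 : ℕ) : ℝ) * (tailEst q n J m (j + 1) - tailEst q n J m j) ^ 2
        ≤ ((j + 1 : ℕ) : ℝ) * (4 * B ^ 2 * 1) := by
          gcongr
          refine a4.trans ?_
          gcongr
          exact pow_le_one₀ hr0 hr1
      _ = _ := by ring

theorem log_one_add_sq_le {t : ℝ} (ht : 0 ≤ t) : Real.log (1 + t) ^ 2 ≤ 4 * t := by
  set s := Real.sqrt (1 + t) with hs
  have hs2 : s ^ 2 = 1 + t := Real.sq_sqrt (by linarith)
  have hs1 : 1 ≤ s := by rw [hs]; exact Real.one_le_sqrt.2 (by linarith)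
  have h0 : 0 ≤ Real.log (1 + t) := Real.log_nonneg (by linarith)
  have h1 : Real.log (1 + t) ≤ 2 * (s - 1) := by
    rw [← hs2, Real.log_pow]
    have := Real.log_le_sub_one_of_pos (by linarith : 0 < s)
    push_cast; linarith
  nlinarith

theorem mul_log_ratio_sq_le {n k : ℕ} (hkn : k ≤ n) {p : ℝ} (hp : 0 < p) :
    (k : ℝ) * (2 + Real.log (2 * n / k)) ^ 2 ≤
      2 * k * (2 + Real.log (2 / p)) ^ 2 + 8 * (n * p) := by
  rcases Nat.eq_zero_or_pos k with rfl | hk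
  · simp; positivity
  have hk0 : (0 : ℝ) < k := by exact_mod_cast hk
  have hkr : (k : ℝ) ≤ n := by exact_mod_cast hkn
  have hn0 : (0 : ℝ) < n := by linarith
  set t : ℝ := n * p / k with ht
  have ht0 : 0 < t := by positivity
  have e : (2 : ℝ) * n / k = 2 / p * t := by rw [ht]; field_simp
  have h1 : Real.log (2 * n / k) ≤ Real.log (2 / p) + Real.log (1 + t) := by
    rw [e, Real.log_mul (by positivity) (by positivity)]
    gcongr
    linarith
  have h0 : 0 ≤ Real.log (2 * n / k) := by
    apply Real.log_nonneg
    rw [le_div_iff₀ hk0]; linarith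
  have h2 := log_one_add_sq_le ht0.le
  set A := Real.log (2 / p)
  have h3 : (2 + Real.log (2 * n / k)) ^ 2 ≤ 2 * (2 + A) ^ 2 + 8 * t := by
    calc (2 + Real.log (2 * n / k)) ^ 2 ≤ ((2 + A) + Real.log (1 + t)) ^ 2 := by
          apply pow_le_pow_left₀ (by linarith); linarith
      _ ≤ 2 * (2 + A) ^ 2 + 2 * Real.log (1 + t) ^ 2 := by
          nlinarith [sq_nonneg ((2 + A) - Real.log (1 + t))]
      _ ≤ _ := by linarith
  have h4 : (k : ℝ) * t = n * p := by rw [ht]; field_simp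
  calc (k : ℝ) * (2 + Real.log (2 * n / k)) ^ 2 ≤ k * (2 * (2 + A) ^ 2 + 8 * t) := by gcongr
    _ = 2 * k * (2 + A) ^ 2 + 8 * (k * t) := by ring
    _ = _ := by rw [h4]

theorem sum_seqWeight_symCount {κ : Type*} [Fintype κ] [DecidableEq κ] {p : κ → ℝ}
    (h1 : ∑ a, p a = 1) (s : κ) (n : ℕ) :
    ∑ x : Fin n → κ, seqWeight p x * (symCount s x : ℝ) = n * p s := by
  have := sum_seqWeight_choose_mul h1 s n 1 0
  simpa using this

theorem exists_entropy_estimator (S : ℕ) {n m J : ℕ} (hm : 2 ≤ m) (hJ : 2 ≤ J) (h4 : n ≤ 4 * J)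
    (h2 : 2 * J + m ≤ n) :
    ∃ est : (Fin n → Fin S) → ℝ, ∀ p : Fin S → ℝ, IsDist p →
      |(∑ x, seqWeight p x * est x) - entropy p| ≤
        ∑ a, 2 * p a * Real.log (1 + 1 / ((m : ℝ) * J / 12 * p a)) ∧
      ∑ x, seqWeight p x * (est x - ∑ y, seqWeight p y * est y) ^ 2 ≤
        (4 * ∑ a, p a * (2 + Real.log (2 / p a)) ^ 2 + 16) / n +
          64 * (2 ^ m / ((J : ℝ) - 1)) ^ 2 * min (S : ℝ) n := by
  have hJ0 : (2 : ℝ) ≤ J := by exact_mod_cast hJ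
  have hn0 : (0 : ℝ) < n := by exact_mod_cast (by omega : 0 < n)
  obtain ⟨q, hq, hbias⟩ := exists_debias_coeffs hm hJ (b := (J : ℝ) / 4) (by linarith) (by linarith)
  set B : ℝ := 2 ^ m / ((J : ℝ) - 1) with hBdef
  have hB : 0 ≤ B := div_nonneg (by positivity) (by linarith)
  have hq' : ∀ i, 0 ≤ q i ∧ q i ≤ B * ((J : ℝ) / 4) ^ (i + 1) / ((i + 1).factorial : ℝ) := by
    intro i
    refine ⟨(hq i).1, (hq i).2.trans (le_of_eq ?_)⟩
    rw [hBdef]; ring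
  let g : ℕ → ℝ := fun k => zhangEst n J k + tailEst q n J m k
  refine ⟨fun x => ∑ a, g (symCount a x), fun p hp => ⟨?_, ?_⟩⟩
  · have hmean : ∀ a, ∑ x : Fin n → Fin S, seqWeight p x * g (symCount a x) =
        ∑ j ∈ Finset.Ico 1 J, p a * (1 - p a) ^ j / j +
          ∑ i ∈ Finset.range m, (-1) ^ i * q i * (p a ^ (i + 1) * (1 - p a) ^ J) := by
      intro a
      rw [← sum_seqWeight_zhangEst hp.2 a (by omega : 1 ≤ n) (by omega : J ≤ n),
        ← sum_seqWeight_tailEst hp.2 a q (by omega : J + m ≤ n), ← Finset.sum_add_distrib]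
      exact Finset.sum_congr rfl fun x _ => by simp only [g]; ring
    have hsw : ∑ x : Fin n → Fin S, seqWeight p x * ∑ a, g (symCount a x) =
        ∑ a, ∑ x : Fin n → Fin S, seqWeight p x * g (symCount a x) := by
      simp_rw [Finset.mul_sum]
      exact Finset.sum_comm
    rw [hsw, entropy, ← Finset.sum_sub_distrib]
    refine (Finset.abs_sum_le_sum_abs _ _).trans (Finset.sum_le_sum fun a _ => ?_)
    rw [hmean a, abs_sub_comm]
    rcases (hp.1 a).eq_or_lt with h | h
    · rw [← h]; simp
    · have hp1 : p a ≤ 1 := by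
        rw [← hp.2]; exact Finset.single_le_sum (fun i _ => hp.1 i) (Finset.mem_univ a)
      have := hbias (p a) h hp1
      rwa [show (m : ℝ) * (J / 4) / 3 = m * J / 12 by ring] at this
  · refine (variance_sum_symCount_le hp.1 hp.2 g).trans ?_
    have hpt : ∀ x : Fin n → Fin S, seqWeight p x *
        ∑ a, (symCount a x : ℝ) * (g (symCount a x) - g (symCount a x - 1)) ^ 2 ≤
        ∑ a, (2 / n ^ 2) * (2 * (2 + Real.log (2 / p a)) ^ 2 * (seqWeight p x * symCount a x) +
          8 * n * (p a * seqWeight p x)) + seqWeight p x * (64 * B ^ 2 * min (S : ℝ) n) := by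
      intro x
      have hw := seqWeight_nonneg hp.1 x
      have hsplit : ∀ a, (symCount a x : ℝ) * (g (symCount a x) - g (symCount a x - 1)) ^ 2 ≤
          2 * ((symCount a x : ℝ) * (zhangEst n J (symCount a x) - zhangEst n J (symCount a x - 1)) ^ 2)
          + 2 * ((symCount a x : ℝ) *
            (tailEst q n J m (symCount a x) - tailEst q n J m (symCount a x - 1)) ^ 2) := by
        intro a
        have hc : (0 : ℝ) ≤ symCount a x := Nat.cast_nonneg _
        rw [← mul_add, ← mul_add, mul_left_comm]
        refine mul_le_mul_of_nonneg_left ?_ hc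
        simp only [g]
        nlinarith [sq_nonneg ((zhangEst n J (symCount a x) - zhangEst n J (symCount a x - 1)) -
          (tailEst q n J m (symCount a x) - tailEst q n J m (symCount a x - 1)))]
      have htail : ∑ a, (symCount a x : ℝ) *
            (tailEst q n J m (symCount a x) - tailEst q n J m (symCount a x - 1)) ^ 2 ≤
            32 * B ^ 2 * min (S : ℝ) n := by
        have hB2 : 0 ≤ 32 * B ^ 2 := by positivity
        rw [mul_min_of_nonneg _ _ hB2]
        refine le_min ?_ ?_
        · refine (Finset.sum_le_sum fun a _ => (mul_tailEst_diff_sq_le hB hq' (by omega)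
            (symCount_le a x) h4 h2).1).trans ?_
          simp [mul_comm]
        · refine (Finset.sum_le_sum fun a _ => (mul_tailEst_diff_sq_le hB hq' (by omega)
            (symCount_le a x) h4 h2).2).trans ?_
          rw [← Finset.mul_sum]
          have : ∑ a, (symCount a x : ℝ) = n := by exact_mod_cast sum_symCount x
          rw [this]
          nlinarith [sq_nonneg B]
      have hz : ∀ a, seqWeight p x * (2 * ((symCount a x : ℝ) *
          (zhangEst n J (symCount a x) - zhangEst n J (symCount a x - 1)) ^ 2)) ≤
          (2 / n ^ 2) * (2 * (2 + Real.log (2 / p a)) ^ 2 * (seqWeight p x * symCount a x) +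
          8 * n * (p a * seqWeight p x)) := by
        intro a
        rcases Nat.eq_zero_or_pos (symCount a x) with h | h
        · rw [h]; simp
          have := hp.1 a
          positivity
        rcases (hp.1 a).eq_or_lt with h' | h'
        · have hw0 : seqWeight p x = 0 := by
            obtain ⟨j, hj⟩ := Finset.card_pos.1 h
            rw [Finset.mem_filter] at hj
            exact Finset.prod_eq_zero (Finset.mem_univ j) (by rw [hj.2, ← h'])
          rw [hw0]; simp
        · have b1 := abs_zhangEst_sub_le h (symCount_le a x) (by omega : 2 ≤ n) (by omega : 2 * J ≤ n)
          have b2 := mul_log_ratio_sq_le (symCount_le a x) h'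
          have b3 : (zhangEst n J (symCount a x) - zhangEst n J (symCount a x - 1)) ^ 2 ≤
              ((2 + Real.log (2 * n / symCount a x)) / n) ^ 2 := by
            rw [← sq_abs]; exact pow_le_pow_left₀ (abs_nonneg _) b1 2
          calc seqWeight p x * (2 * ((symCount a x : ℝ) *
                (zhangEst n J (symCount a x) - zhangEst n J (symCount a x - 1)) ^ 2))
              ≤ seqWeight p x * (2 * ((symCount a x : ℝ) *
                ((2 + Real.log (2 * n / symCount a x)) / n) ^ 2)) := by gcongr
            _ = seqWeight p x * (2 / n ^ 2) *
                ((symCount a x : ℝ) * (2 + Real.log (2 * n / symCount a x)) ^ 2) := by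
                rw [div_pow]; ring
            _ ≤ seqWeight p x * (2 / n ^ 2) *
                (2 * symCount a x * (2 + Real.log (2 / p a)) ^ 2 + 8 * (n * p a)) :=
                mul_le_mul_of_nonneg_left b2 (by positivity)
            _ = _ := by ring
      calc seqWeight p x * ∑ a, (symCount a x : ℝ) * (g (symCount a x) - g (symCount a x - 1)) ^ 2
          ≤ seqWeight p x * ∑ a, (2 * ((symCount a x : ℝ) *
            (zhangEst n J (symCount a x) - zhangEst n J (symCount a x - 1)) ^ 2)
            + 2 * ((symCount a x : ℝ) *
            (tailEst q n J m (symCount a x) - tailEst q n J m (symCount a x - 1)) ^ 2)) :=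
            mul_le_mul_of_nonneg_left (Finset.sum_le_sum fun a _ => hsplit a) hw
        _ = ∑ a, seqWeight p x * (2 * ((symCount a x : ℝ) *
            (zhangEst n J (symCount a x) - zhangEst n J (symCount a x - 1)) ^ 2)) +
            seqWeight p x * (2 * ∑ a, (symCount a x : ℝ) *
            (tailEst q n J m (symCount a x) - tailEst q n J m (symCount a x - 1)) ^ 2) := by
            rw [Finset.sum_add_distrib, mul_add, ← Finset.mul_sum, ← Finset.mul_sum]
            simp_rw [← Finset.mul_sum]
        _ ≤ _ := by
            refine add_le_add (Finset.sum_le_sum fun a _ => hz a) ?_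
            refine mul_le_mul_of_nonneg_left ?_ hw
            linarith
    refine (Finset.sum_le_sum fun x _ => hpt x).trans (le_of_eq ?_)
    have hW : ∑ x : Fin n → Fin S, seqWeight p x = 1 := by rw [sum_seqWeight, hp.2, one_pow]
    rw [Finset.sum_add_distrib, ← Finset.sum_mul, hW, Finset.sum_comm]
    have hcol : ∀ a, ∑ x : Fin n → Fin S, (2 / (n : ℝ) ^ 2) *
        (2 * (2 + Real.log (2 / p a)) ^ 2 * (seqWeight p x * symCount a x) +
          8 * n * (p a * seqWeight p x)) =
        (4 * (p a * (2 + Real.log (2 / p a)) ^ 2) + 16 * p a) / n := by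
      intro a
      rw [← Finset.mul_sum, Finset.sum_add_distrib, ← Finset.mul_sum, ← Finset.mul_sum,
        ← Finset.mul_sum, sum_seqWeight_symCount hp.2, hW]
      field_simp
      ring
    simp_rw [hcol]
    rw [← Finset.sum_div, Finset.sum_add_distrib, ← Finset.mul_sum, ← Finset.mul_sum, hp.2]
    ring

theorem IsDist.le_one {S : ℕ} {p : Fin S → ℝ} (hp : IsDist p) (a : Fin S) : p a ≤ 1 := by
  rw [← hp.2]; exact Finset.single_le_sum (fun i _ => hp.1 i) (Finset.mem_univ a)

theorem IsDist.term_nonneg {S : ℕ} {p : Fin S → ℝ} (hp : IsDist p) (a : Fin S) :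
    0 ≤ -(p a * Real.log (p a)) := by
  have := Real.log_nonpos (hp.1 a) (hp.le_one a)
  nlinarith [hp.1 a]

theorem IsDist.entropy_nonneg {S : ℕ} {p : Fin S → ℝ} (hp : IsDist p) : 0 ≤ entropy p :=
  Finset.sum_nonneg fun a _ => hp.term_nonneg a

theorem mul_log_sq_le_sqrt {p : ℝ} (hp : 0 < p) (hp1 : p ≤ 1) :
    p * Real.log p ^ 2 ≤ 16 * Real.sqrt p := by
  set s := Real.sqrt (Real.sqrt p) with hs
  have hs0 : 0 < s := Real.sqrt_pos.2 (Real.sqrt_pos.2 hp)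
  have h2 : s ^ 2 = Real.sqrt p := Real.sq_sqrt (Real.sqrt_nonneg p)
  have h4 : s ^ 4 = p := by
    rw [show s ^ 4 = (s ^ 2) ^ 2 by ring, h2, Real.sq_sqrt hp.le]
  rw [← h2]
  have hl : Real.log p = 4 * Real.log s := by rw [← h4, Real.log_pow]; norm_num
  have h1 : -Real.log s ≤ 1 / s := by
    have := Real.log_le_sub_one_of_pos (inv_pos.2 hs0)
    rw [Real.log_inv] at this
    rw [one_div]; linarith
  have hs1 : s ≤ 1 := by
    by_contra h
    push Not at h
    have : 1 < s ^ 4 := one_lt_pow₀ h (by norm_num)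
    linarith
  have h0 : 0 ≤ -Real.log s := by have := Real.log_nonpos hs0.le hs1; linarith
  have h3 : Real.log s ^ 2 ≤ (1 / s) ^ 2 := by
    rw [← neg_sq]; exact pow_le_pow_left₀ h0 h1 2
  rw [hl, ← h4]
  calc s ^ 4 * (4 * Real.log s) ^ 2 = 16 * s ^ 4 * Real.log s ^ 2 := by ring
    _ ≤ 16 * s ^ 4 * (1 / s) ^ 2 := by gcongr
    _ = 16 * s ^ 2 := by field_simp

theorem sum_mul_log_sq_le {S : ℕ} (hS : 1 ≤ S) {p : Fin S → ℝ} (hp : IsDist p) :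
    ∑ a, p a * (2 + Real.log (2 / p a)) ^ 2 ≤ 4 * Real.log S * entropy p + 48 := by
  have hS0 : (1 : ℝ) ≤ S := by exact_mod_cast hS
  have hlS : 0 ≤ Real.log S := Real.log_nonneg hS0
  have hterm : ∀ a, p a * (2 + Real.log (2 / p a)) ^ 2 ≤
      4 * Real.log S * -(p a * Real.log (p a)) + 16 * p a + 32 / S := by
    intro a
    have hnn := hp.term_nonneg a
    rcases (hp.1 a).eq_or_lt with h | h
    · rw [← h]; simp; positivity
    have h1 := hp.le_one a
    have e : Real.log (2 / p a) = Real.log 2 - Real.log (p a) := Real.log_div (by norm_num) h.ne'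
    have hl2 : Real.log 2 ≤ 0.7 := by linarith [Real.log_two_lt_d9]
    have hl0 : 0 ≤ Real.log 2 := Real.log_nonneg (by norm_num)
    have hq : (2 + Real.log (2 / p a)) ^ 2 ≤ 16 + 2 * Real.log (p a) ^ 2 := by
      rw [e]
      nlinarith [sq_nonneg ((2 + Real.log 2) + Real.log (p a))]
    have hsq : 2 * (p a * Real.log (p a) ^ 2) ≤
        4 * Real.log S * -(p a * Real.log (p a)) + 32 / S := by
      have hlp : Real.log (p a) ≤ 0 := Real.log_nonpos h.le h1
      rcases le_or_gt (1 / (S : ℝ) ^ 2) (p a) with hc | hc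
      · have : -Real.log (p a) ≤ 2 * Real.log S := by
          have h3 := Real.log_le_log (by positivity) hc
          rw [one_div, Real.log_inv, Real.log_pow] at h3
          push_cast at h3
          linarith
        have h4 : 0 ≤ 32 / (S : ℝ) := by positivity
        have h5 : -(p a * Real.log (p a)) * (-Real.log (p a)) ≤
            -(p a * Real.log (p a)) * (2 * Real.log S) := mul_le_mul_of_nonneg_left this hnn
        linarith
      · have h3 := mul_log_sq_le_sqrt h h1
        have h4 : Real.sqrt (p a) ≤ 1 / S := by
          rw [Real.sqrt_le_left (by positivity), div_pow, one_pow]; exact hc.le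
        have h5 : 0 ≤ 4 * Real.log S * -(p a * Real.log (p a)) := by positivity
        have h6 : 32 / (S : ℝ) = 32 * (1 / S) := by ring
        rw [h6]; linarith
    calc p a * (2 + Real.log (2 / p a)) ^ 2 ≤ p a * (16 + 2 * Real.log (p a) ^ 2) := by gcongr
      _ = 16 * p a + 2 * (p a * Real.log (p a) ^ 2) := by ring
      _ ≤ _ := by linarith
  refine (Finset.sum_le_sum fun a _ => hterm a).trans (le_of_eq ?_)
  rw [Finset.sum_add_distrib, Finset.sum_add_distrib, ← Finset.mul_sum, ← Finset.mul_sum, hp.2,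
    entropy]
  have : (S : ℝ) ≠ 0 := by positivity
  simp
  field_simp
  ring

/-- The estimator with its tuning parameters chosen as functions of the sample size. -/
theorem exists_tuned_estimator {S n : ℕ} (hS : 1 ≤ S) (hn : 768 ≤ Real.log n) :
    ∃ est : (Fin n → Fin S) → ℝ, ∀ p : Fin S → ℝ, IsDist p →
      |(∑ x, seqWeight p x * est x) - entropy p| ≤
        ∑ a, 2 * p a * Real.log (1 + 1 / ((n * Real.log n / 768) * p a)) ∧
      ∑ x, seqWeight p x * (est x - ∑ y, seqWeight p y * est y) ^ 2 ≤
        (16 * Real.log S * entropy p + 208) / n +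
          4096 * ((n : ℝ) ^ (1 / 4 : ℝ) / n ^ 2) * min (S : ℝ) n := by
  have hn0 : (0 : ℝ) < n := by
    by_contra h
    have : (n : ℝ) = 0 := le_antisymm (not_lt.1 h) (Nat.cast_nonneg n)
    rw [this] at hn; norm_num at hn
  have hlogn : Real.log n ≤ n := (Real.log_le_sub_one_of_pos hn0).trans (by linarith)
  have hn768 : (768 : ℝ) ≤ n := by linarith
  set m := ⌊Real.log n / 8⌋₊ with hm
  set J := ⌈(n : ℝ) / 4⌉₊ with hJ
  have m1 : (m : ℝ) ≤ Real.log n / 8 := Nat.floor_le (by linarith)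
  have m2 : Real.log n / 8 < m + 1 := Nat.lt_floor_add_one _
  have j1 : (n : ℝ) / 4 ≤ J := Nat.le_ceil _
  have j2 : (J : ℝ) < n / 4 + 1 := Nat.ceil_lt_add_one (by linarith)
  have hm2 : 2 ≤ m := by
    have : (2 : ℝ) ≤ m := by linarith
    exact_mod_cast this
  have hJ2 : 2 ≤ J := by
    have : (2 : ℝ) ≤ J := by linarith
    exact_mod_cast this
  have h4 : n ≤ 4 * J := by
    have : (n : ℝ) ≤ 4 * J := by linarith
    exact_mod_cast this
  have h2 : 2 * J + m ≤ n := by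
    have : (2 : ℝ) * J + m ≤ n := by linarith
    exact_mod_cast this
  obtain ⟨est, hest⟩ := exists_entropy_estimator S hm2 hJ2 h4 h2
  refine ⟨est, fun p hp => ?_⟩
  obtain ⟨hb, hv⟩ := hest p hp
  constructor
  · refine hb.trans (Finset.sum_le_sum fun a _ => ?_)
    rcases (hp.1 a).eq_or_lt with h | h
    · rw [← h]; simp
    have ha : n * Real.log n / 768 ≤ (m : ℝ) * J / 12 := by
      have : Real.log n / 16 * (n / 4) ≤ m * J := by
        apply mul_le_mul <;> linarith
      linarith
    have hpos : 0 < n * Real.log n / 768 * p a := by positivity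
    gcongr
  · refine hv.trans (add_le_add ?_ ?_)
    · have := sum_mul_log_sq_le hS hp
      exact div_le_div_of_nonneg_right (by linarith) hn0.le
    · refine mul_le_mul_of_nonneg_right ?_ (by positivity)
      have hJ1 : (n : ℝ) / 8 ≤ (J : ℝ) - 1 := by linarith
      have h2m : ((2 : ℝ) ^ m) ^ 2 ≤ (n : ℝ) ^ (1 / 4 : ℝ) := by
        have h2e : (2 : ℝ) ≤ Real.exp 1 := by have := Real.add_one_le_exp (1 : ℝ); linarith
        calc ((2 : ℝ) ^ m) ^ 2 ≤ ((Real.exp 1) ^ m) ^ 2 := by gcongr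
          _ = Real.exp (2 * m) := by
            rw [← pow_mul, ← Real.exp_nat_mul]; congr 1; push_cast; ring
          _ ≤ Real.exp (Real.log n * (1 / 4)) := by
            apply Real.exp_le_exp.2; linarith
          _ = _ := by rw [Real.rpow_def_of_pos hn0]
      rw [div_pow]
      calc 64 * (((2 : ℝ) ^ m) ^ 2 / ((J : ℝ) - 1) ^ 2)
          ≤ 64 * ((n : ℝ) ^ (1 / 4 : ℝ) / ((n : ℝ) / 8) ^ 2) := by gcongr
        _ = _ := by field_simp; norm_num

theorem exists_eighth_root {y : ℝ} (hy : 1 ≤ y) :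
    ∃ r : ℝ, 1 ≤ r ∧ r ^ 8 = y ∧ y ^ (1 / 4 : ℝ) = r ^ 2 ∧ Real.log y ≤ 8 * r := by
  have hy0 : 0 < y := by linarith
  refine ⟨y ^ (1 / 8 : ℝ), Real.one_le_rpow hy (by norm_num), ?_, ?_, ?_⟩
  · rw [← Real.rpow_natCast, ← Real.rpow_mul hy0.le]; norm_num
  · rw [← Real.rpow_natCast, ← Real.rpow_mul hy0.le]; norm_num
  · have := Real.log_le_rpow_div hy0.le (show (0 : ℝ) < 1 / 8 by norm_num)
    linarith

theorem mse_le {S n : ℕ} {p : Fin S → ℝ} (hp : IsDist p) {est : (Fin n → Fin S) → ℝ} {b V : ℝ}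
    (hb : |(∑ x, seqWeight p x * est x) - entropy p| ≤ b)
    (hV : ∑ x, seqWeight p x * (est x - ∑ y, seqWeight p y * est y) ^ 2 ≤ V) :
    ∑ x, seqWeight p x * (est x - entropy p) ^ 2 ≤ V + b ^ 2 := by
  rw [variance_decomp hp.2]
  exact add_le_add hV (sq_le_sq' (by linarith [neg_abs_le ((∑ x, seqWeight p x * est x) - entropy p)])
    ((le_abs_self _).trans hb))

/-- Upper bound valid whenever the sample size is large enough. -/
theorem minimaxRisk_le_of_large_sample {S n : ℕ} {H : ℝ} (hn : 768 ≤ Real.log n) (hS : 2 ≤ S)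
    (hH : 1 ≤ H) (hHS : H ≤ Real.log S) :
    minimaxRisk S n H ≤ ENNReal.ofReal
      (3000000 * ((S : ℝ) ^ 2 / (n * Real.log n) ^ 2 + H * Real.log S / n)) := by
  obtain ⟨est, hest⟩ := exists_tuned_estimator (S := S) (n := n) (by omega) hn
  refine minimaxRisk_le_ofReal est fun p hp hpH => ?_
  obtain ⟨hb, hv⟩ := hest p hp
  have hn0 : (1 : ℝ) ≤ n := by
    rcases Nat.eq_zero_or_pos n with h | h
    · rw [h] at hn; norm_num at hn
    · exact_mod_cast h
  have hS0 : (1 : ℝ) ≤ S := by exact_mod_cast (by omega : 1 ≤ S)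
  obtain ⟨r, hr1, hr8, hr2, hrl⟩ := exists_eighth_root hn0
  set l := Real.log n with hl
  have hb' : |(∑ x, seqWeight p x * est x) - entropy p| ≤ 1536 * S / (n * l) := by
    refine hb.trans ((Finset.sum_le_sum (g := fun _ => 1536 / (n * l)) fun a _ => ?_).trans ?_)
    · rcases (hp.1 a).eq_or_lt with h | h
      · rw [← h]; simp; positivity
      · have h1 : 0 < 1 / ((n * l / 768) * p a) := by positivity
        have h2 := Real.log_le_sub_one_of_pos (show 0 < 1 + 1 / ((n * l / 768) * p a) by positivity)
        calc 2 * p a * Real.log (1 + 1 / ((n * l / 768) * p a))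
            ≤ 2 * p a * (1 / ((n * l / 768) * p a)) := by
              apply mul_le_mul_of_nonneg_left _ (by positivity); linarith
          _ = _ := by field_simp; norm_num
    · simp; apply le_of_eq; ring
  refine (mse_le hp hb' hv).trans ?_
  have hA : (16 * Real.log S * entropy p + 208) / n ≤ 224 * (H * Real.log S / n) := by
    rw [← mul_div_assoc]
    refine div_le_div_of_nonneg_right ?_ (by linarith)
    have h1 : Real.log S * entropy p ≤ Real.log S * H :=
      mul_le_mul_of_nonneg_left hpH (by linarith)
    nlinarith
  have hB : (n : ℝ) ^ (1 / 4 : ℝ) / n ^ 2 * min (S : ℝ) n ≤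
      64 * ((S : ℝ) ^ 2 / (n * l) ^ 2) + H * Real.log S / n := by
    have hp1 : 0 ≤ 64 * ((S : ℝ) ^ 2 / (n * l) ^ 2) := by positivity
    have hp2 : 0 ≤ H * Real.log S / n := by
      apply div_nonneg (mul_nonneg _ _) <;> linarith
    have h0 : (n : ℝ) ^ (1 / 4 : ℝ) / n ^ 2 * min (S : ℝ) n ≤ r ^ 2 / n ^ 2 * S := by
      rw [hr2]; exact mul_le_mul_of_nonneg_left (min_le_left _ _) (by positivity)
    rcases le_or_gt (r ^ 4) (S : ℝ) with h | h
    · have : r ^ 2 / (n : ℝ) ^ 2 * S ≤ 64 * ((S : ℝ) ^ 2 / (n * l) ^ 2) := by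
        rw [mul_pow, div_mul_eq_mul_div, ← mul_div_assoc,
          div_le_div_iff₀ (by positivity) (by positivity)]
        have hl2 : l ^ 2 ≤ 64 * r ^ 2 := by
          calc l ^ 2 ≤ (8 * r) ^ 2 := pow_le_pow_left₀ (by linarith) hrl 2
            _ = _ := by ring
        calc r ^ 2 * S * (n ^ 2 * l ^ 2) ≤ r ^ 2 * S * (n ^ 2 * (64 * r ^ 2)) := by gcongr
          _ = 64 * n ^ 2 * S * r ^ 4 := by ring
          _ ≤ 64 * n ^ 2 * S * S := by gcongr
          _ = _ := by ring
      linarith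
    · have : r ^ 2 / (n : ℝ) ^ 2 * S ≤ H * Real.log S / n := by
        rw [div_mul_eq_mul_div, div_le_div_iff₀ (by positivity) (by positivity)]
        have h1 : r ^ 2 * S ≤ n := by
          calc r ^ 2 * S ≤ r ^ 2 * r ^ 4 := by gcongr
            _ = r ^ 6 := by ring
            _ ≤ r ^ 8 := pow_le_pow_right₀ hr1 (by norm_num)
            _ = n := hr8
        have h2 : 1 ≤ H * Real.log S := by nlinarith
        calc r ^ 2 * S * n ≤ n * n := by gcongr
          _ = 1 * (n : ℝ) ^ 2 := by ring
          _ ≤ _ := by gcongr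
      linarith
  have hC : (1536 * S / (n * l)) ^ 2 = 2359296 * ((S : ℝ) ^ 2 / (n * l) ^ 2) := by
    rw [div_pow]; ring
  have hp1 : 0 ≤ (S : ℝ) ^ 2 / (n * l) ^ 2 := by positivity
  have hp2 : 0 ≤ H * Real.log S / n := by
    apply div_nonneg (mul_nonneg _ _) <;> linarith
  rw [hC, mul_assoc (4096 : ℝ)]
  linarith

theorem mul_log_one_add_div_le {p q c : ℝ} (hp : 0 < p) (hpq : p ≤ q) (hc : 0 ≤ c) :
    p * Real.log (1 + c / p) ≤ q * Real.log (1 + c / q) := by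
  have hq : 0 < q := hp.trans_le hpq
  have h0 : 0 ≤ c / q := by positivity
  have h := one_add_mul_self_le_rpow_one_add (s := c / q) (by linarith)
    (p := q / p) ((one_le_div hp).2 hpq)
  have e : 1 + q / p * (c / q) = 1 + c / p := by field_simp
  rw [e] at h
  have h1 := Real.log_le_log (by positivity) h
  rw [Real.log_rpow (by linarith)] at h1
  calc p * Real.log (1 + c / p) ≤ p * (q / p * Real.log (1 + c / q)) := by gcongr
    _ = _ := by field_simp

theorem bias_term_le {p a p0 : ℝ} (hp : 0 ≤ p) (hp1 : p ≤ 1) (ha : 1 < a) (hp0 : 0 < p0) :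
    p * Real.log (1 + 1 / (a * p)) ≤
      p0 * Real.log (1 + 1 / (a * p0)) +
        Real.log (1 + 1 / (a * p0)) * (-(p * Real.log p) / Real.log (Real.sqrt a)) +
        p * (1 / Real.sqrt a) := by
  have ha0 : 0 < a := by linarith
  have hs1 : 1 < Real.sqrt a := by rwa [Real.lt_sqrt (by norm_num), one_pow]
  have hlog : 0 < Real.log (Real.sqrt a) := Real.log_pos hs1
  have hL : 0 ≤ Real.log (1 + 1 / (a * p0)) := by
    apply Real.log_nonneg; have : 0 ≤ 1 / (a * p0) := by positivity
    linarith
  rcases hp.eq_or_lt with h | h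
  · rw [← h]; simp; apply mul_nonneg hp0.le; simpa using hL
  have hlp : 0 ≤ -Real.log p := by have := Real.log_nonpos hp hp1; linarith
  have t1 : 0 ≤ p0 * Real.log (1 + 1 / (a * p0)) := by positivity
  have t2 : 0 ≤ Real.log (1 + 1 / (a * p0)) * (-(p * Real.log p) / Real.log (Real.sqrt a)) := by
    rw [← mul_neg]; positivity
  have t3 : 0 ≤ p * (1 / Real.sqrt a) := by positivity
  rcases le_or_gt p p0 with h1 | h1
  · have := mul_log_one_add_div_le h h1 (c := 1 / a) (by positivity)
    rw [div_div, div_div] at this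
    linarith
  rcases le_or_gt p (1 / Real.sqrt a) with h2 | h2
  · have h3 : Real.log (1 + 1 / (a * p)) ≤ Real.log (1 + 1 / (a * p0)) := by gcongr
    have h4 : Real.log (Real.sqrt a) ≤ -Real.log p := by
      have := Real.log_le_log h h2
      rw [one_div, Real.log_inv] at this; linarith
    have h5 : p ≤ -(p * Real.log p) / Real.log (Real.sqrt a) := by
      rw [le_div_iff₀ hlog, ← mul_neg]
      exact mul_le_mul_of_nonneg_left h4 hp
    have h6 : p * Real.log (1 + 1 / (a * p)) ≤
        Real.log (1 + 1 / (a * p0)) * (-(p * Real.log p) / Real.log (Real.sqrt a)) := by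
      rw [mul_comm]
      exact mul_le_mul h3 h5 hp hL
    linarith
  · have h3 : 0 < 1 / (a * p) := by positivity
    have h4 := Real.log_le_sub_one_of_pos (show 0 < 1 + 1 / (a * p) by positivity)
    have h5 : 1 / (a * p) ≤ 1 / Real.sqrt a := by
      apply one_div_le_one_div_of_le (by positivity)
      rw [div_lt_iff₀ (by positivity)] at h2
      have : Real.sqrt a * Real.sqrt a = a := Real.mul_self_sqrt ha0.le
      calc Real.sqrt a = 1 * Real.sqrt a := by ring
        _ ≤ (p * Real.sqrt a) * Real.sqrt a := by gcongr
        _ = p * (Real.sqrt a * Real.sqrt a) := by ring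
        _ = a * p := by rw [this]; ring
    have : p * Real.log (1 + 1 / (a * p)) ≤ p * (1 / Real.sqrt a) := by
      apply mul_le_mul_of_nonneg_left _ hp; linarith
    linarith

theorem bias_sum_le {S : ℕ} (hS : 1 ≤ S) {p : Fin S → ℝ} (hp : IsDist p) {a w : ℝ}
    (ha : 1 < a) (hw : 0 < w) :
    ∑ i, p i * Real.log (1 + 1 / (a * p i)) ≤
      w * Real.log (1 + 1 / (a * (w / S))) +
        Real.log (1 + 1 / (a * (w / S))) * (entropy p / Real.log (Real.sqrt a)) +
        1 / Real.sqrt a := by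
  have hS0 : (0 : ℝ) < S := by exact_mod_cast hS
  refine (Finset.sum_le_sum fun i _ => bias_term_le (hp.1 i) (hp.le_one i) ha
    (show 0 < w / S by positivity)).trans (le_of_eq ?_)
  rw [Finset.sum_add_distrib, Finset.sum_add_distrib, ← Finset.mul_sum, ← Finset.mul_sum,
    ← Finset.sum_mul, ← Finset.sum_div, hp.2, entropy]
  simp
  field_simp

set_option maxHeartbeats 1000000 in
/-- Upper bound in the sparse-data regime. -/
theorem minimaxRisk_le_of_small_sample {S n : ℕ} {H : ℝ} (hS : 1536 ≤ Real.log S) (hn : 3 ≤ n)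
    (hH : 1 ≤ H) (hHS : H ≤ Real.log S)
    (hreg : Real.exp 1 * n * H * Real.log n < S * Real.log S) :
    minimaxRisk S n H ≤ ENNReal.ofReal
      (200000 * (H / Real.log S * Real.log (S * Real.log S / (n * H * Real.log n))) ^ 2) := by
  set s := Real.log S with hs
  set l := Real.log n with hl
  have hS1 : 1 ≤ S := by
    rcases Nat.eq_zero_or_pos S with h | h
    · rw [hs, h] at hS; norm_num at hS
    · exact h
  have hS0 : (0 : ℝ) < S := by exact_mod_cast hS1
  have hn0 : (3 : ℝ) ≤ n := by exact_mod_cast hn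
  have hn1 : (0 : ℝ) < n := by linarith
  have hl1 : 0 < l := Real.log_pos (by linarith)
  have hH0 : 0 < H := by linarith
  have hs0 : 0 < s := by linarith
  set x := S * s / (n * H * l) with hx
  have hxe : Real.exp 1 < x := by
    rw [hx, lt_div_iff₀ (by positivity)]; linarith
  have hx0 : 0 < x := (Real.exp_pos 1).trans hxe
  have hlx : 1 ≤ Real.log x := by
    rw [Real.le_log_iff_exp_le hx0]; exact hxe.le
  set ω := H / s with hω
  have hω0 : 0 < ω := by positivity
  have hωs : ω * s = H := by rw [hω]; field_simp
  have hω1 : 1 / s ≤ ω := by rw [hω]; gcongr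
  set r := Real.exp (s / 8) with hr
  have hr0 : 0 < r := Real.exp_pos _
  have hr1 : 1 ≤ r := Real.one_le_exp (by positivity)
  have hr8 : r ^ 8 = S := by
    rw [hr, ← Real.exp_nat_mul, ← Real.exp_log hS0]; congr 1; push_cast; ring
  have hr2 : Real.exp (s / 4) = r ^ 2 := by
    rw [hr, ← Real.exp_nat_mul]; congr 1; push_cast; ring
  have hs4 : s ^ 4 ≤ 6144 * r ^ 2 := by
    have := Real.pow_div_factorial_le_exp (x := s / 4) (by positivity) 4
    rw [hr2] at this
    norm_num [Nat.factorial] at this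
    linarith
  rcases le_or_gt (n : ℝ) (r ^ 4) with hc | hc
  · -- few samples: the zero estimator is enough
    have hl2 : l ≤ s / 2 := by
      have := Real.log_le_log hn1 hc
      rw [Real.log_pow, hr, Real.log_exp] at this; push_cast at this; linarith
    have hx1 : r ^ 2 ≤ x := by
      rw [hx, le_div_iff₀ (by positivity)]
      have h1 : s ≤ r ^ 2 := by
        have : s * 6144 ≤ s ^ 4 := by
          have : 6144 ≤ s ^ 3 := by
            calc (6144 : ℝ) ≤ 1536 ^ 3 := by norm_num
              _ ≤ s ^ 3 := pow_le_pow_left₀ (by norm_num) hS 3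
          nlinarith
        linarith
      calc r ^ 2 * (n * H * l) ≤ r ^ 2 * (r ^ 4 * s * (s / 2)) := by gcongr
        _ ≤ r ^ 2 * (r ^ 4 * r ^ 2 * (s / 1)) := by gcongr; norm_num
        _ = r ^ 8 * s := by ring
        _ = S * s := by rw [hr8]
    have hlx4 : s / 4 ≤ Real.log x := by
      have := Real.log_le_log (by positivity) hx1
      rw [Real.log_pow, hr, Real.log_exp] at this; push_cast at this; linarith
    refine minimaxRisk_le_ofReal (fun _ => 0) fun p hp hpH => ?_
    simp only [zero_sub, neg_sq]
    rw [← Finset.sum_mul, sum_seqWeight, hp.2, one_pow, one_mul]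
    have h1 : entropy p ≤ 4 * (ω * Real.log x) := by
      calc entropy p ≤ H := hpH
        _ = 4 * (ω * (s / 4)) := by rw [← hωs]; ring
        _ ≤ _ := by gcongr
    calc entropy p ^ 2 ≤ (4 * (ω * Real.log x)) ^ 2 := pow_le_pow_left₀ hp.entropy_nonneg h1 2
      _ = 16 * (ω * Real.log x) ^ 2 := by ring
      _ ≤ _ := by gcongr; norm_num
  · have hl2 : s / 2 < l := by
      have := Real.log_lt_log (by positivity) hc
      rw [Real.log_pow, hr, Real.log_exp] at this; push_cast at this; linarith
    have hl768 : 768 ≤ l := by linarith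
    obtain ⟨est, hest⟩ := exists_tuned_estimator (S := S) (n := n) hS1 hl768
    refine minimaxRisk_le_ofReal est fun p hp hpH => ?_
    obtain ⟨hb, hv⟩ := hest p hp
    set a := n * l / 768 with ha
    have hna : (n : ℝ) ≤ a := by
      rw [ha, le_div_iff₀ (by norm_num)]; gcongr
    have ha1 : 1 < a := by linarith
    have hsq : r ^ 2 ≤ Real.sqrt a := by
      rw [Real.le_sqrt (by positivity) (by linarith)]
      calc (r ^ 2) ^ 2 = r ^ 4 := by ring
        _ ≤ a := by linarith
    have hlsq : s / 4 ≤ Real.log (Real.sqrt a) := by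
      rw [← Real.log_exp (s / 4), hr2]
      exact Real.log_le_log (by positivity) hsq
    have hax : 1 / (a * (ω / S)) = 768 * x := by
      rw [ha, hω, hx]; field_simp
    have hL0 : Real.log (1 + 768 * x) ≤ 8 * Real.log x := by
      have h1 : 1 + 768 * x ≤ Real.exp 7 * x := by
        have h7 : (769 : ℝ) ≤ Real.exp 7 := by
          have := Real.exp_one_gt_d9
          have e : Real.exp 7 = Real.exp 1 ^ 7 := by rw [← Real.exp_nat_mul]; norm_num
          rw [e]
          calc (769 : ℝ) ≤ 2.7 ^ 7 := by norm_num
            _ ≤ _ := by gcongr; linarith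
        have : 1 ≤ x := (Real.one_le_exp (by norm_num)).trans hxe.le
        nlinarith
      have := Real.log_le_log (by positivity) h1
      rw [Real.log_mul (by positivity) hx0.ne', Real.log_exp] at this
      linarith
    have hL1 : 0 ≤ Real.log (1 + 768 * x) := Real.log_nonneg (by linarith)
    have hb' : |(∑ x, seqWeight p x * est x) - entropy p| ≤ 90 * (ω * Real.log x) := by
      have h1 := bias_sum_le hS1 hp ha1 hω0
      rw [hax] at h1
      have h2 : entropy p / Real.log (Real.sqrt a) ≤ 4 * ω := by
        rw [div_le_iff₀ (by linarith)]
        calc entropy p ≤ H := hpH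
          _ = 4 * ω * (s / 4) := by rw [← hωs]; ring
          _ ≤ _ := by gcongr
      have h3 : 1 / Real.sqrt a ≤ 4 * ω := by
        have : s / 4 ≤ Real.sqrt a := by
          have := Real.add_one_le_exp (s / 4)
          rw [hr2] at this; linarith
        calc 1 / Real.sqrt a ≤ 1 / (s / 4) := by gcongr
          _ = 4 * (1 / s) := by field_simp
          _ ≤ _ := by gcongr
      have h4 : Real.log (1 + 768 * x) * (entropy p / Real.log (Real.sqrt a)) ≤
          8 * Real.log x * (4 * ω) := by
        apply mul_le_mul hL0 h2 (div_nonneg hp.entropy_nonneg (by linarith)) (by positivity)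
      have h5 : ω * Real.log (1 + 768 * x) ≤ ω * (8 * Real.log x) := by gcongr
      have h6 : ω ≤ ω * Real.log x := le_mul_of_one_le_right hω0.le hlx
      refine hb.trans ?_
      have e : ∑ i, 2 * p i * Real.log (1 + 1 / (a * p i)) =
          2 * ∑ i, p i * Real.log (1 + 1 / (a * p i)) := by
        rw [Finset.mul_sum]; exact Finset.sum_congr rfl fun i _ => by ring
      rw [e]
      linarith
    refine (mse_le hp hb' hv).trans ?_
    have hV1 : (16 * s * entropy p + 208) / n ≤ (16 * s ^ 2 + 208) / r ^ 2 := by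
      apply div_le_div₀ (by positivity) _ (by positivity)
      · exact (pow_le_pow_right₀ hr1 (by norm_num)).trans hc.le
      · have : 16 * s * entropy p ≤ 16 * s * s := by gcongr; linarith
        linarith
    obtain ⟨q, hq1, hq8, hq2, -⟩ := exists_eighth_root (show (1 : ℝ) ≤ n by linarith)
    have hqr : r ≤ q ^ 2 := by
      by_contra h
      push Not at h
      have : (q ^ 2) ^ 4 < r ^ 4 := pow_lt_pow_left₀ h (by positivity) (by norm_num)
      rw [← pow_mul] at this
      norm_num at this
      linarith
    have hV2 : (n : ℝ) ^ (1 / 4 : ℝ) / n ^ 2 * min (S : ℝ) n ≤ 1 / r ^ 2 := by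
      rw [hq2]
      calc q ^ 2 / (n : ℝ) ^ 2 * min (S : ℝ) n ≤ q ^ 2 / (n : ℝ) ^ 2 * n := by
            gcongr; exact min_le_right _ _
        _ = q ^ 2 / n := by field_simp
        _ = 1 / (q ^ 2) ^ 3 := by rw [← hq8]; field_simp
        _ ≤ 1 / (r) ^ 3 := by gcongr
        _ ≤ 1 / r ^ 2 := by
          apply one_div_le_one_div_of_le (by positivity)
          exact pow_le_pow_right₀ hr1 (by norm_num)
    have hV3 : (16 * s ^ 2 + 208) / r ^ 2 + 4096 * (1 / r ^ 2) ≤ 17 * 6144 * (ω * Real.log x) ^ 2 := by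
      have h1 : (16 * s ^ 2 + 208) / r ^ 2 + 4096 * (1 / r ^ 2) ≤ 17 * s ^ 2 / r ^ 2 := by
        rw [mul_one_div, ← add_div]
        refine div_le_div_of_nonneg_right ?_ (by positivity)
        nlinarith
      have h2 : 17 * s ^ 2 / r ^ 2 ≤ 17 * 6144 * (1 / s) ^ 2 := by
        rw [one_div, inv_pow, ← div_eq_mul_inv, div_le_div_iff₀ (by positivity) (by positivity)]
        nlinarith
      have h3 : 1 / s ≤ ω * Real.log x :=
        hω1.trans (le_mul_of_one_le_right hω0.le hlx)
      have h4 : (1 / s) ^ 2 ≤ (ω * Real.log x) ^ 2 := pow_le_pow_left₀ (by positivity) h3 2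
      linarith
    have e : (90 * (ω * Real.log x)) ^ 2 = 8100 * (ω * Real.log x) ^ 2 := by ring
    have : 0 ≤ (ω * Real.log x) ^ 2 := sq_nonneg _
    rw [e, mul_assoc (4096 : ℝ)]
    linarith

/-- Replacing the coordinates of a product measure one at a time. -/
theorem sum_abs_product_sub_le {κ X : Type*} [Fintype κ] [Fintype X] {μ0 μ1 : κ → ℝ}
    (h0 : ∀ a, 0 ≤ μ0 a) (h1 : ∀ a, 0 ≤ μ1 a) (s0 : ∑ a, μ0 a = 1) (s1 : ∑ a, μ1 a = 1)
    {δ : ℝ} {s : ℕ} (Ψ : (Fin s → κ) → X → ℝ)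
    (h : ∀ (j : Fin s) (ω : Fin s → κ),
      ∑ x, |∑ a, (μ1 a - μ0 a) * Ψ (Function.update ω j a) x| ≤ δ) :
    ∑ x, |∑ ω, (seqWeight μ1 ω - seqWeight μ0 ω) * Ψ ω x| ≤ s * δ := by
  induction s with
  | zero => simp [seqWeight]
  | succ s ih =>
    have key : ∀ x, ∑ ω, (seqWeight μ1 ω - seqWeight μ0 ω) * Ψ ω x =
        ∑ y : Fin s → κ, seqWeight μ1 y * ∑ a, (μ1 a - μ0 a) * Ψ (Fin.cons a y) x +
        ∑ a, μ0 a * ∑ y : Fin s → κ, (seqWeight μ1 y - seqWeight μ0 y) * Ψ (Fin.cons a y) x := by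
      intro x
      rw [sum_fin_cons]
      simp_rw [Finset.mul_sum, seqWeight_cons]
      rw [Finset.sum_comm (γ := Fin s → κ), ← Finset.sum_add_distrib]
      refine Finset.sum_congr rfl fun a _ => ?_
      rw [← Finset.sum_add_distrib]
      exact Finset.sum_congr rfl fun y _ => by ring
    have b1 : ∑ x, |∑ y : Fin s → κ, seqWeight μ1 y *
        ∑ a, (μ1 a - μ0 a) * Ψ (Fin.cons a y) x| ≤ δ := by
      calc _ ≤ ∑ x, ∑ y : Fin s → κ, seqWeight μ1 y *
            |∑ a, (μ1 a - μ0 a) * Ψ (Fin.cons a y) x| := by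
            refine Finset.sum_le_sum fun x _ => (Finset.abs_sum_le_sum_abs _ _).trans (le_of_eq ?_)
            refine Finset.sum_congr rfl fun y _ => ?_
            rw [abs_mul, abs_of_nonneg (seqWeight_nonneg h1 y)]
        _ = ∑ y : Fin s → κ, seqWeight μ1 y *
            ∑ x, |∑ a, (μ1 a - μ0 a) * Ψ (Fin.cons a y) x| := by
            rw [Finset.sum_comm]; simp_rw [Finset.mul_sum]
        _ ≤ ∑ y : Fin s → κ, seqWeight μ1 y * δ := by
            refine Finset.sum_le_sum fun y _ =>
              mul_le_mul_of_nonneg_left ?_ (seqWeight_nonneg h1 y)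
            rcases isEmpty_or_nonempty κ with hκ | ⟨⟨a0⟩⟩
            · simp at s1
            have := h 0 (Fin.cons a0 y)
            simpa using this
        _ = δ := by rw [← Finset.sum_mul, sum_seqWeight, s1]; simp
    have b2 : ∑ x, |∑ a, μ0 a * ∑ y : Fin s → κ,
        (seqWeight μ1 y - seqWeight μ0 y) * Ψ (Fin.cons a y) x| ≤ s * δ := by
      calc _ ≤ ∑ x, ∑ a, μ0 a * |∑ y : Fin s → κ,
            (seqWeight μ1 y - seqWeight μ0 y) * Ψ (Fin.cons a y) x| := by
            refine Finset.sum_le_sum fun x _ => (Finset.abs_sum_le_sum_abs _ _).trans (le_of_eq ?_)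
            refine Finset.sum_congr rfl fun a _ => ?_
            rw [abs_mul, abs_of_nonneg (h0 a)]
        _ = ∑ a, μ0 a * ∑ x, |∑ y : Fin s → κ,
            (seqWeight μ1 y - seqWeight μ0 y) * Ψ (Fin.cons a y) x| := by
            rw [Finset.sum_comm]; simp_rw [Finset.mul_sum]
        _ ≤ ∑ a, μ0 a * (s * δ) := by
            refine Finset.sum_le_sum fun a _ => mul_le_mul_of_nonneg_left ?_ (h0 a)
            refine ih (fun y x => Ψ (Fin.cons a y) x) fun j y => ?_
            have := h j.succ (Fin.cons a y)
            simpa [← Fin.cons_update] using this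
        _ = s * δ := by rw [← Finset.sum_mul, s0, one_mul]
    calc _ ≤ ∑ x, (|∑ y : Fin s → κ, seqWeight μ1 y *
              ∑ a, (μ1 a - μ0 a) * Ψ (Fin.cons a y) x| +
            |∑ a, μ0 a * ∑ y : Fin s → κ,
              (seqWeight μ1 y - seqWeight μ0 y) * Ψ (Fin.cons a y) x|) := by
          refine Finset.sum_le_sum fun x _ => ?_
          rw [key]; exact abs_add_le _ _
      _ ≤ δ + s * δ := by rw [Finset.sum_add_distrib]; exact add_le_add b1 b2
      _ = _ := by push_cast; ring

/-- If the moments of the signed weight `ν` decay geometrically, then so do its integrals against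
`v ^ k / (B + v) ^ n`. -/
theorem abs_sum_mul_pow_div_le {κ : Type*} [Fintype κ] {ν v : κ → ℝ} {A U B : ℝ} {n : ℕ}
    (hv0 : ∀ a, 0 ≤ v a) (hvU : ∀ a, v a ≤ U) (hUB : U < B)
    (hmom : ∀ m, |∑ a, ν a * v a ^ m| ≤ A * U ^ m) (k : ℕ) :
    |∑ a, ν a * (v a ^ k / (B + v a) ^ n)| ≤ A * U ^ k / (B - U) ^ n := by
  rcases Nat.eq_zero_or_pos n with h | h
  · subst h; simpa using hmom k
  obtain ⟨n, rfl⟩ : ∃ n', n = n' + 1 := ⟨n - 1, by omega⟩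
  rcases isEmpty_or_nonempty κ with hκ | ⟨⟨a0⟩⟩
  · have := hmom k
    simp at this ⊢
    apply div_nonneg this (pow_nonneg (by linarith) _)
  have hU0 : 0 ≤ U := (hv0 a0).trans (hvU a0)
  have hB : 0 < B := by linarith
  have hs : ∀ a, HasSum (fun m => ν a * (v a ^ k / B ^ (n + 1)) *
      (((m + n).choose n : ℝ) * (-(v a / B)) ^ m)) (ν a * (v a ^ k / (B + v a) ^ (n + 1))) := by
    intro a
    have h1 : ‖-(v a / B)‖ < 1 := by
      rw [norm_neg, Real.norm_of_nonneg (div_nonneg (hv0 a) hB.le), div_lt_one hB]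
      linarith [hvU a]
    have h2 := (hasSum_choose_mul_geometric_of_norm_lt_one n h1).mul_left
      (ν a * (v a ^ k / B ^ (n + 1)))
    have : 0 < B + v a := by linarith [hv0 a]
    have e : 1 - -(v a / B) = (B + v a) / B := by field_simp; ring
    rw [e, div_pow] at h2
    have e2 : ν a * (v a ^ k / (B + v a) ^ (n + 1)) = ν a * (v a ^ k / B ^ (n + 1)) *
        (1 / ((B + v a) ^ (n + 1) / B ^ (n + 1))) := by field_simp
    rw [e2]
    exact h2
  have hsum := hasSum_sum (s := Finset.univ) fun a _ => hs a
  have hU : HasSum (fun m => A * U ^ k / B ^ (n + 1) * (((m + n).choose n : ℝ) * (U / B) ^ m))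
      (A * U ^ k / (B - U) ^ (n + 1)) := by
    have h1 : ‖U / B‖ < 1 := by
      rw [Real.norm_of_nonneg (div_nonneg hU0 hB.le), div_lt_one hB]; exact hUB
    have h2 := (hasSum_choose_mul_geometric_of_norm_lt_one n h1).mul_left
      (A * U ^ k / B ^ (n + 1))
    have : 0 < B - U := by linarith
    have e : 1 - U / B = (B - U) / B := by field_simp
    rw [e, div_pow] at h2
    have e2 : A * U ^ k / (B - U) ^ (n + 1) = A * U ^ k / B ^ (n + 1) *
        (1 / ((B - U) ^ (n + 1) / B ^ (n + 1))) := by field_simp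
    rw [e2]
    exact h2
  have hterm : ∀ m, ‖∑ a, ν a * (v a ^ k / B ^ (n + 1)) *
      (((m + n).choose n : ℝ) * (-(v a / B)) ^ m)‖ ≤
      A * U ^ k / B ^ (n + 1) * (((m + n).choose n : ℝ) * (U / B) ^ m) := by
    intro m
    have e : ∑ a, ν a * (v a ^ k / B ^ (n + 1)) *
        (((m + n).choose n : ℝ) * (-(v a / B)) ^ m) =
        ((-1) ^ m * ((m + n).choose n : ℝ) / (B ^ (n + 1) * B ^ m)) *
          ∑ a, ν a * v a ^ (k + m) := by
      rw [Finset.mul_sum]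
      refine Finset.sum_congr rfl fun a _ => ?_
      rw [neg_eq_neg_one_mul, mul_pow, div_pow, pow_add]
      field_simp
      ring
    rw [e, Real.norm_eq_abs, abs_mul, abs_div, abs_mul, abs_pow, abs_neg, abs_one, one_pow, one_mul,
      abs_of_nonneg (Nat.cast_nonneg _), abs_of_pos (by positivity : 0 < B ^ (n + 1) * B ^ m)]
    calc ((m + n).choose n : ℝ) / (B ^ (n + 1) * B ^ m) * |∑ a, ν a * v a ^ (k + m)|
        ≤ ((m + n).choose n : ℝ) / (B ^ (n + 1) * B ^ m) * (A * U ^ (k + m)) := by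
          gcongr; exact hmom _
      _ = _ := by rw [div_pow, pow_add]; field_simp; ring
  have := tsum_of_norm_bounded hU hterm
  rwa [hsum.tsum_eq] at this

theorem seqWeight_update {κ : Type*} [DecidableEq κ] {n : ℕ} (q : κ → ℝ) (c : κ) (u : ℝ)
    (x : Fin n → κ) :
    seqWeight (Function.update q c u) x =
      u ^ (Finset.univ.filter fun i => x i = c).card * ∏ i, if x i = c then 1 else q (x i) := by
  have h : ∀ i, Function.update q c u (x i) =
      (if x i = c then u else 1) * (if x i = c then 1 else q (x i)) := by
    intro i
    by_cases hi : x i = c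
    · simp [hi]
    · simp [hi, Function.update_of_ne]
  rw [seqWeight, Finset.prod_congr rfl fun i _ => h i, Finset.prod_mul_distrib]
  congr 1
  rw [Finset.prod_ite]
  simp

theorem seqWeight_div {κ : Type*} {n : ℕ} (q : κ → ℝ) (Z : ℝ) (x : Fin n → κ) :
    seqWeight (fun i => q i / Z) x = seqWeight q x / Z ^ n := by
  simp [seqWeight, Finset.prod_div_distrib]

/-- One heavy symbol of mass `1 - w`, the other symbols having masses `v (ω i)`. -/
noncomputable def mixVec {κ : Type*} {s : ℕ} (w : ℝ) (v : κ → ℝ) (ω : Fin s → κ) :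
    Fin (s + 1) → ℝ :=
  Fin.cons (1 - w) fun i => v (ω i)

theorem mixVec_update {κ : Type*} {s : ℕ} (w : ℝ) (v : κ → ℝ) (ω : Fin s → κ) (j : Fin s)
    (a : κ) :
    mixVec w v (Function.update ω j a) = Function.update (mixVec w v ω) j.succ (v a) := by
  rw [mixVec, mixVec, ← Fin.cons_update]
  congr 1
  ext i
  by_cases h : i = j
  · subst h; simp
  · simp [h, Function.update_of_ne]

theorem mixVec_nonneg {κ : Type*} {s : ℕ} {w : ℝ} (hw : w ≤ 1) {v : κ → ℝ} (hv : ∀ a, 0 ≤ v a)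
    (ω : Fin s → κ) (i : Fin (s + 1)) : 0 ≤ mixVec w v ω i := by
  refine Fin.cases ?_ (fun i => ?_) i
  · simp [mixVec, hw]
  · simp [mixVec, hv]

theorem sum_mixVec {κ : Type*} {s : ℕ} (w : ℝ) (v : κ → ℝ) (ω : Fin s → κ) :
    ∑ i, mixVec w v ω i = 1 - w + ∑ i, v (ω i) := by
  simp [mixVec, Fin.sum_univ_succ]

/-- Total variation bound between the two mixtures of sampling distributions. -/
theorem sum_abs_mixture_sub_le {κ : Type*} [Fintype κ] {μ0 μ1 v : κ → ℝ}
    (h0 : ∀ a, 0 ≤ μ0 a) (h1 : ∀ a, 0 ≤ μ1 a) (s0 : ∑ a, μ0 a = 1) (s1 : ∑ a, μ1 a = 1)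
    {w A U : ℝ} (hw : w ≤ 1 / 2) (hv : ∀ a, 0 ≤ v a) (hvU : ∀ a, v a ≤ U) (hU : U ≤ 1 / 4)
    (hU0 : 0 ≤ U) (hA : 0 ≤ A)
    (hmom : ∀ m, |∑ a, (μ1 a - μ0 a) * v a ^ m| ≤ A * U ^ m) (s n : ℕ) :
    ∑ x : Fin n → Fin (s + 1), |∑ ω : Fin s → κ, (seqWeight μ1 ω - seqWeight μ0 ω) *
      (seqWeight (mixVec w v ω) x / (∑ i, mixVec w v ω i) ^ n)| ≤
      s * (A * Real.exp (8 * U * n)) := by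
  refine sum_abs_product_sub_le h0 h1 s0 s1 _ fun j ω => ?_
  set q := mixVec w v ω with hq
  set B := ∑ i ∈ Finset.univ \ {j.succ}, q i with hB
  have hqn : ∀ i, 0 ≤ q i := mixVec_nonneg (by linarith) hv ω
  have hBw : 1 / 2 ≤ B := by
    have : q 0 ≤ B := Finset.single_le_sum (fun i _ => hqn i)
      (by simp [(Fin.succ_ne_zero j).symm])
    have e : q 0 = 1 - w := by simp [hq, mixVec]
    linarith
  have hsum : ∀ u, ∑ i, Function.update q j.succ u i = B + u := by
    intro u
    rw [Finset.sum_update_of_mem (Finset.mem_univ _), add_comm]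
  set r : (Fin n → Fin (s + 1)) → ℝ := fun x => ∏ i, if x i = j.succ then 1 else q (x i) with hr
  have hr0 : ∀ x, 0 ≤ r x := fun x => Finset.prod_nonneg fun i _ => by
    split_ifs
    · exact zero_le_one
    · exact hqn _
  have hterm : ∀ x : Fin n → Fin (s + 1), |∑ a, (μ1 a - μ0 a) *
      (seqWeight (mixVec w v (Function.update ω j a)) x /
        (∑ i, mixVec w v (Function.update ω j a) i) ^ n)| ≤
      A * (seqWeight (Function.update q j.succ U) x / (B - U) ^ n) := by
    intro x
    have e : ∀ a, (μ1 a - μ0 a) * (seqWeight (mixVec w v (Function.update ω j a)) x /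
        (∑ i, mixVec w v (Function.update ω j a) i) ^ n) =
        r x * ((μ1 a - μ0 a) * (v a ^ (Finset.univ.filter fun i => x i = j.succ).card /
          (B + v a) ^ n)) := by
      intro a
      rw [mixVec_update, ← hq, hsum, seqWeight_update]
      ring
    simp_rw [e]
    rw [← Finset.mul_sum, abs_mul, abs_of_nonneg (hr0 x), seqWeight_update]
    have := abs_sum_mul_pow_div_le (n := n) hv hvU (show U < B by linarith) hmom
      (Finset.univ.filter fun i => x i = j.succ).card
    refine (mul_le_mul_of_nonneg_left this (hr0 x)).trans (le_of_eq ?_)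
    rw [hr]; ring
  refine (Finset.sum_le_sum fun x _ => hterm x).trans ?_
  rw [← Finset.mul_sum, ← Finset.sum_div, sum_seqWeight, hsum]
  refine mul_le_mul_of_nonneg_left ?_ hA
  rw [← div_pow, show 8 * U * (n : ℝ) = n * (8 * U) by ring, Real.exp_nat_mul]
  refine pow_le_pow_left₀ (div_nonneg (by linarith) (by linarith)) ?_ n
  have h2 := Real.add_one_le_exp (8 * U)
  refine le_trans ?_ h2
  rw [div_le_iff₀ (by linarith)]
  nlinarith

/-- Le Cam's method with two mixtures: if the estimand concentrates at two separated values under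
the two priors and the mixtures are close in total variation, the worst-case risk is large. -/
theorem le_risk_of_two_mixtures {Ω X : Type*} [Fintype Ω] [Fintype X] {W0 W1 : Ω → ℝ}
    (hW0 : ∀ ω, 0 ≤ W0 ω) (hW1 : ∀ ω, 0 ≤ W1 ω) (sW0 : ∑ ω, W0 ω = 1) (sW1 : ∑ ω, W1 ω = 1)
    {P : Ω → X → ℝ} (hP : ∀ ω x, 0 ≤ P ω x) (sP : ∀ ω, ∑ x, P ω x = 1)
    (est : X → ℝ) (g : Ω → ℝ) {h0 h1 D R : ℝ} (hD : h1 - h0 = D) (hD0 : 0 < D) (hR : 0 ≤ R)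
    (G0 G1 : Ω → Prop) [DecidablePred G0] [DecidablePred G1]
    (r0 : ∀ ω, G0 ω → ∑ x, P ω x * (est x - g ω) ^ 2 ≤ R)
    (r1 : ∀ ω, G1 ω → ∑ x, P ω x * (est x - g ω) ^ 2 ≤ R)
    (g0 : ∀ ω, G0 ω → |g ω - h0| ≤ D / 8) (g1 : ∀ ω, G1 ω → |g ω - h1| ≤ D / 8)
    (b0 : ∑ ω with ¬ G0 ω, W0 ω ≤ 1 / 8) (b1 : ∑ ω with ¬ G1 ω, W1 ω ≤ 1 / 8)
    (tv : ∑ x, |∑ ω, (W1 ω - W0 ω) * P ω x| ≤ 1 / 4) :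
    D ^ 2 / 64 ≤ R := by
  classical
  set e := R / (3 * D / 8) ^ 2 with he
  have hd : 0 < (3 * D / 8) ^ 2 := by positivity
  have he0 : 0 ≤ e := by positivity
  set T : X → ℝ := fun x => if (h0 + h1) / 2 ≤ est x then 1 else 0 with hT
  have T0 : ∀ x, 0 ≤ T x := fun x => by simp only [hT]; split_ifs <;> norm_num
  have T1 : ∀ x, T x ≤ 1 := fun x => by simp only [hT]; split_ifs <;> norm_num
  have cheb : ∀ (G : Ω → Prop) [DecidablePred G] (W : Ω → ℝ) (I : X → ℝ), (∀ ω, 0 ≤ W ω) →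
      (∑ ω, W ω = 1) → (∀ x, I x ≤ 1) →
      (∀ ω, G ω → ∑ x, P ω x * (est x - g ω) ^ 2 ≤ R) →
      (∀ ω, G ω → ∀ x, I x * (3 * D / 8) ^ 2 ≤ (est x - g ω) ^ 2) →
      (∑ ω with ¬ G ω, W ω ≤ 1 / 8) → ∑ ω, W ω * ∑ x, P ω x * I x ≤ e + 1 / 8 := by
    intro G _ W I hW sW hI hr hIg hb
    have h1 : ∀ ω, W ω * ∑ x, P ω x * I x ≤ W ω * e + if ¬ G ω then W ω else 0 := by
      intro ω
      by_cases hg : G ω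
      · simp only [hg, not_true, if_false, add_zero]
        refine mul_le_mul_of_nonneg_left ?_ (hW ω)
        rw [he, le_div_iff₀ hd, Finset.sum_mul]
        refine le_trans (Finset.sum_le_sum fun x _ => ?_) (hr ω hg)
        rw [mul_assoc]
        exact mul_le_mul_of_nonneg_left (hIg ω hg x) (hP ω x)
      · simp only [hg, not_false_iff, if_true]
        have : ∑ x, P ω x * I x ≤ 1 := by
          rw [← sP ω]
          exact Finset.sum_le_sum fun x _ => mul_le_of_le_one_right (hP ω x) (hI x)
        have h2 := mul_le_mul_of_nonneg_left this (hW ω)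
        have h3 := mul_nonneg (hW ω) he0
        linarith
    refine (Finset.sum_le_sum fun ω _ => h1 ω).trans ?_
    rw [Finset.sum_add_distrib, ← Finset.sum_mul, sW, one_mul, ← Finset.sum_filter]
    linarith
  have a0 := cheb G0 W0 T hW0 sW0 T1 r0 (by
    intro ω hω x
    have := abs_le.1 (g0 ω hω)
    simp only [hT]
    split_ifs with hx
    · rw [one_mul]; exact pow_le_pow_left₀ (by positivity) (by linarith [this.2]) 2
    · rw [zero_mul]; positivity) b0
  have a1 := cheb G1 W1 (fun x => 1 - T x) hW1 sW1 (fun x => by linarith [T0 x]) r1 (by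
    intro ω hω x
    have := abs_le.1 (g1 ω hω)
    simp only [hT]
    split_ifs with hx
    · rw [sub_self, zero_mul]; positivity
    · rw [sub_zero, one_mul, ← neg_sq (est x - g ω)]
      exact pow_le_pow_left₀ (by positivity) (by linarith [this.1]) 2) b1
  have c1 : ∑ ω, W1 ω * ∑ x, P ω x * (1 - T x) = (∑ ω, W1 ω) - ∑ ω, W1 ω * ∑ x, P ω x * T x := by
    rw [← Finset.sum_sub_distrib]
    refine Finset.sum_congr rfl fun ω _ => ?_
    simp_rw [mul_sub, mul_one]
    rw [Finset.sum_sub_distrib, sP, mul_sub, mul_one]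
  rw [sW1] at c1
  have c2 : ∑ ω, W1 ω * ∑ x, P ω x * T x - ∑ ω, W0 ω * ∑ x, P ω x * T x ≤ 1 / 4 := by
    refine le_trans (le_trans (le_of_eq ?_) (Finset.sum_le_sum
      (f := fun x => (∑ ω, (W1 ω - W0 ω) * P ω x) * T x) fun x _ => ?_)) tv
    · rw [← Finset.sum_sub_distrib]
      simp_rw [← sub_mul, Finset.mul_sum, Finset.sum_mul]
      rw [Finset.sum_comm]
      exact Finset.sum_congr rfl fun x _ => Finset.sum_congr rfl fun ω _ => by ring
    · exact (mul_le_mul_of_nonneg_right (le_abs_self _) (T0 x)).trans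
        (mul_le_of_le_one_right (abs_nonneg _) (T1 x))
  have e4 : 1 / 4 ≤ e := by linarith
  rw [he, le_div_iff₀ hd] at e4
  nlinarith

theorem entropy_div {S : ℕ} {q : Fin S → ℝ} (hq : ∀ i, 0 ≤ q i) {Z : ℝ} (hZ : ∑ i, q i = Z)
    (hZ0 : 0 < Z) :
    entropy (fun i => q i / Z) = (∑ i, -(q i * Real.log (q i))) / Z + Real.log Z := by
  have h : ∀ i, -(q i / Z * Real.log (q i / Z)) =
      -(q i * Real.log (q i)) / Z + q i * (Real.log Z / Z) := by
    intro i
    rcases (hq i).eq_or_lt with h | h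
    · rw [← h]; simp
    · rw [Real.log_div h.ne' hZ0.ne']; field_simp; ring
  rw [entropy, Finset.sum_congr rfl fun i _ => h i, Finset.sum_add_distrib, ← Finset.sum_div,
    ← Finset.sum_mul, hZ]
  field_simp

theorem abs_div_add_log_sub_le {T Z h D Y : ℝ} (hT : |T - h| ≤ D / 32) (hh : 0 ≤ h)
    (hhY : h ≤ 1 + Y) (hD : 0 ≤ D) (hDY : D ≤ Y) (hZ : |Z - 1| ≤ D / (128 * (1 + Y))) :
    |T / Z + Real.log Z - h| ≤ D / 8 := by
  set θ := D / (128 * (1 + Y)) with hθ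
  have hY : 0 < 1 + Y := by linarith
  have hθY : θ * (1 + Y) = D / 128 := by rw [hθ]; field_simp
  have hθ0 : 0 ≤ θ := by positivity
  have hθ1 : θ ≤ 1 / 2 := by
    rw [hθ, div_le_iff₀ (by positivity)]; linarith
  obtain ⟨z1, z2⟩ := abs_le.1 hZ
  have hZ0 : 1 / 2 ≤ Z := by linarith
  have hlog1 : Real.log Z ≤ 2 * θ := by
    have := Real.log_le_sub_one_of_pos (show 0 < Z by linarith); linarith
  have hinv : |1 / Z - 1| ≤ 2 * θ := by
    have e : 1 / Z - 1 = -((Z - 1) / Z) := by field_simp; ring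
    rw [e, abs_neg, abs_div, abs_of_pos (show 0 < Z by linarith), div_le_iff₀ (by linarith)]
    nlinarith
  have hlog2 : -(2 * θ) ≤ Real.log Z := by
    have := Real.one_sub_inv_le_log_of_pos (show 0 < Z by linarith)
    rw [← one_div] at this
    have := (abs_le.1 hinv).2
    linarith
  have hlog : |Real.log Z| ≤ 2 * θ := abs_le.2 ⟨hlog2, hlog1⟩
  have hTa : |T| ≤ 2 * (1 + Y) := by
    rw [abs_le] at hT ⊢; constructor <;> linarith [hT.1, hT.2]
  have e : T / Z + Real.log Z - h = T * (1 / Z - 1) + (T - h) + Real.log Z := by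
    field_simp; ring
  have h1 : |T * (1 / Z - 1)| ≤ 4 * (D / 128) := by
    rw [abs_mul]
    calc |T| * |1 / Z - 1| ≤ (2 * (1 + Y)) * (2 * θ) := by gcongr
      _ = 4 * (θ * (1 + Y)) := by ring
      _ = _ := by rw [hθY]
  have h2 : θ ≤ D / 128 := by rw [← hθY]; nlinarith
  rw [e]
  calc _ ≤ |T * (1 / Z - 1)| + |T - h| + |Real.log Z| :=
        (abs_add_le _ _).trans (add_le_add (abs_add_le _ _) le_rfl)
    _ ≤ 4 * (D / 128) + D / 32 + 2 * (D / 128) := by linarith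
    _ ≤ _ := by linarith

/-- Two priors `μ0`, `μ1` on the values `v`, having mean `α`, matching moments up to order `L`, and
mean entropy contributions that differ by at least `d`. -/
structure IsPriorPair {κ : Type*} [Fintype κ] (v μ0 μ1 : κ → ℝ) (α Λ : ℝ) (L : ℕ) (d : ℝ) :
    Prop where
  nonneg0 : ∀ a, 0 ≤ μ0 a
  nonneg1 : ∀ a, 0 ≤ μ1 a
  sum0 : ∑ a, μ0 a = 1
  sum1 : ∑ a, μ1 a = 1
  value : ∀ a, v a = 0 ∨ (α ≤ v a ∧ v a ≤ Λ)
  mean0 : ∑ a, μ0 a * v a = α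
  mean1 : ∑ a, μ1 a * v a = α
  moment : ∀ m ≤ L, ∑ a, μ0 a * v a ^ m = ∑ a, μ1 a * v a ^ m
  gap : d ≤ ∑ a, μ1 a * -(v a * Real.log (v a)) - ∑ a, μ0 a * -(v a * Real.log (v a))

theorem moment_le {κ : Type*} [Fintype κ] {v μ : κ → ℝ} {α Λ : ℝ} (hμ : ∀ a, 0 ≤ μ a)
    (hv : ∀ a, 0 ≤ v a) (hvΛ : ∀ a, v a ≤ Λ) (hm : ∑ a, μ a * v a = α) (m : ℕ) :
    ∑ a, μ a * v a ^ (m + 1) ≤ α * Λ ^ m := by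
  rw [← hm, Finset.sum_mul]
  refine Finset.sum_le_sum fun a _ => ?_
  rw [pow_succ, mul_assoc, mul_comm (v a) (Λ ^ m)]
  exact mul_le_mul_of_nonneg_left (mul_le_mul_of_nonneg_right
    (pow_le_pow_left₀ (hv a) (hvΛ a) m) (hv a)) (hμ a)

theorem abs_moment_sub_le {κ : Type*} [Fintype κ] {v μ0 μ1 : κ → ℝ} {α Λ d K : ℝ} {L : ℕ}
    (h : IsPriorPair v μ0 μ1 α Λ L d) (hα : 0 < α) (hΛ : 0 < Λ) (hK : 1 ≤ K) (m : ℕ) :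
    |∑ a, (μ1 a - μ0 a) * v a ^ m| ≤ α / Λ / K ^ (L + 1) * (K * Λ) ^ m := by
  have hv : ∀ a, 0 ≤ v a := fun a => by
    rcases h.value a with h1 | h1
    · exact h1.ge
    · exact hα.le.trans h1.1
  have hvΛ : ∀ a, v a ≤ Λ := fun a => by
    rcases h.value a with h1 | h1
    · rw [h1]; exact hΛ.le
    · exact h1.2
  have e : ∑ a, (μ1 a - μ0 a) * v a ^ m = ∑ a, μ1 a * v a ^ m - ∑ a, μ0 a * v a ^ m := by
    rw [← Finset.sum_sub_distrib]; exact Finset.sum_congr rfl fun a _ => by ring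
  rw [e]
  rcases le_or_gt m L with hm | hm
  · rw [h.moment m hm, sub_self, abs_zero]; positivity
  · obtain ⟨k, rfl⟩ : ∃ k, m = L + 1 + k := ⟨m - (L + 1), by omega⟩
    have i0 := moment_le h.nonneg0 hv hvΛ h.mean0 (L + k)
    have i1 := moment_le h.nonneg1 hv hvΛ h.mean1 (L + k)
    rw [show L + k + 1 = L + 1 + k by ring] at i0 i1
    have p0 : 0 ≤ ∑ a, μ0 a * v a ^ (L + 1 + k) :=
      Finset.sum_nonneg fun a _ => mul_nonneg (h.nonneg0 a) (pow_nonneg (hv a) _)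
    have p1 : 0 ≤ ∑ a, μ1 a * v a ^ (L + 1 + k) :=
      Finset.sum_nonneg fun a _ => mul_nonneg (h.nonneg1 a) (pow_nonneg (hv a) _)
    have e2 : α / Λ / K ^ (L + 1) * (K * Λ) ^ (L + 1 + k) = α * Λ ^ (L + k) * K ^ k := by
      rw [mul_pow, pow_add, pow_add Λ, pow_add Λ, pow_add Λ]; field_simp; ring
    rw [e2]
    refine le_trans ?_ (le_mul_of_one_le_right (by positivity) (one_le_pow₀ hK))
    rw [abs_le]; constructor <;> linarith

theorem mul_log_nonneg_and_le {v α Λ : ℝ} (hα : 0 < α) (hΛ : Λ ≤ 1)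
    (h : v = 0 ∨ (α ≤ v ∧ v ≤ Λ)) :
    0 ≤ -(v * Real.log v) ∧ -(v * Real.log v) ≤ v * -Real.log α := by
  rcases h with h | ⟨h1, h2⟩
  · simp [h]
  · have hv : 0 < v := hα.trans_le h1
    have l1 := Real.log_nonpos hv.le (h2.trans hΛ)
    have l2 := Real.log_le_log hα h1
    constructor
    · nlinarith
    · rw [← mul_neg]; exact mul_le_mul_of_nonneg_left (by linarith) hv.le

theorem le_minimaxRisk_of_priorPair {κ : Type*} [Fintype κ] {v μ0 μ1 : κ → ℝ}
    {α Λ d K w H : ℝ} {L s n : ℕ} (h : IsPriorPair v μ0 μ1 α Λ L d) (hα : 0 < α) (hΛ : 0 < Λ)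
    (hΛ1 : Λ ≤ 1) (hw : s * α = w) (hw2 : w ≤ 1 / 2) (hα1 : 1 ≤ -Real.log α)
    (hH : 1 + 2 * w * -Real.log α ≤ H) (hsd : 0 < s * d)
    (hvar : 2 ^ 20 * w * Λ * Real.log α ^ 2 ≤ (s * d) ^ 2) (hK : 1 ≤ K) (hKΛ : K * Λ ≤ 1 / 4)
    (htv : w / Λ / K ^ (L + 1) * Real.exp (8 * (K * Λ) * n) ≤ 1 / 4) :
    ENNReal.ofReal ((s * d) ^ 2 / 64) ≤ minimaxRisk (s + 1) n H := by
  classical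
  have hv : ∀ a, 0 ≤ v a := fun a => by
    rcases h.value a with h1 | h1
    · exact h1.ge
    · exact hα.le.trans h1.1
  have hvΛ : ∀ a, v a ≤ Λ := fun a => by
    rcases h.value a with h1 | h1
    · rw [h1]; exact hΛ.le
    · exact h1.2
  have hvU : ∀ a, v a ≤ K * Λ := fun a => (hvΛ a).trans (le_mul_of_one_le_left hΛ.le hK)
  refine ofReal_le_minimaxRisk fun est R hR hrisk => ?_
  set f : κ → ℝ := fun a => -(v a * Real.log (v a)) with hf
  set ℓ := -Real.log α with hℓ
  have hw0 : 0 ≤ w := by rw [← hw]; positivity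
  have hf0 : ∀ a, 0 ≤ f a := fun a => (mul_log_nonneg_and_le hα hΛ1 (h.value a)).1
  have hf1 : ∀ a, f a ≤ v a * ℓ := fun a => (mul_log_nonneg_and_le hα hΛ1 (h.value a)).2
  set D := s * (∑ a, μ1 a * f a - ∑ a, μ0 a * f a) with hD
  have hDd : s * d ≤ D := mul_le_mul_of_nonneg_left h.gap (Nat.cast_nonneg s)
  have hD0 : 0 < D := by linarith
  have hDsq : (s * d) ^ 2 ≤ D ^ 2 := pow_le_pow_left₀ hsd.le hDd 2
  set Y := w * ℓ with hY
  have hY0 : 0 ≤ Y := by positivity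
  have hE : ∀ μ : κ → ℝ, (∀ a, 0 ≤ μ a) → ∑ a, μ a * v a = α →
      0 ≤ ∑ a, μ a * f a ∧ s * ∑ a, μ a * f a ≤ Y := by
    intro μ hμ hm
    refine ⟨Finset.sum_nonneg fun a _ => mul_nonneg (hμ a) (hf0 a), ?_⟩
    have : ∑ a, μ a * f a ≤ α * ℓ := by
      rw [← hm, Finset.sum_mul]
      refine Finset.sum_le_sum fun a _ => ?_
      rw [mul_assoc]; exact mul_le_mul_of_nonneg_left (hf1 a) (hμ a)
    calc s * ∑ a, μ a * f a ≤ s * (α * ℓ) := by gcongr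
      _ = Y := by rw [hY, ← hw]; ring
  obtain ⟨e00, e0Y⟩ := hE μ0 h.nonneg0 h.mean0
  obtain ⟨e10, e1Y⟩ := hE μ1 h.nonneg1 h.mean1
  have hDY : D ≤ Y := by
    have : 0 ≤ s * ∑ a, μ0 a * f a := by positivity
    rw [hD, mul_sub]; linarith
  set θ := D / (128 * (1 + Y)) with hθ
  have hθ0 : 0 < θ := by positivity
  set c := -((1 - w) * Real.log (1 - w)) with hc
  have hc0 : 0 ≤ c := by
    have := Real.log_nonpos (show 0 ≤ 1 - w by linarith) (by linarith)
    rw [hc, ← mul_neg]; apply mul_nonneg <;> linarith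
  have hc1 : c ≤ w := by
    have h1 := Real.one_sub_inv_le_log_of_pos (show 0 < 1 - w by linarith)
    have h2 : (1 - w) * (1 - (1 - w)⁻¹) ≤ (1 - w) * Real.log (1 - w) :=
      mul_le_mul_of_nonneg_left h1 (by linarith)
    have h3 : (1 - w) * (1 - w)⁻¹ = 1 := mul_inv_cancel₀ (by linarith)
    rw [mul_sub, h3] at h2
    rw [hc]; linarith
  have hZ : ∀ ω : Fin s → κ, 1 / 2 ≤ ∑ i, mixVec w v ω i := by
    intro ω
    rw [sum_mixVec]
    have : 0 ≤ ∑ i, v (ω i) := Finset.sum_nonneg fun i _ => hv _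
    linarith
  have hent : ∀ ω : Fin s → κ, entropy (fun i => mixVec w v ω i / ∑ i, mixVec w v ω i) =
      (c + ∑ i, f (ω i)) / (∑ i, mixVec w v ω i) + Real.log (∑ i, mixVec w v ω i) := by
    intro ω
    rw [entropy_div (mixVec_nonneg (by linarith) hv ω) rfl (by linarith [hZ ω])]
    congr 2
    simp [mixVec, Fin.sum_univ_succ, hc, hf, add_comm]
  have happ : ∀ (μ : κ → ℝ), (∀ a, 0 ≤ μ a) → ∑ a, μ a * v a = α → ∀ ω : Fin s → κ,
      (|∑ i, f (ω i) - s * ∑ a, μ a * f a| ≤ D / 32 ∧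
        |∑ i, v (ω i) - s * ∑ a, μ a * v a| ≤ θ) →
      |entropy (fun i => mixVec w v ω i / ∑ i, mixVec w v ω i) - (c + s * ∑ a, μ a * f a)| ≤
        D / 8 := by
    rintro μ hμ hm ω ⟨g1, g2⟩
    obtain ⟨e1, e2⟩ := hE μ hμ hm
    rw [hent]
    refine abs_div_add_log_sub_le (Y := Y) ?_ (by positivity) (by linarith) hD0.le hDY ?_
    · rwa [add_sub_add_left_eq_sub]
    · rw [hm, hw] at g2
      rw [sum_mixVec, show 1 - w + ∑ i, v (ω i) - 1 = ∑ i, v (ω i) - w by ring]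
      exact g2
  have hgood : ∀ (μ : κ → ℝ), (∀ a, 0 ≤ μ a) → ∑ a, μ a * v a = α → ∀ ω : Fin s → κ,
      (|∑ i, f (ω i) - s * ∑ a, μ a * f a| ≤ D / 32 ∧
        |∑ i, v (ω i) - s * ∑ a, μ a * v a| ≤ θ) →
      ∑ x : Fin n → Fin (s + 1), seqWeight (fun i => mixVec w v ω i / ∑ i, mixVec w v ω i) x *
        (est x - entropy (fun i => mixVec w v ω i / ∑ i, mixVec w v ω i)) ^ 2 ≤ R := by
    intro μ hμ hm ω hg
    have h1 := (abs_le.1 (happ μ hμ hm ω hg)).2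
    obtain ⟨e1, e2⟩ := hE μ hμ hm
    have hZω := hZ ω
    refine hrisk _ ⟨fun i => div_nonneg (mixVec_nonneg (by linarith) hv ω i) (by linarith), ?_⟩ ?_
    · rw [← Finset.sum_div, div_self (by linarith)]
    · have : 2 * w * ℓ = 2 * Y := by rw [hY]; ring
      linarith
  have hbad : ∀ (μ : κ → ℝ), (∀ a, 0 ≤ μ a) → ∑ a, μ a = 1 → ∑ a, μ a * v a = α →
      ∑ ω : Fin s → κ with ¬ (|∑ i, f (ω i) - s * ∑ a, μ a * f a| ≤ D / 32 ∧
        |∑ i, v (ω i) - s * ∑ a, μ a * v a| ≤ θ), seqWeight μ ω ≤ 1 / 8 := by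
    intro μ hμ hμ1 hm
    have hbf : ∑ ω : Fin s → κ with ¬ (|∑ i, f (ω i) - s * ∑ a, μ a * f a| ≤ D / 32),
        seqWeight μ ω ≤ 1 / 16 := by
      have hb : s * ∑ a, μ a * f a ^ 2 ≤ w * Λ * ℓ ^ 2 := by
        have : ∑ a, μ a * f a ^ 2 ≤ α * (Λ * ℓ ^ 2) := by
          rw [← hm, Finset.sum_mul]
          refine Finset.sum_le_sum fun a _ => ?_
          rw [mul_assoc]
          refine mul_le_mul_of_nonneg_left ?_ (hμ a)
          calc f a ^ 2 ≤ (v a * ℓ) ^ 2 := pow_le_pow_left₀ (hf0 a) (hf1 a) 2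
            _ = v a * (v a * ℓ ^ 2) := by ring
            _ ≤ v a * (Λ * ℓ ^ 2) := by gcongr; exact hv a; exact hvΛ a
        calc s * ∑ a, μ a * f a ^ 2 ≤ s * (α * (Λ * ℓ ^ 2)) := by gcongr
          _ = _ := by rw [← hw]; ring
      refine (sum_filter_le_of_sq (seqWeight_nonneg hμ)
        (fun ω : Fin s → κ => ∑ i, f (ω i) - s * ∑ a, μ a * f a) (t := D / 32) (by positivity)
        ((variance_sum_le hμ hμ1 f).trans hb) _ fun ω hω => (not_le.1 hω).le).trans ?_
      rw [div_le_iff₀ (by positivity)]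
      have e : ℓ ^ 2 = Real.log α ^ 2 := by rw [hℓ]; ring
      rw [e]
      have : 0 ≤ w * Λ * Real.log α ^ 2 := by positivity
      linarith
    have hbv : ∑ ω : Fin s → κ with ¬ (|∑ i, v (ω i) - s * ∑ a, μ a * v a| ≤ θ),
        seqWeight μ ω ≤ 1 / 16 := by
      have hb : s * ∑ a, μ a * v a ^ 2 ≤ w * Λ := by
        have := moment_le hμ hv hvΛ hm 1
        calc s * ∑ a, μ a * v a ^ 2 ≤ s * (α * Λ ^ 1) := by gcongr
          _ = _ := by rw [← hw]; ring
      refine (sum_filter_le_of_sq (seqWeight_nonneg hμ)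
        (fun ω : Fin s → κ => ∑ i, v (ω i) - s * ∑ a, μ a * v a) (t := θ) hθ0
        ((variance_sum_le hμ hμ1 v).trans hb) _ fun ω hω => (not_le.1 hω).le).trans ?_
      rw [hθ, div_pow, div_div_eq_mul_div, div_le_iff₀ (by positivity)]
      have hYℓ : 1 + Y ≤ 3 / 2 * ℓ := by
        have : Y ≤ 1 / 2 * ℓ := by rw [hY]; gcongr
        linarith
      have e : ℓ ^ 2 = Real.log α ^ 2 := by rw [hℓ]; ring
      have hY2 : (128 * (1 + Y)) ^ 2 ≤ 36864 * ℓ ^ 2 := by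
        calc (128 * (1 + Y)) ^ 2 ≤ (128 * (3 / 2 * ℓ)) ^ 2 := by gcongr
          _ = _ := by ring
      rw [e] at hY2
      have h3 : w * Λ * (128 * (1 + Y)) ^ 2 ≤ w * Λ * (36864 * Real.log α ^ 2) := by gcongr
      have : 0 ≤ w * Λ * Real.log α ^ 2 := by positivity
      linarith
    have hsub : (Finset.univ.filter fun ω : Fin s → κ =>
        ¬ (|∑ i, f (ω i) - s * ∑ a, μ a * f a| ≤ D / 32 ∧
        |∑ i, v (ω i) - s * ∑ a, μ a * v a| ≤ θ)) ⊆
        (Finset.univ.filter fun ω : Fin s → κ =>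
          ¬ (|∑ i, f (ω i) - s * ∑ a, μ a * f a| ≤ D / 32)) ∪
        (Finset.univ.filter fun ω : Fin s → κ =>
          ¬ (|∑ i, v (ω i) - s * ∑ a, μ a * v a| ≤ θ)) := by
      intro ω
      simp only [Finset.mem_filter, Finset.mem_univ, true_and, Finset.mem_union, not_and_or]
      exact id
    refine (Finset.sum_le_sum_of_subset_of_nonneg hsub fun ω _ _ => seqWeight_nonneg hμ ω).trans ?_
    have := Finset.sum_union_inter (s₁ := Finset.univ.filter fun ω : Fin s → κ =>
          ¬ (|∑ i, f (ω i) - s * ∑ a, μ a * f a| ≤ D / 32))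
        (s₂ := Finset.univ.filter fun ω : Fin s → κ =>
          ¬ (|∑ i, v (ω i) - s * ∑ a, μ a * v a| ≤ θ)) (f := seqWeight μ)
    have h4 : 0 ≤ ∑ ω ∈ (Finset.univ.filter fun ω : Fin s → κ =>
          ¬ (|∑ i, f (ω i) - s * ∑ a, μ a * f a| ≤ D / 32)) ∩
        (Finset.univ.filter fun ω : Fin s → κ =>
          ¬ (|∑ i, v (ω i) - s * ∑ a, μ a * v a| ≤ θ)), seqWeight μ ω :=
      Finset.sum_nonneg fun ω _ => seqWeight_nonneg hμ ω
    linarith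
  refine le_trans (div_le_div_of_nonneg_right hDsq (by norm_num)) ?_
  refine le_risk_of_two_mixtures (W0 := seqWeight μ0) (W1 := seqWeight μ1)
    (P := fun (ω : Fin s → κ) x => seqWeight (fun i => mixVec w v ω i / ∑ i, mixVec w v ω i) x)
    (seqWeight_nonneg h.nonneg0) (seqWeight_nonneg h.nonneg1)
    (by rw [sum_seqWeight, h.sum0, one_pow]) (by rw [sum_seqWeight, h.sum1, one_pow])
    (fun ω x => seqWeight_nonneg (fun i => div_nonneg (mixVec_nonneg (by linarith) hv ω i)
      (by linarith [hZ ω])) x)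
    (fun ω => by rw [sum_seqWeight, ← Finset.sum_div, div_self (by linarith [hZ ω]), one_pow])
    est (fun ω => entropy (fun i => mixVec w v ω i / ∑ i, mixVec w v ω i))
    (h0 := c + s * ∑ a, μ0 a * f a) (h1 := c + s * ∑ a, μ1 a * f a)
    (by rw [hD]; ring) hD0 hR _ _ (hgood μ0 h.nonneg0 h.mean0) (hgood μ1 h.nonneg1 h.mean1)
    (happ μ0 h.nonneg0 h.mean0) (happ μ1 h.nonneg1 h.mean1)
    (hbad μ0 h.nonneg0 h.sum0 h.mean0) (hbad μ1 h.nonneg1 h.sum1 h.mean1) ?_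
  have htv2 := sum_abs_mixture_sub_le h.nonneg0 h.nonneg1 h.sum0 h.sum1 hw2 hv hvU hKΛ
    (by positivity) (show 0 ≤ α / Λ / K ^ (L + 1) by positivity)
    (abs_moment_sub_le h hα hΛ hK) s n
  simp_rw [seqWeight_div]
  refine htv2.trans (le_trans (le_of_eq ?_) htv)
  rw [← hw]; ring

/-- Tilt the weights `e` by `α / u` and put the remaining mass on `none`. -/
noncomputable def tiltedWeight {ι : Type*} [Fintype ι] (α : ℝ) (u e : ι → ℝ) : Option ι → ℝ
  | none => 1 - ∑ i, α / u i * e i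
  | some i => α / u i * e i

theorem exists_priorPair_of_signed {ι : Type*} [Fintype ι] {c u : ι → ℝ} {α Λ g : ℝ} {N : ℕ}
    (hα : 0 < α) (hu : ∀ i, α ≤ u i ∧ u i ≤ Λ) (hkill : ∀ m ≤ N, ∑ i, c i * u i ^ m = 0)
    (hc0 : 0 < ∑ i, |c i|) (hc4 : ∑ i, |c i| ≤ 4) (hg : 0 ≤ g)
    (hgap : g ≤ ∑ i, c i * -Real.log (u i)) :
    ∃ v μ0 μ1 : Option ι → ℝ, IsPriorPair v μ0 μ1 α Λ (N + 1) (α / 2 * g) := by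
  set t := (∑ i, |c i|) / 2 with ht
  have ht0 : 0 < t := by positivity
  have hc : ∑ i, c i = 0 := by simpa using hkill 0 (Nat.zero_le _)
  set e1 : ι → ℝ := fun i => (|c i| + c i) / 2 / t with he1
  set e0 : ι → ℝ := fun i => (|c i| - c i) / 2 / t with he0
  have hn1 : ∀ i, 0 ≤ e1 i := fun i => by
    simp only [he1]; have := neg_abs_le (c i)
    apply div_nonneg (div_nonneg _ _) ht0.le <;> linarith
  have hn0 : ∀ i, 0 ≤ e0 i := fun i => by
    simp only [he0]; have := le_abs_self (c i)
    apply div_nonneg (div_nonneg _ _) ht0.le <;> linarith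
  have hs1 : ∑ i, e1 i = 1 := by
    simp only [he1]
    rw [← Finset.sum_div, ← Finset.sum_div, Finset.sum_add_distrib, hc, add_zero, ← ht,
      div_self ht0.ne']
  have hs0 : ∑ i, e0 i = 1 := by
    simp only [he0]
    rw [← Finset.sum_div, ← Finset.sum_div, Finset.sum_sub_distrib, hc, sub_zero, ← ht,
      div_self ht0.ne']
  have hd : ∀ i, e1 i - e0 i = c i / t := fun i => by simp only [he1, he0]; ring
  have hu0 : ∀ i, 0 < u i := fun i => hα.trans_le (hu i).1
  set v : Option ι → ℝ := fun o => o.elim 0 u with hv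
  have hnn : ∀ e : ι → ℝ, (∀ i, 0 ≤ e i) → ∑ i, e i = 1 → ∀ o, 0 ≤ tiltedWeight α u e o := by
    intro e he hes o
    cases o with
    | none =>
      have : ∑ i, α / u i * e i ≤ ∑ i, e i := Finset.sum_le_sum fun i _ =>
        mul_le_of_le_one_left (he i) ((div_le_one (hu0 i)).2 (hu i).1)
      simp only [tiltedWeight]; linarith
    | some i => exact mul_nonneg (div_nonneg hα.le (hu0 i).le) (he i)
  have hsum : ∀ e : ι → ℝ, ∑ o, tiltedWeight α u e o = 1 := by
    intro e; rw [Fintype.sum_option]; simp [tiltedWeight]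
  have hmom : ∀ (e : ι → ℝ) (m : ℕ), ∑ o, tiltedWeight α u e o * v o ^ (m + 1) =
      α * ∑ i, e i * u i ^ m := by
    intro e m
    rw [Fintype.sum_option, Finset.mul_sum]
    simp only [tiltedWeight, hv, Option.elim]
    rw [zero_pow (Nat.succ_ne_zero _), mul_zero, zero_add]
    refine Finset.sum_congr rfl fun i _ => ?_
    have := (hu0 i).ne'
    field_simp
    ring
  have hmean : ∀ e : ι → ℝ, ∑ i, e i = 1 → ∑ o, tiltedWeight α u e o * v o = α := by
    intro e he
    have := hmom e 0
    simpa [he] using this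
  have hlog : ∀ e : ι → ℝ, ∑ o, tiltedWeight α u e o * -(v o * Real.log (v o)) =
      α * ∑ i, e i * -Real.log (u i) := by
    intro e
    rw [Fintype.sum_option, Finset.mul_sum]
    simp only [tiltedWeight, hv, Option.elim]
    rw [zero_mul, neg_zero, mul_zero, zero_add]
    refine Finset.sum_congr rfl fun i _ => ?_
    have := (hu0 i).ne'
    field_simp
  refine ⟨v, tiltedWeight α u e0, tiltedWeight α u e1, hnn e0 hn0 hs0, hnn e1 hn1 hs1, hsum e0,
    hsum e1, ?_, hmean e0 hs0, hmean e1 hs1, ?_, ?_⟩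
  · intro o
    cases o with
    | none => left; rfl
    | some i => right; exact hu i
  · intro m hm
    cases m with
    | zero => simp [hsum]
    | succ m =>
      rw [hmom, hmom, ← sub_eq_zero, ← mul_sub, ← Finset.sum_sub_distrib]
      have : ∑ i, (e0 i * u i ^ m - e1 i * u i ^ m) = -(∑ i, c i * u i ^ m) / t := by
        rw [neg_div, Finset.sum_div, ← Finset.sum_neg_distrib]
        refine Finset.sum_congr rfl fun i _ => ?_
        have := hd i
        rw [← sub_mul, show e0 i - e1 i = -(c i / t) by linarith]; ring
      rw [this, hkill m (by omega)]; simp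
  · rw [hlog, hlog, ← mul_sub, ← Finset.sum_sub_distrib]
    have : ∑ i, (e1 i * -Real.log (u i) - e0 i * -Real.log (u i)) =
        (∑ i, c i * -Real.log (u i)) / t := by
      rw [Finset.sum_div]
      refine Finset.sum_congr rfl fun i _ => ?_
      rw [← sub_mul, hd i]; ring
    rw [this, div_mul_eq_mul_div, mul_div_assoc]
    refine mul_le_mul_of_nonneg_left ?_ hα.le
    rw [div_le_div_iff₀ (by norm_num) ht0]
    nlinarith

theorem sum_alternating_choose_mul_eval {n : ℕ} {P : Polynomial ℝ} (hP : P.natDegree < n) :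
    ∑ k : Fin (n + 1), (-1 : ℝ) ^ (n - (k : ℕ)) * (n.choose k : ℝ) * P.eval (k : ℝ) = 0 := by
  have h := congrFun (Polynomial.fwdDiff_iter_eq_zero_of_degree_lt hP) 0
  rw [fwdDiff_iter_eq_sum_shift] at h
  rw [Fin.sum_univ_eq_sum_range fun k : ℕ => (-1 : ℝ) ^ (n - k) * (n.choose k : ℝ) * P.eval (k : ℝ)]
  simpa using h

/-- Normalised alternating binomial weights, centred at `N`. -/
noncomputable def altBinom (N : ℕ) (k : Fin (2 * N + 1)) : ℝ :=
  (-1) ^ N * ((-1) ^ (2 * N - (k : ℕ)) * ((2 * N).choose k : ℝ)) / ((2 * N).choose N : ℝ)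

theorem abs_altBinom_le (N : ℕ) (k : Fin (2 * N + 1)) : |altBinom N k| ≤ 1 := by
  have h0 : (0 : ℝ) < ((2 * N).choose N : ℝ) := by exact_mod_cast Nat.choose_pos (by omega)
  rw [altBinom, abs_div, abs_mul, abs_mul, abs_pow, abs_pow, abs_neg, abs_one, one_pow, one_pow,
    one_mul, one_mul, Nat.abs_cast, Nat.abs_cast, div_le_one h0]
  have := Nat.choose_le_centralBinom (k : ℕ) N
  rw [Nat.centralBinom_eq_two_mul_choose] at this
  exact_mod_cast this

theorem altBinom_center (N : ℕ) (k : Fin (2 * N + 1)) (hk : (k : ℕ) = N) : altBinom N k = 1 := by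
  have h0 : (0 : ℝ) < ((2 * N).choose N : ℝ) := by exact_mod_cast Nat.choose_pos (by omega)
  rw [altBinom, hk, show 2 * N - N = N by omega, ← mul_assoc, ← mul_pow]
  simp [h0.ne']

theorem sum_altBinom_mul_eval {N : ℕ} {P : Polynomial ℝ} (hP : P.natDegree < 2 * N) :
    ∑ k, altBinom N k * P.eval (k : ℝ) = 0 := by
  have h := sum_alternating_choose_mul_eval hP
  have e : ∑ k, altBinom N k * P.eval (k : ℝ) = (-1) ^ N / ((2 * N).choose N : ℝ) *
      ∑ k : Fin (2 * N + 1), (-1 : ℝ) ^ (2 * N - (k : ℕ)) * ((2 * N).choose k : ℝ) *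
        P.eval (k : ℝ) := by
    rw [Finset.mul_sum]
    refine Finset.sum_congr rfl fun k _ => ?_
    rw [altBinom]; ring
  rw [e, h, mul_zero]

/-- The offset `k - N` of a node index. -/
noncomputable def offset (N : ℕ) (k : Fin (2 * N + 1)) : ℝ := (k : ℝ) - N

theorem one_le_offset_sq {N : ℕ} {k : Fin (2 * N + 1)} (hk : (k : ℕ) ≠ N) :
    1 ≤ offset N k ^ 2 := by
  have h : (1 : ℤ) ≤ ((k : ℤ) - N) ^ 2 := by
    have : ((k : ℤ) - N) ≠ 0 := by omega
    have := sq_pos_of_ne_zero this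
    omega
  rw [offset]; exact_mod_cast h

theorem offset_sq_le {N : ℕ} (k : Fin (2 * N + 1)) : offset N k ^ 2 ≤ (N : ℝ) ^ 2 := by
  have h1 : ((k : ℕ) : ℝ) ≤ 2 * N := by have := k.2; exact_mod_cast (by omega : (k : ℕ) ≤ 2 * N)
  have h2 : (0 : ℝ) ≤ ((k : ℕ) : ℝ) := by positivity
  rw [offset]
  apply sq_le_sq'
  · linarith
  · linarith

theorem offset_center {N : ℕ} {k : Fin (2 * N + 1)} (hk : (k : ℕ) = N) : offset N k = 0 := by
  rw [offset, hk, sub_self]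

theorem one_sub_four_offset_ne_zero {N : ℕ} (k : Fin (2 * N + 1)) : 1 - 4 * offset N k ^ 2 ≠ 0 := by
  by_cases hk : (k : ℕ) = N
  · rw [offset_center hk]; norm_num
  · have := one_le_offset_sq hk; intro h; linarith

theorem sum_abs_inv_one_sub_four_offset_le (N : ℕ) :
    ∑ k, |1 / (1 - 4 * offset N k ^ 2)| ≤ 2 := by
  have h1 : ∀ k : Fin (2 * N + 1), |1 / (1 - 4 * offset N k ^ 2)| =
      -(1 / (1 - 4 * offset N k ^ 2)) + if k = (⟨N, by omega⟩ : Fin (2 * N + 1)) then 2 else 0 := by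
    intro k
    by_cases hk : (k : ℕ) = N
    · rw [offset_center hk, if_pos (Fin.ext hk)]; norm_num
    · rw [if_neg (fun h => hk (by rw [h])), add_zero]
      apply abs_of_nonpos
      have := one_le_offset_sq hk
      exact div_nonpos_of_nonneg_of_nonpos (by norm_num) (by linarith)
  have h2 : ∑ k : Fin (2 * N + 1), -(1 / (1 - 4 * offset N k ^ 2)) = -(1 / (2 * (N : ℝ) + 1)) := by
    set f : ℕ → ℝ := fun k => -(1 / 2 * (1 / (2 * ((k : ℝ) - N) - 1))) with hf
    have e : ∀ k : Fin (2 * N + 1), -(1 / (1 - 4 * offset N k ^ 2)) = f ((k : ℕ) + 1) - f k := by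
      intro k
      have h := one_sub_four_offset_ne_zero k
      simp only [hf, offset] at h ⊢
      have a1 : 2 * (((k : ℕ) : ℝ) - N) - 1 ≠ 0 := fun h0 => h (by
        linear_combination (-(2 * (((k : ℕ) : ℝ) - N) + 1)) * h0)
      have a2 : 2 * (((k : ℕ) : ℝ) - N) + 1 ≠ 0 := fun h0 => h (by nlinarith)
      push_cast
      rw [show 2 * (((k : ℕ) : ℝ) + 1 - N) - 1 = 2 * (((k : ℕ) : ℝ) - N) + 1 by ring,
        show 1 - 4 * (((k : ℕ) : ℝ) - N) ^ 2 =
          -((2 * (((k : ℕ) : ℝ) - N) - 1) * (2 * (((k : ℕ) : ℝ) - N) + 1)) by ring]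
      field_simp
      ring
    rw [Finset.sum_congr rfl fun k _ => e k,
      Fin.sum_univ_eq_sum_range (fun k : ℕ => f (k + 1) - f k), Finset.sum_range_sub]
    simp only [hf]
    push_cast
    have a1 : (2 * (N : ℝ) + 1) ≠ 0 := by positivity
    rw [show 2 * (2 * (N : ℝ) + 1 - N) - 1 = 2 * (N : ℝ) + 1 by ring,
      show 2 * (0 - (N : ℝ)) - 1 = -(2 * (N : ℝ) + 1) by ring]
    field_simp
    ring
  rw [Finset.sum_congr rfl fun k _ => h1 k, Finset.sum_add_distrib, h2,
    Finset.sum_ite_eq' Finset.univ]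
  have : 0 ≤ 1 / (2 * (N : ℝ) + 1) := by positivity
  simp only [Finset.mem_univ, if_true]
  linarith

/-- The node polynomial `α (1 + M (X - N)²)`. -/
noncomputable def nodePoly (α M : ℝ) (N : ℕ) : Polynomial ℝ :=
  Polynomial.C α * (1 + Polynomial.C M * (Polynomial.X - Polynomial.C (N : ℝ)) ^ 2)

theorem nodePoly_eval (α M : ℝ) (N : ℕ) (k : Fin (2 * N + 1)) :
    (nodePoly α M N).eval ((k : ℕ) : ℝ) = α * (1 + M * offset N k ^ 2) := by
  simp [nodePoly, offset]

theorem natDegree_nodePoly_le (α M : ℝ) (N : ℕ) : (nodePoly α M N).natDegree ≤ 2 := by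
  unfold nodePoly
  compute_degree

theorem sum_altBinom_div_mul_pow_sub_eq_zero {N m : ℕ} (hm : m ≤ N) (α M : ℝ) :
    ∑ k, altBinom N k / (1 - 4 * offset N k ^ 2) *
      ((α * (1 + M * offset N k ^ 2)) ^ m - (α * (1 + M / 4)) ^ m) = 0 := by
  rcases Nat.eq_zero_or_pos m with rfl | hm0
  · simp
  set y := α * (1 + M / 4) with hy
  set Q : Polynomial ℝ := ∑ i ∈ Finset.range m, nodePoly α M N ^ i * Polynomial.C y ^ (m - 1 - i)
    with hQ
  have hQd : Q.natDegree < 2 * N := by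
    have : Q.natDegree ≤ 2 * (m - 1) := by
      refine Polynomial.natDegree_sum_le_of_forall_le _ _ fun i hi => ?_
      rw [Finset.mem_range] at hi
      rw [← Polynomial.C_pow]
      refine (Polynomial.natDegree_mul_C_le _ _).trans
        ((Polynomial.natDegree_pow_le_of_le i (natDegree_nodePoly_le α M N)).trans ?_)
      omega
    omega
  have h := sum_altBinom_mul_eval hQd
  have e : ∀ k, altBinom N k / (1 - 4 * offset N k ^ 2) *
      ((α * (1 + M * offset N k ^ 2)) ^ m - y ^ m) =
      -(α * M / 4) * (altBinom N k * Q.eval ((k : ℕ) : ℝ)) := by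
    intro k
    have h0 := one_sub_four_offset_ne_zero k
    have hQe : Q.eval ((k : ℕ) : ℝ) =
        ∑ i ∈ Finset.range m, (α * (1 + M * offset N k ^ 2)) ^ i * y ^ (m - 1 - i) := by
      rw [hQ, Polynomial.eval_finsetSum]
      refine Finset.sum_congr rfl fun i _ => ?_
      rw [Polynomial.eval_mul, Polynomial.eval_pow, nodePoly_eval, Polynomial.eval_pow,
        Polynomial.eval_C]
    rw [hQe, ← geom_sum₂_mul,
      show α * (1 + M * offset N k ^ 2) - y = -(α * M / 4) * (1 - 4 * offset N k ^ 2) by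
        rw [hy]; ring]
    field_simp
  rw [Finset.sum_congr rfl fun k _ => e k, ← Finset.mul_sum, h, mul_zero]

theorem exists_sum_log_offset_le : ∃ C0 : ℝ, 0 ≤ C0 ∧ ∀ N : ℕ,
    ∑ k : Fin (2 * N + 1), 2 * |offset N k| ^ (-(3 / 2) : ℝ) ≤ C0 := by
  have hs : Summable fun n : ℤ => 2 * |(n : ℝ)| ^ (-(3 / 2) : ℝ) :=
    (Real.summable_abs_int_rpow (by norm_num)).mul_left 2
  have h0 : ∀ n : ℤ, 0 ≤ 2 * |(n : ℝ)| ^ (-(3 / 2) : ℝ) := fun n => by positivity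
  refine ⟨∑' n : ℤ, 2 * |(n : ℝ)| ^ (-(3 / 2) : ℝ), tsum_nonneg h0, fun N => ?_⟩
  let e : Fin (2 * N + 1) ↪ ℤ := ⟨fun k => (k : ℤ) - N, fun a b h => by
    apply Fin.ext; simp only at h; omega⟩
  have := hs.sum_le_tsum (Finset.univ.map e) fun n _ => h0 n
  rw [Finset.sum_map] at this
  refine le_trans (le_of_eq (Finset.sum_congr rfl fun k _ => ?_)) this
  show 2 * |offset N k| ^ (-(3 / 2) : ℝ) = 2 * |(((k : ℤ) - N : ℤ) : ℝ)| ^ (-(3 / 2) : ℝ)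
  rw [offset]; push_cast; rfl

theorem log_four_mul_sq_div_le {t : ℝ} (ht : 1 ≤ t ^ 2) :
    Real.log (4 * t ^ 2) / (4 * t ^ 2 - 1) ≤ 2 * |t| ^ (-(3 / 2) : ℝ) := by
  have h1 : 1 ≤ |t| := by
    rw [← sq_abs] at ht; nlinarith [abs_nonneg t]
  have e : t ^ 2 = |t| ^ 2 := (sq_abs t).symm
  rw [e]
  generalize |t| = r at h1
  obtain ⟨u, hu, rfl⟩ : ∃ u : ℝ, 1 ≤ u ∧ r = u ^ 2 :=
    ⟨√r, Real.one_le_sqrt.2 h1, (Real.sq_sqrt (by linarith)).symm⟩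
  have hu0 : 0 < u := by linarith
  have h3 : (u ^ 2) ^ (-(3 / 2) : ℝ) = (u ^ 3)⁻¹ := by
    rw [← Real.rpow_natCast u 2, ← Real.rpow_mul hu0.le, ← Real.rpow_natCast u 3,
      ← Real.rpow_neg hu0.le]
    norm_num
  rw [h3]
  have hlog : Real.log (4 * (u ^ 2) ^ 2) ≤ 6 * u := by
    rw [show 4 * (u ^ 2) ^ 2 = (2 * u ^ 2) ^ 2 by ring, Real.log_pow,
      Real.log_mul (by norm_num) (by positivity), Real.log_pow]
    have l2 := Real.log_two_lt_d9
    have := Real.log_le_sub_one_of_pos hu0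
    push_cast
    linarith
  have h4 : 1 ≤ u ^ 4 := one_le_pow₀ hu
  rw [div_le_iff₀ (by nlinarith), ← div_eq_mul_inv, div_mul_eq_mul_div, le_div_iff₀ (by positivity)]
  calc Real.log (4 * (u ^ 2) ^ 2) * u ^ 3 ≤ 6 * u * u ^ 3 := by gcongr
    _ = 6 * u ^ 4 := by ring
    _ ≤ 2 * (4 * (u ^ 2) ^ 2 - 1) := by nlinarith

theorem log_node_ratio_le {α M t : ℝ} (hα : 0 < α) (hM : 1 ≤ M) (ht : 1 ≤ t ^ 2) :
    |Real.log (α * (1 + M / 4)) - Real.log (α * (1 + M * t ^ 2))| ≤ Real.log (4 * t ^ 2) := by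
  have hMt : M ≤ M * t ^ 2 := le_mul_of_one_le_right (by linarith) ht
  have p1 : 0 < α * (1 + M / 4) := by positivity
  have p2 : 0 < α * (1 + M * t ^ 2) := by positivity
  have h1 : Real.log (α * (1 + M / 4)) ≤ Real.log (α * (1 + M * t ^ 2)) := by
    apply Real.log_le_log p1
    gcongr
    linarith
  have h2 : Real.log (α * (1 + M * t ^ 2)) ≤ Real.log (4 * t ^ 2) + Real.log (α * (1 + M / 4)) := by
    rw [← Real.log_mul (by positivity) p1.ne']
    apply Real.log_le_log p2
    nlinarith
  rw [abs_le]; constructor <;> linarith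

theorem exists_priorPair : ∃ M0 : ℝ, 16 ≤ M0 ∧ ∀ (N : ℕ) (M α : ℝ), 1 ≤ N → M0 ≤ M → 0 < α →
    ∃ v μ0 μ1 : Option (Option (Fin (2 * N + 1))) → ℝ,
      IsPriorPair v μ0 μ1 α (α * (1 + M * N ^ 2)) (N + 1) (α / 4 * Real.log M) := by
  obtain ⟨C0, hC0, hsum⟩ := exists_sum_log_offset_le
  refine ⟨16 * Real.exp (2 * C0), ?_, ?_⟩
  · have := Real.one_le_exp (mul_nonneg (zero_le_two (α := ℝ)) hC0); linarith
  intro N M α hN hM hα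
  have hM16 : 16 ≤ M := by
    have := Real.one_le_exp (mul_nonneg (zero_le_two (α := ℝ)) hC0); linarith
  have hN' : (1 : ℝ) ≤ N := by exact_mod_cast hN
  set c : Option (Fin (2 * N + 1)) → ℝ := fun o =>
    o.elim (-∑ k, altBinom N k / (1 - 4 * offset N k ^ 2))
      fun k => altBinom N k / (1 - 4 * offset N k ^ 2) with hc
  set u : Option (Fin (2 * N + 1)) → ℝ := fun o =>
    o.elim (α * (1 + M / 4)) fun k => α * (1 + M * offset N k ^ 2) with hu
  have hck : ∀ k, |altBinom N k / (1 - 4 * offset N k ^ 2)| ≤ |1 / (1 - 4 * offset N k ^ 2)| := by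
    intro k
    rw [abs_div, abs_div, abs_one]
    exact div_le_div_of_nonneg_right (abs_altBinom_le N k) (abs_nonneg _)
  have hcs : ∑ k, |altBinom N k / (1 - 4 * offset N k ^ 2)| ≤ 2 :=
    (Finset.sum_le_sum fun k _ => hck k).trans (sum_abs_inv_one_sub_four_offset_le N)
  have hk0 : ((⟨N, by omega⟩ : Fin (2 * N + 1)) : ℕ) = N := rfl
  have hpair := exists_priorPair_of_signed (c := c) (u := u) (Λ := α * (1 + M * N ^ 2))
    (g := Real.log M / 2) (N := N) hα ?_ ?_ ?_ ?_ ?_ ?_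
  · rwa [show α / 2 * (Real.log M / 2) = α / 4 * Real.log M by ring] at hpair
  · intro o
    cases o with
    | none =>
      simp only [hu, Option.elim]
      refine ⟨le_mul_of_one_le_right hα.le (by linarith), mul_le_mul_of_nonneg_left ?_ hα.le⟩
      have := le_mul_of_one_le_right (by linarith : 0 ≤ M) (one_le_pow₀ hN' : 1 ≤ (N : ℝ) ^ 2)
      linarith
    | some k =>
      simp only [hu, Option.elim]
      have h1 := offset_sq_le k
      have h2 := sq_nonneg (offset N k)
      refine ⟨le_mul_of_one_le_right hα.le (by nlinarith), mul_le_mul_of_nonneg_left ?_ hα.le⟩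
      nlinarith
  · intro m hm
    have := sum_altBinom_div_mul_pow_sub_eq_zero hm α M
    rw [Fintype.sum_option]
    simp only [hc, hu, Option.elim]
    rw [← this, neg_mul, Finset.sum_mul, neg_add_eq_sub, ← Finset.sum_sub_distrib]
    exact Finset.sum_congr rfl fun k _ => by ring
  · refine lt_of_lt_of_le ?_ (Finset.single_le_sum (fun o _ => abs_nonneg (c o))
      (Finset.mem_univ (some (⟨N, by omega⟩ : Fin (2 * N + 1)))))
    simp only [hc, Option.elim]
    rw [altBinom_center N _ hk0, offset_center hk0]; norm_num
  · rw [Fintype.sum_option]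
    simp only [hc, Option.elim]
    rw [abs_neg]
    have := Finset.abs_sum_le_sum_abs (fun k => altBinom N k / (1 - 4 * offset N k ^ 2))
      Finset.univ
    linarith
  · have := Real.log_nonneg (by linarith : 1 ≤ M); linarith
  · have hterm : ∀ k : Fin (2 * N + 1),
        (if k = (⟨N, by omega⟩ : Fin (2 * N + 1)) then Real.log (1 + M / 4) else 0) -
          2 * |offset N k| ^ (-(3 / 2) : ℝ) ≤ altBinom N k / (1 - 4 * offset N k ^ 2) *
            (Real.log (α * (1 + M / 4)) - Real.log (α * (1 + M * offset N k ^ 2))) := by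
      intro k
      by_cases hk : (k : ℕ) = N
      · rw [if_pos (Fin.ext hk), altBinom_center N k hk, offset_center hk,
          Real.log_mul hα.ne' (by positivity)]
        have : (0 : ℝ) ≤ 2 * |(0 : ℝ)| ^ (-(3 / 2) : ℝ) := by positivity
        norm_num at this ⊢
      · rw [if_neg (fun h => hk (by rw [h])), zero_sub]
        have ho := one_le_offset_sq hk
        have h1 := log_node_ratio_le hα (by linarith : 1 ≤ M) ho
        have h2 := log_four_mul_sq_div_le ho
        refine le_trans ?_ (neg_abs_le _)
        rw [abs_mul, neg_le_neg_iff]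
        refine (mul_le_mul (hck k) h1 (abs_nonneg _) (abs_nonneg _)).trans (le_trans ?_ h2)
        rw [abs_div, abs_one, abs_of_neg (by linarith : 1 - 4 * offset N k ^ 2 < 0),
          neg_sub, one_div, inv_mul_eq_div]
    have hs := Finset.sum_le_sum fun k (_ : k ∈ Finset.univ) => hterm k
    rw [Finset.sum_sub_distrib, Finset.sum_ite_eq' Finset.univ] at hs
    simp only [Finset.mem_univ, if_true] at hs
    have e : ∑ o, c o * -Real.log (u o) = ∑ k, altBinom N k / (1 - 4 * offset N k ^ 2) *
            (Real.log (α * (1 + M / 4)) - Real.log (α * (1 + M * offset N k ^ 2))) := by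
      rw [Fintype.sum_option]
      simp only [hc, hu, Option.elim]
      rw [neg_mul_neg, Finset.sum_mul, ← Finset.sum_add_distrib]
      exact Finset.sum_congr rfl fun k _ => by ring
    rw [e]
    have h3 := hsum N
    have h4 : Real.log M - Real.log 4 ≤ Real.log (1 + M / 4) := by
      rw [← Real.log_div (by linarith) (by norm_num)]
      exact Real.log_le_log (by positivity) (by linarith)
    have h5 : 2 * Real.log 4 + 2 * C0 ≤ Real.log M := by
      refine le_trans (le_of_eq ?_) (Real.log_le_log (by positivity) hM)
      rw [Real.log_mul (by norm_num) (Real.exp_ne_zero _), Real.log_exp,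
        show (16 : ℝ) = 4 ^ 2 by norm_num, Real.log_pow]
      push_cast; ring
    linarith

theorem exists_general_lower_bound : ∃ M0 : ℝ, 16 ≤ M0 ∧
    ∀ (s n N : ℕ) (H M α Λ K w : ℝ), 1 ≤ N → M0 ≤ M → 0 < α → Λ = α * (1 + M * N ^ 2) → Λ ≤ 1 →
      s * α = w → w ≤ 1 / 2 → 1 ≤ -Real.log α → 1 + 2 * w * -Real.log α ≤ H →
      2 ^ 24 * Λ * Real.log α ^ 2 ≤ w * Real.log M ^ 2 → 1 ≤ K → K * Λ ≤ 1 / 4 →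
      w / Λ / K ^ (N + 2) * Real.exp (8 * (K * Λ) * n) ≤ 1 / 4 → 0 < w →
      ENNReal.ofReal ((w * Real.log M) ^ 2 / 1024) ≤ minimaxRisk (s + 1) n H := by
  obtain ⟨M0, h16, h⟩ := exists_priorPair
  refine ⟨M0, h16, ?_⟩
  intro s n N H M α Λ K w hN hM hα hΛ hΛ1 hw hw2 hα1 hH hvar hK hKΛ htv hw0
  obtain ⟨v, μ0, μ1, hp⟩ := h N M α hN hM hα
  rw [← hΛ] at hp
  have hlog : 0 < Real.log M := Real.log_pos (by linarith)
  have hΛ0 : 0 < Λ := by rw [hΛ]; have : 0 < M := by linarith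
                         positivity
  have e : s * (α / 4 * Real.log M) = w * Real.log M / 4 := by rw [← hw]; ring
  have := le_minimaxRisk_of_priorPair (s := s) (n := n) (H := H) (w := w) (K := K) hp hα hΛ0 hΛ1 hw
    hw2 hα1 hH (by rw [e]; positivity) (by
      rw [e]
      have := mul_le_mul_of_nonneg_left hvar hw0.le
      nlinarith) hK hKΛ htv
  rw [e] at this
  rwa [show (w * Real.log M / 4) ^ 2 / 64 = (w * Real.log M) ^ 2 / 1024 by ring] at this

/-- Mass `1 - w` on the first symbol, the rest spread uniformly. -/
noncomputable def spikeDist (s : ℕ) (w : ℝ) : Fin (s + 1) → ℝ :=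
  Fin.cons (1 - w) fun _ => w / s

theorem isDist_spikeDist {s : ℕ} (hs : 1 ≤ s) {w : ℝ} (hw : 0 ≤ w) (hw1 : w ≤ 1) :
    IsDist (spikeDist s w) := by
  have hs' : (s : ℝ) ≠ 0 := by positivity
  constructor
  · intro i
    refine Fin.cases ?_ (fun j => ?_) i
    · simp [spikeDist, hw1]
    · simp only [spikeDist, Fin.cons_succ]; positivity
  · rw [Fin.sum_univ_succ]
    simp only [spikeDist, Fin.cons_zero, Fin.cons_succ, Finset.sum_const, Finset.card_univ,
      Fintype.card_fin, nsmul_eq_mul]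
    field_simp
    ring

theorem entropy_spikeDist {s : ℕ} (hs : 1 ≤ s) {w : ℝ} (hw : 0 < w) :
    entropy (spikeDist s w) = Real.binEntropy w + w * Real.log s := by
  have hs' : (s : ℝ) ≠ 0 := by positivity
  rw [entropy, Fin.sum_univ_succ, Real.binEntropy_eq_negMulLog_add_negMulLog_one_sub]
  simp only [spikeDist, Fin.cons_zero, Fin.cons_succ, Finset.sum_const, Finset.card_univ,
      Fintype.card_fin, nsmul_eq_mul, Real.negMulLog]
  rw [Real.log_div hw.ne' hs']
  field_simp
  ring

theorem sum_sq_div_spikeDist {s : ℕ} (hs : 1 ≤ s) {w w' : ℝ} (hw : 0 < w) (hw1 : w < 1) :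
    ∑ i, spikeDist s w' i ^ 2 / spikeDist s w i = 1 + (w - w') ^ 2 / (w * (1 - w)) := by
  have hs' : (s : ℝ) ≠ 0 := by positivity
  have h1 : 1 - w ≠ 0 := by linarith
  rw [Fin.sum_univ_succ]
  simp only [spikeDist, Fin.cons_zero, Fin.cons_succ, Finset.sum_const, Finset.card_univ,
      Fintype.card_fin, nsmul_eq_mul]
  field_simp
  ring

/-- Two-point lower bound through the chi-square divergence. -/
theorem sq_sub_le_of_chiSq {X : Type*} [Fintype X] {P Q e : X → ℝ} {a b R E : ℝ}
    (hP : ∀ x, 0 < P x) (hQ : ∀ x, 0 ≤ Q x) (hQ1 : ∑ x, Q x = 1)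
    (hE : ∑ x, Q x ^ 2 / P x ≤ E) (hPR : ∑ x, P x * (e x - a) ^ 2 ≤ R)
    (hQR : ∑ x, Q x * (e x - b) ^ 2 ≤ R) : (b - a) ^ 2 ≤ 2 * (E + 1) * R := by
  have h1 : (∑ x, Q x * (e x - a)) ^ 2 ≤ E * R := by
    have h := Finset.sum_sq_le_sum_mul_sum_of_sq_le_mul Finset.univ
      (r := fun x => Q x * (e x - a)) (f := fun x => Q x ^ 2 / P x)
      (g := fun x => P x * (e x - a) ^ 2)
      (fun x _ => div_nonneg (sq_nonneg _) (hP x).le)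
      (fun x _ => mul_nonneg (hP x).le (sq_nonneg _))
      (fun x _ => by have := (hP x).ne'; apply le_of_eq; field_simp)
    have hp : 0 ≤ ∑ x, P x * (e x - a) ^ 2 :=
      Finset.sum_nonneg fun x _ => mul_nonneg (hP x).le (sq_nonneg _)
    have hq : 0 ≤ ∑ x, Q x ^ 2 / P x :=
      Finset.sum_nonneg fun x _ => div_nonneg (sq_nonneg _) (hP x).le
    exact h.trans (mul_le_mul hE hPR hp (hq.trans hE))
  have h2 : (∑ x, Q x * (e x - b)) ^ 2 ≤ R := (sq_mean_le hQ hQ1 fun x => e x - b).trans hQR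
  have h3 : b - a = ∑ x, Q x * (e x - a) - ∑ x, Q x * (e x - b) := by
    rw [← Finset.sum_sub_distrib]
    have : ∀ x, Q x * (e x - a) - Q x * (e x - b) = Q x * (b - a) := fun x => by ring
    rw [Finset.sum_congr rfl fun x _ => this x, ← Finset.sum_mul, hQ1, one_mul]
  rw [h3]
  nlinarith [sq_nonneg (∑ x, Q x * (e x - a) + ∑ x, Q x * (e x - b))]

theorem le_minimaxRisk_of_variance {s n : ℕ} {H : ℝ} (hs : 8 ≤ s) (hn : 1 ≤ n) (hH : 2 ≤ H)
    (hHS : H ≤ Real.log ((s + 1 : ℕ) : ℝ)) (hnH : Real.log ((s + 1 : ℕ) : ℝ) ≤ n * H) :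
    ENNReal.ofReal (H * Real.log ((s + 1 : ℕ) : ℝ) / n / 2000) ≤ minimaxRisk (s + 1) n H := by
  set ℓ := Real.log ((s + 1 : ℕ) : ℝ) with hℓ
  have hℓ0 : 0 < ℓ := by linarith
  have hn0 : (0 : ℝ) < n := by exact_mod_cast hn
  have hs1 : 1 ≤ s := by omega
  have hs8 : (8 : ℝ) ≤ s := by exact_mod_cast hs
  set w := H / (4 * ℓ) with hw
  have hw0 : 0 < w := by positivity
  have hw4 : w ≤ 1 / 4 := by rw [hw, div_le_iff₀ (by positivity)]; linarith
  set ε := √(w / n) / 4 with hε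
  have hε0 : 0 < ε := by positivity
  have hεsq : ε ^ 2 = w / n / 16 := by rw [hε, div_pow, Real.sq_sqrt (by positivity)]; norm_num
  have hnw : 1 ≤ 4 * (n * w) := by
    rw [hw, show 4 * (n * (H / (4 * ℓ))) = n * H / ℓ by field_simp, le_div_iff₀ hℓ0]; linarith
  have hεw : ε ≤ w / 2 := by
    refine le_of_sq_le_sq ?_ (by positivity)
    rw [hεsq, div_div, div_le_iff₀ (by positivity)]
    nlinarith [mul_le_mul_of_nonneg_left hnw hw0.le]
  have hw'0 : 0 < w - ε := by linarith
  have hlogs0 : 0 ≤ Real.log s := Real.log_nonneg (by linarith)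
  have hlogs : ℓ ≤ 2 * Real.log s := by
    rw [hℓ, ← Nat.cast_two, ← Real.log_pow]
    refine Real.log_le_log (by positivity) ?_
    push_cast
    nlinarith
  have hlogs' : Real.log s ≤ ℓ := by
    rw [hℓ]; exact Real.log_le_log (by positivity) (by push_cast; linarith)
  have hlogle : w * Real.log s ≤ H / 4 := by
    calc w * Real.log s ≤ w * ℓ := by gcongr
      _ = H / 4 := by rw [hw]; field_simp
  have hmono : Real.binEntropy (w - ε) ≤ Real.binEntropy w :=
    Real.binEntropy_strictMonoOn.monotoneOn ⟨hw'0.le, by norm_num; linarith⟩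
      ⟨hw0.le, by norm_num; linarith⟩ (by linarith)
  have hle : entropy (spikeDist s w) ≤ H := by
    rw [entropy_spikeDist hs1 hw0]
    have h1 : Real.binEntropy w ≤ Real.log 2 := Real.binEntropy_le_log_two
    have := Real.log_two_lt_d9
    linarith
  have hdiff : ε * Real.log s ≤ entropy (spikeDist s w) - entropy (spikeDist s (w - ε)) := by
    rw [entropy_spikeDist hs1 hw0, entropy_spikeDist hs1 hw'0]; linarith
  have hle' : entropy (spikeDist s (w - ε)) ≤ H := by
    have : 0 ≤ ε * Real.log s := by positivity
    linarith
  have hd := isDist_spikeDist hs1 hw0.le (by linarith)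
  have hd' := isDist_spikeDist hs1 hw'0.le (by linarith)
  have hpos : ∀ i, 0 < spikeDist s w i := fun i => by
    refine Fin.cases ?_ (fun j => ?_) i
    · simp only [spikeDist, Fin.cons_zero]; linarith
    · simp only [spikeDist, Fin.cons_succ]; positivity
  refine ofReal_le_minimaxRisk fun est R _ hest => ?_
  have hE : ∑ x : Fin n → Fin (s + 1), seqWeight (spikeDist s (w - ε)) x ^ 2 /
      seqWeight (spikeDist s w) x ≤ 2 := by
    have e : ∀ x : Fin n → Fin (s + 1), seqWeight (spikeDist s (w - ε)) x ^ 2 /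
        seqWeight (spikeDist s w) x =
        seqWeight (fun i => spikeDist s (w - ε) i ^ 2 / spikeDist s w i) x := by
      intro x
      simp only [seqWeight]
      rw [Finset.prod_div_distrib, Finset.prod_pow]
    rw [Finset.sum_congr rfl fun x _ => e x, sum_seqWeight,
      sum_sq_div_spikeDist hs1 hw0 (by linarith), sub_sub_cancel, hεsq]
    have h1 : w / n / 16 / (w * (1 - w)) ≤ 1 / 12 / n := by
      have : 0 < 1 - w := by linarith
      rw [show w / n / 16 / (w * (1 - w)) = 1 / (16 * (1 - w)) / n by field_simp]
      gcongr
      linarith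
    calc (1 + w / n / 16 / (w * (1 - w))) ^ n ≤ (Real.exp (1 / 12 / n)) ^ n := by
          have : 0 < 1 - w := by linarith
          refine pow_le_pow_left₀ (by positivity) ?_ n
          have := Real.add_one_le_exp (1 / 12 / (n : ℝ))
          linarith
      _ = Real.exp (1 / 12) := by
          rw [← Real.exp_nat_mul]; congr 1; field_simp
      _ ≤ 2 := by
          rw [← Real.le_log_iff_exp_le (by norm_num)]
          have := Real.log_two_gt_d9
          linarith
  have hmain := sq_sub_le_of_chiSq (e := est) (fun x => Finset.prod_pos fun j _ => hpos (x j))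
    (fun x => seqWeight_nonneg hd'.1 x) (by rw [sum_seqWeight, hd'.2, one_pow]) hE
    (hest _ hd hle) (hest _ hd' hle')
  have h2 : (ε * Real.log s) ^ 2 ≤ 6 * R := by
    refine le_trans (pow_le_pow_left₀ (by positivity) hdiff 2) ?_
    rw [← neg_sq, neg_sub]; linarith
  have h3 : H * ℓ / n / 256 ≤ (ε * Real.log s) ^ 2 := by
    rw [mul_pow, hεsq, hw]
    calc H * ℓ / n / 256 = H / (4 * ℓ) / n / 16 * (ℓ / 2) ^ 2 := by field_simp; ring
      _ ≤ _ := by gcongr; linarith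
  have : 0 ≤ H * ℓ / n := by positivity
  linarith

theorem exists_mul_pow_le_exp (A : ℝ) (k : ℕ) {b : ℝ} (hb : 0 < b) :
    ∃ T : ℝ, 1 ≤ T ∧ ∀ t, T ≤ t → A * t ^ k ≤ Real.exp (b * t) := by
  have h := (isLittleO_pow_exp_pos_mul_atTop k hb).def (c := 1 / (|A| + 1)) (by positivity)
  obtain ⟨T, hT⟩ := Filter.eventually_atTop.1 h
  refine ⟨max T 1, le_max_right _ _, fun t ht => ?_⟩
  have ht1 : 1 ≤ t := (le_max_right _ _).trans ht
  have h1 := hT t ((le_max_left _ _).trans ht)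
  rw [Real.norm_of_nonneg (by positivity), Real.norm_of_nonneg (Real.exp_nonneg _),
    one_div_mul_eq_div, le_div_iff₀ (by positivity)] at h1
  have h2 : A * t ^ k ≤ |A| * t ^ k := mul_le_mul_of_nonneg_right (le_abs_self A) (by positivity)
  have h3 : 0 ≤ t ^ k := by positivity
  linarith

theorem exists_log_scale_lower_bound : ∃ M0 : ℝ, 16 ≤ M0 ∧
    ∀ (s n N : ℕ) (H M α w : ℝ), N = ⌈3 * Real.log n⌉₊ → 16 ≤ Real.log n → M0 ≤ M → 0 < α →
      Real.log n / (32 * n) = α * (1 + M * N ^ 2) →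
      s * α = w → 0 < w → w ≤ 1 / 2 → 1 ≤ -Real.log α → 1 + 2 * w * -Real.log α ≤ H →
      2 ^ 24 * (Real.log n / (32 * n)) * Real.log α ^ 2 ≤ w * Real.log M ^ 2 →
      ENNReal.ofReal ((w * Real.log M) ^ 2 / 1024) ≤ minimaxRisk (s + 1) n H := by
  obtain ⟨M0, h16, h⟩ := exists_general_lower_bound
  refine ⟨M0, h16, ?_⟩
  intro s n N H M α w hN hl hM hα hΛ hw hw0 hw2 hα1 hH hvar
  set l := Real.log n with hldef
  have hn0 : (0 : ℝ) < n := by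
    rcases Nat.eq_zero_or_pos n with h0 | h0
    · rw [hldef, h0] at hl; simp at hl; linarith
    · exact_mod_cast h0
  have hnl : Real.exp l = n := Real.exp_log hn0
  have hln : l ≤ n := by have := Real.add_one_le_exp l; linarith
  have he := Real.exp_one_lt_d9
  have hNl : 3 * l ≤ N := by rw [hN]; exact Nat.le_ceil _
  have hN1 : 1 ≤ N := by
    have : (0 : ℝ) < N := by linarith
    exact_mod_cast this
  have hΛle : l / (32 * n) ≤ 1 / 32 := by rw [div_le_div_iff₀ (by positivity) (by norm_num)]; linarith
  have hΛ0 : 0 < l / (32 * n) := by positivity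
  refine h s n N H M α (l / (32 * n)) (Real.exp 1) w hN1 hM hα hΛ (by linarith) hw hw2 hα1 hH hvar
    (Real.one_le_exp zero_le_one) ?_ ?_ hw0
  · nlinarith
  · have e1 : 8 * (Real.exp 1 * (l / (32 * n))) * n = Real.exp 1 / 4 * l := by field_simp; ring
    have e2 : Real.exp (Real.exp 1 / 4 * l) ≤ Real.exp l := Real.exp_le_exp.2 (by nlinarith)
    have e3 : Real.exp (3 * l) ≤ Real.exp 1 ^ (N + 2) := by
      rw [← Real.exp_nat_mul]; apply Real.exp_le_exp.2; push_cast; linarith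
    have e4 : w / (l / (32 * n)) ≤ Real.exp l := by
      rw [hnl, div_le_iff₀ hΛ0, show (n : ℝ) * (l / (32 * n)) = l / 32 by field_simp]; linarith
    rw [e1]
    calc w / (l / (32 * n)) / Real.exp 1 ^ (N + 2) * Real.exp (Real.exp 1 / 4 * l)
        ≤ Real.exp l / Real.exp (3 * l) * Real.exp l := by gcongr
      _ = Real.exp (-l) := by rw [← Real.exp_sub, ← Real.exp_add]; ring_nf
      _ ≤ 1 / 4 := by
        rw [Real.exp_neg, hnl, inv_eq_one_div]
        exact one_div_le_one_div_of_le (by norm_num) (by linarith)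

theorem neg_log_div_bounds {c s ℓ H : ℝ} (hc : 0 < c) (hc1 : c ≤ 1 / 16) (hs : 1 ≤ s)
    (hsl : Real.log s ≤ ℓ) (hH : 16 ≤ H) (hHl : H ≤ ℓ) :
    1 ≤ -Real.log (c * H / ℓ / s) ∧ -Real.log (c * H / ℓ / s) ≤ (1 + 1 / c) * ℓ ∧
      1 + 2 * (c * H / ℓ) * -Real.log (c * H / ℓ / s) ≤ H := by
  have hℓ : 0 < ℓ := by linarith
  set w := c * H / ℓ with hw
  have hw0 : 0 < w := by positivity
  have hwc : w ≤ c := by rw [hw, div_le_iff₀ hℓ]; gcongr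
  have hlogs : 0 ≤ Real.log s := Real.log_nonneg hs
  have hwi : -Real.log w ≤ 1 / w - 1 := by
    rw [← Real.log_inv, ← one_div]; exact Real.log_le_sub_one_of_pos (by positivity)
  rw [Real.log_div hw0.ne' (by linarith)]
  refine ⟨?_, ?_, ?_⟩
  · have h1 : Real.log w ≤ Real.log (Real.exp (-1)) := by
      apply Real.log_le_log hw0
      have := Real.exp_neg_one_gt_d9
      linarith
    rw [Real.log_exp] at h1
    linarith
  · have h2 : 1 / w ≤ 1 / c * ℓ := by
      rw [hw, one_div_div, div_le_iff₀ (by positivity)]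
      rw [show 1 / c * ℓ * (c * H) = ℓ * H by field_simp]
      nlinarith
    linarith
  · have h3 : w * -Real.log w ≤ 1 := by
      calc w * -Real.log w ≤ w * (1 / w) := by gcongr; linarith
        _ = 1 := by field_simp
    have h4 : w * Real.log s ≤ H / 16 := by
      calc w * Real.log s ≤ w * ℓ := by gcongr
        _ = c * H := by rw [hw]; field_simp
        _ ≤ H / 16 := by nlinarith
    linarith

theorem exists_lower_bound_sparse_moderate : ∃ c L : ℝ, 0 < c ∧ ∀ (s n : ℕ) (H : ℝ), 1 ≤ s →
    16 ≤ H → H ≤ Real.log ((s + 1 : ℕ) : ℝ) → L ≤ Real.log n →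
    Real.log ((s + 1 : ℕ) : ℝ) ≤ 8 * Real.log n →
    Real.exp 1 * n * H * Real.log n < ((s + 1 : ℕ) : ℝ) * Real.log ((s + 1 : ℕ) : ℝ) →
    ENNReal.ofReal (c * (H / Real.log ((s + 1 : ℕ) : ℝ) *
      Real.log (((s + 1 : ℕ) : ℝ) * Real.log ((s + 1 : ℕ) : ℝ) / (n * H * Real.log n))) ^ 2) ≤
      minimaxRisk (s + 1) n H := by
  obtain ⟨M0, h16, h⟩ := exists_log_scale_lower_bound
  set c := 1 / (4096 * M0) with hc
  have hc0 : 0 < c := by positivity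
  have hc1 : c ≤ 1 / 16 := by
    rw [hc]; exact one_div_le_one_div_of_le (by norm_num) (by linarith)
  obtain ⟨T, hT1, hT⟩ := exists_mul_pow_le_exp (2 ^ 25 * (1 + 1 / c) ^ 2 / c) 4 zero_lt_one
  refine ⟨c ^ 2 / 1024, max T 16, by positivity, ?_⟩
  intro s n H hs hH hHS hL hℓl hreg
  set ℓ := Real.log ((s + 1 : ℕ) : ℝ) with hℓ
  set l := Real.log n with hl
  have hlT : T ≤ l := (le_max_left _ _).trans hL
  have hl16 : 16 ≤ l := (le_max_right _ _).trans hL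
  have hℓ0 : 0 < ℓ := by linarith
  have hn0 : (0 : ℝ) < n := by
    rcases Nat.eq_zero_or_pos n with h0 | h0
    · rw [hl, h0] at hl16; simp at hl16; linarith
    · exact_mod_cast h0
  have hs0 : (1 : ℝ) ≤ s := by exact_mod_cast hs
  have hlogs : Real.log s ≤ ℓ := Real.log_le_log (by linarith) (by push_cast; linarith)
  set x := ((s + 1 : ℕ) : ℝ) * ℓ / (n * H * l) with hx
  have hxe : Real.exp 1 < x := by
    rw [hx, lt_div_iff₀ (by positivity)]; linarith
  have hx1 : 1 ≤ x := by have := Real.add_one_le_exp (1 : ℝ); linarith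
  have hx1' : 1 ≤ Real.log x := by
    rw [Real.le_log_iff_exp_le (by linarith)]; exact hxe.le
  obtain ⟨b1, b2, b3⟩ := neg_log_div_bounds hc0 hc1 hs0 hlogs hH hHS
  set w := c * H / ℓ with hw
  have hw0 : 0 < w := by positivity
  have hwc : w ≤ c := by rw [hw, div_le_iff₀ hℓ0]; gcongr
  set N := ⌈3 * l⌉₊ with hN
  have hN3 : 3 * l ≤ N := Nat.le_ceil _
  have hN4 : (N : ℝ) ≤ 4 * l := by
    have := Nat.ceil_lt_add_one (by linarith : 0 ≤ 3 * l); linarith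
  have hN0 : (0 : ℝ) < N := by linarith
  set Q := l / (32 * n) / (w / s) with hQ
  have hQx : 64 * M0 * x * l ^ 2 ≤ Q := by
    have e : Q = 128 * M0 * (s : ℝ) * ℓ * l / (n * H) := by
      rw [hQ, hw, hc]; field_simp; ring
    have e2 : 64 * M0 * x * l ^ 2 = 64 * M0 * ((s + 1 : ℕ) : ℝ) * ℓ * l / (n * H) := by
      rw [hx]; field_simp
    rw [e, e2]
    apply div_le_div_of_nonneg_right _ (by positivity)
    have : ((s + 1 : ℕ) : ℝ) ≤ 2 * s := by push_cast; linarith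
    calc 64 * M0 * ((s + 1 : ℕ) : ℝ) * ℓ * l ≤ 64 * M0 * (2 * s) * ℓ * l := by gcongr
      _ = _ := by ring
  set M := (Q - 1) / N ^ 2 with hM
  have hMx : M0 * x ≤ M := by
    rw [hM, le_div_iff₀ (by positivity)]
    have h1 : (N : ℝ) ^ 2 ≤ 16 * l ^ 2 := by
      calc (N : ℝ) ^ 2 ≤ (4 * l) ^ 2 := by gcongr
        _ = _ := by ring
    have h2 : 1 ≤ M0 * x := by nlinarith
    have h3 : 1 ≤ l ^ 2 := one_le_pow₀ (by linarith)
    have h4 : M0 * x * N ^ 2 ≤ M0 * x * (16 * l ^ 2) := by gcongr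
    have h5 : 1 ≤ M0 * x * l ^ 2 := one_le_mul_of_one_le_of_one_le h2 h3
    linarith
  have hM0M : M0 ≤ M := le_trans (le_mul_of_one_le_right (by linarith) hx1) hMx
  have hlogM : Real.log x ≤ Real.log M := by
    refine Real.log_le_log (by linarith) (le_trans ?_ hMx)
    exact le_mul_of_one_le_left (by linarith) (by linarith)
  have hα0 : 0 < w / s := by positivity
  have key := h s n N H M (w / s) w hN hl16 hM0M hα0 ?_ (by field_simp) hw0 (by linarith) b1 b3 ?_
  · refine le_trans (ENNReal.ofReal_le_ofReal ?_) key
    have : c * (H / ℓ * Real.log x) ≤ w * Real.log M := by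
      rw [hw, ← mul_assoc, ← mul_div_assoc]
      gcongr
    calc c ^ 2 / 1024 * (H / ℓ * Real.log x) ^ 2 = (c * (H / ℓ * Real.log x)) ^ 2 / 1024 := by ring
      _ ≤ _ := by gcongr
  · rw [hM, div_mul_cancel₀ _ (by positivity : (N : ℝ) ^ 2 ≠ 0), add_sub_cancel, hQ]
    field_simp
    exact hl.symm
  · have h1 : Real.log (w / s) ^ 2 ≤ ((1 + 1 / c) * (8 * l)) ^ 2 := by
      rw [← neg_sq]
      refine pow_le_pow_left₀ (by linarith) (b2.trans ?_) 2
      gcongr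
    have h2 : c / l ≤ w := by
      rw [hw, div_le_div_iff₀ (by linarith) hℓ0]
      calc c * ℓ ≤ c * (16 * l) := by gcongr; linarith
        _ ≤ c * (H * l) := by gcongr
        _ = _ := by ring
    have h3 : 1 ≤ Real.log M ^ 2 := one_le_pow₀ (hx1'.trans hlogM)
    have h4 := hT l hlT
    rw [one_mul, hl, Real.exp_log hn0, ← hl] at h4
    calc 2 ^ 24 * (l / (32 * n)) * Real.log (w / s) ^ 2
        ≤ 2 ^ 24 * (l / (32 * n)) * ((1 + 1 / c) * (8 * l)) ^ 2 := by gcongr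
      _ = c / l * (2 ^ 25 * (1 + 1 / c) ^ 2 / c * l ^ 4) / n := by field_simp; ring
      _ ≤ c / l * n / n := by gcongr
      _ = c / l := by field_simp
      _ ≤ w := h2
      _ ≤ w * Real.log M ^ 2 := le_mul_of_one_le_right hw0.le h3

theorem exists_lower_bound_sparse_small : ∃ c L : ℝ, 0 < c ∧ ∀ (s n : ℕ) (H : ℝ), 1 ≤ s → 3 ≤ n →
    16 ≤ H → H ≤ Real.log ((s + 1 : ℕ) : ℝ) → L ≤ Real.log ((s + 1 : ℕ) : ℝ) →
    8 * Real.log n ≤ Real.log ((s + 1 : ℕ) : ℝ) →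
    Real.exp 1 * n * H * Real.log n < ((s + 1 : ℕ) : ℝ) * Real.log ((s + 1 : ℕ) : ℝ) →
    ENNReal.ofReal (c * (H / Real.log ((s + 1 : ℕ) : ℝ) *
      Real.log (((s + 1 : ℕ) : ℝ) * Real.log ((s + 1 : ℕ) : ℝ) / (n * H * Real.log n))) ^ 2) ≤
      minimaxRisk (s + 1) n H := by
  obtain ⟨M0, h16, h⟩ := exists_general_lower_bound
  set c : ℝ := 1 / 16 with hc
  have hc0 : 0 < c := by positivity
  obtain ⟨T, hT1, hT⟩ := exists_mul_pow_le_exp (2 ^ 24 * (1 + 1 / c) ^ 2) 2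
    (by norm_num : (0 : ℝ) < 1 / 2)
  refine ⟨c ^ 2 / 16384, max T (max 10000 (2 * M0)), by positivity, ?_⟩
  intro s n H hs hn hH hHS hL hℓl hreg
  set ℓ := Real.log ((s + 1 : ℕ) : ℝ) with hℓ
  set l := Real.log n with hl
  have hℓT : T ≤ ℓ := (le_max_left _ _).trans hL
  have hℓ4 : 10000 ≤ ℓ := ((le_max_left _ _).trans (le_max_right _ _)).trans hL
  have hℓM : 2 * M0 ≤ ℓ := ((le_max_right _ _).trans (le_max_right _ _)).trans hL
  have hℓ0 : 0 < ℓ := by linarith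
  have hn3 : (3 : ℝ) ≤ n := by exact_mod_cast hn
  have hn0 : (0 : ℝ) < n := by linarith
  have he3 : Real.exp 1 ≤ 3 := by have := Real.exp_one_lt_d9; linarith
  have hl1 : 1 ≤ l := by
    rw [hl, Real.le_log_iff_exp_le hn0]; linarith
  have hs0 : (1 : ℝ) ≤ s := by exact_mod_cast hs
  have hlogs : Real.log s ≤ ℓ := Real.log_le_log (by linarith) (by push_cast; linarith)
  have hSexp : Real.exp ℓ = ((s + 1 : ℕ) : ℝ) := Real.exp_log (by positivity)
  have hnexp : Real.exp l = n := Real.exp_log hn0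
  set x := ((s + 1 : ℕ) : ℝ) * ℓ / (n * H * l) with hx
  have hxe : Real.exp 1 < x := by
    rw [hx, lt_div_iff₀ (by positivity)]; linarith
  have hx1 : 1 ≤ x := by have := Real.add_one_le_exp (1 : ℝ); linarith
  have hx0 : 0 ≤ Real.log x := Real.log_nonneg hx1
  have hx2 : Real.log x ≤ 2 * ℓ := by
    have h1 : x ≤ Real.exp ℓ * Real.exp ℓ := by
      rw [hx, div_le_iff₀ (by positivity), hSexp]
      have h2 : ℓ ≤ ((s + 1 : ℕ) : ℝ) := by
        rw [← hSexp]; have := Real.add_one_le_exp ℓ; linarith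
      have h3 : 1 ≤ n * H * l := by
        exact one_le_mul_of_one_le_of_one_le
          (one_le_mul_of_one_le_of_one_le (by linarith) (by linarith)) hl1
      calc ((s + 1 : ℕ) : ℝ) * ℓ ≤ ((s + 1 : ℕ) : ℝ) * ((s + 1 : ℕ) : ℝ) := by gcongr
        _ ≤ _ := le_mul_of_one_le_right (by positivity) h3
    rw [← Real.exp_add] at h1
    have := Real.log_le_log (by linarith) h1
    rw [Real.log_exp] at this
    linarith
  obtain ⟨b1, b2, b3⟩ := neg_log_div_bounds hc0 le_rfl hs0 hlogs hH hHS
  set w := c * H / ℓ with hw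
  have hw0 : 0 < w := by positivity
  have hwc : w ≤ c := by rw [hw, div_le_iff₀ hℓ0]; gcongr
  have hα0 : 0 < w / s := by positivity
  set E := Real.exp (ℓ / 2) with hE
  have hE0 : 0 < E := Real.exp_pos _
  have hEE : E * E = ((s + 1 : ℕ) : ℝ) := by rw [hE, ← Real.exp_add, ← hSexp]; ring_nf
  have hE1 : ℓ / 2 + 1 ≤ E := Real.add_one_le_exp _
  have hnE : (n : ℝ) ^ 4 ≤ E := by
    rw [hE, ← hnexp, ← Real.exp_nat_mul]; apply Real.exp_le_exp.2; push_cast; linarith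
  have hn8E : 8 * n ≤ E := by
    have : (27 : ℝ) ≤ n ^ 3 := by
      calc (27 : ℝ) = 3 ^ 3 := by norm_num
        _ ≤ _ := by gcongr
    nlinarith
  set M := 1 / E / (w / s) - 1 with hM
  have hME : E ≤ M := by
    have : E + 1 ≤ 1 / E / (w / s) := by
      rw [div_div, le_div_iff₀ (by positivity)]
      have h1 : E * (w / s) ≤ E * (c / s) := by gcongr
      have h2 : E * E ≤ 2 * s := by rw [hEE]; push_cast; linarith
      have h3 : (E + 1) * (E * (c / s)) = c * (E * E + E) / s := by field_simp
      calc (E + 1) * (E * (w / s)) ≤ (E + 1) * (E * (c / s)) := by gcongr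
        _ = c * (E * E + E) / s := h3
        _ ≤ c * (4 * s) / s := by
          gcongr; nlinarith
        _ ≤ 1 := by rw [hc]; field_simp; norm_num
    linarith
  have hM0M : M0 ≤ M := by linarith
  have hlogM : ℓ / 2 ≤ Real.log M := by
    rw [Real.le_log_iff_exp_le (by linarith)]; exact hME
  have hΛE : (0 : ℝ) < 1 / E := by positivity
  clear_value M E w x
  have hKΛ : E / (8 * n) * (1 / E) = 1 / (8 * n) := by field_simp
  have key := h s n 1 H M (w / s) (1 / E) (E / (8 * n)) w le_rfl hM0M hα0
    (by rw [hM]; field_simp; push_cast; ring)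
    (by rw [div_le_one hE0]; linarith) (by field_simp) (hwc.trans (by rw [hc]; norm_num)) b1 b3 ?_ ?_ ?_ ?_ hw0
  · refine le_trans (ENNReal.ofReal_le_ofReal ?_) key
    have : c * (H / ℓ * Real.log x) / 4 ≤ w * Real.log M := by
      calc c * (H / ℓ * Real.log x) / 4 = w * (Real.log x / 4) := by rw [hw]; field_simp
        _ ≤ w * Real.log M := by gcongr; linarith
    calc c ^ 2 / 16384 * (H / ℓ * Real.log x) ^ 2
        = (c * (H / ℓ * Real.log x) / 4) ^ 2 / 1024 := by ring
      _ ≤ _ := by gcongr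
  · have h1 : Real.log (w / s) ^ 2 ≤ ((1 + 1 / c) * ℓ) ^ 2 := by
      rw [← neg_sq]
      exact pow_le_pow_left₀ (by linarith) b2 2
    have h4 := hT ℓ hℓT
    rw [one_div_mul_eq_div, ← hE] at h4
    calc 2 ^ 24 * (1 / E) * Real.log (w / s) ^ 2
        ≤ 2 ^ 24 * (1 / E) * ((1 + 1 / c) * ℓ) ^ 2 := by gcongr
      _ = (2 ^ 24 * (1 + 1 / c) ^ 2 * ℓ ^ 2) / E := by field_simp
      _ ≤ E / E := by gcongr
      _ = 1 := div_self hE0.ne'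
      _ ≤ c * 16 / ℓ * (ℓ / 2) ^ 2 := by
        rw [show c * 16 / ℓ * (ℓ / 2) ^ 2 = ℓ / 4 by rw [hc]; field_simp; norm_num]; linarith
      _ ≤ w * Real.log M ^ 2 := by rw [hw]; gcongr
  · rw [le_div_iff₀ (by positivity)]; linarith
  · rw [hKΛ]; exact one_div_le_one_div_of_le (by norm_num) (by linarith)
  · rw [hKΛ, show 8 * (1 / (8 * (n : ℝ))) * n = 1 by field_simp]
    have h1 : w / (1 / E) / (E / (8 * n)) ^ (1 + 2) = 512 * w * (n : ℝ) ^ 3 / (E * E) := by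
      rw [div_pow, mul_pow]; field_simp; norm_num
    rw [h1]
    have h2 : (n : ℝ) ^ 3 ≤ E := by
      refine le_trans ?_ hnE
      exact pow_le_pow_right₀ (by linarith) (by norm_num)
    calc 512 * w * (n : ℝ) ^ 3 / (E * E) * Real.exp 1 ≤ 512 * c * E / (E * E) * 3 := by gcongr
      _ = 96 / E := by rw [hc]; field_simp; norm_num
      _ ≤ 1 / 4 := by rw [div_le_div_iff₀ hE0 (by norm_num)]; linarith

theorem exists_lower_bound_dense : ∃ c L : ℝ, 0 < c ∧ ∀ (s n : ℕ) (H : ℝ), 1 ≤ s →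
    16 ≤ H → H ≤ Real.log ((s + 1 : ℕ) : ℝ) → L ≤ Real.log n →
    Real.log n ≤ 2 * Real.log ((s + 1 : ℕ) : ℝ) →
    ((s + 1 : ℕ) : ℝ) * Real.log ((s + 1 : ℕ) : ℝ) ≤ Real.exp 1 * n * H * Real.log n →
    ENNReal.ofReal (c * (((s + 1 : ℕ) : ℝ) ^ 2 / (n * Real.log n) ^ 2)) ≤
      minimaxRisk (s + 1) n H := by
  obtain ⟨M, h16, h⟩ := exists_log_scale_lower_bound
  obtain ⟨T, hT1, hT⟩ := exists_mul_pow_le_exp (2 ^ 27 * (17 * M)) 4 (by norm_num : (0 : ℝ) < 1 / 2)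
  refine ⟨(1 / (1088 * M)) ^ 2 / 1024, max T (1088 * M), by positivity, ?_⟩
  intro s n H hs hH hHS hL hlℓ hreg
  set ℓ := Real.log ((s + 1 : ℕ) : ℝ) with hℓ
  set l := Real.log n with hl
  have hlT : T ≤ l := (le_max_left _ _).trans hL
  have hlM : 1088 * M ≤ l := (le_max_right _ _).trans hL
  have hl16 : 16 ≤ l := by linarith
  have hl0 : 0 < l := by linarith
  have hℓ0 : 0 < ℓ := by linarith
  have hn0 : (0 : ℝ) < n := by
    rcases Nat.eq_zero_or_pos n with h0 | h0
    · rw [hl, h0] at hl16; simp at hl16; linarith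
    · exact_mod_cast h0
  have hnexp : Real.exp l = n := Real.exp_log hn0
  have hln : l ≤ n := by have := Real.add_one_le_exp l; linarith
  have hs0 : (1 : ℝ) ≤ s := by exact_mod_cast hs
  have hSs : ((s + 1 : ℕ) : ℝ) ≤ 2 * s := by push_cast; linarith
  have hSs' : (s : ℝ) ≤ ((s + 1 : ℕ) : ℝ) := by push_cast; linarith
  have he3 : Real.exp 1 ≤ 3 := by have := Real.exp_one_lt_d9; linarith
  have hM0 : 0 < M := by linarith
  set N := ⌈3 * l⌉₊ with hN
  have hN3 : 3 * l ≤ N := Nat.le_ceil _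
  have hN4 : (N : ℝ) ≤ 4 * l := by
    have := Nat.ceil_lt_add_one (by linarith : 0 ≤ 3 * l); linarith
  set G := 1 + M * (N : ℝ) ^ 2 with hG
  have hG0 : 0 < G := by positivity
  have hG1 : 1 ≤ G := by rw [hG]; have : 0 ≤ M * (N : ℝ) ^ 2 := by positivity
                         linarith
  have hGlow : 9 * M * l ^ 2 ≤ G := by
    have : (3 * l) ^ 2 ≤ (N : ℝ) ^ 2 := by gcongr
    have := mul_le_mul_of_nonneg_left this hM0.le
    rw [hG]; linarith
  have hGup : G ≤ 17 * M * l ^ 2 := by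
    have h1 : (N : ℝ) ^ 2 ≤ (4 * l) ^ 2 := by gcongr
    have h2 := mul_le_mul_of_nonneg_left h1 hM0.le
    have h3 : 1 ≤ M * l ^ 2 := one_le_mul_of_one_le_of_one_le (by linarith)
      (one_le_pow₀ (by linarith))
    rw [hG]; linarith
  set Λ := l / (32 * n) with hΛ
  have hΛ0 : 0 < Λ := by positivity
  have hΛle : Λ ≤ 1 / 32 := by
    rw [hΛ, div_le_div_iff₀ (by positivity) (by norm_num)]; linarith
  set α := Λ / G with hα
  have hα0 : 0 < α := by positivity
  have hαΛ : α ≤ Λ := div_le_self hΛ0.le hG1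
  set w := s * α with hw
  have hw0 : 0 < w := by positivity
  have hwH : w ≤ H / (1536 * ℓ) := by
    have h1 : w ≤ ((s + 1 : ℕ) : ℝ) * (l / (32 * n) / (9 * M * l ^ 2)) := by
      rw [hw, hα]; gcongr
    refine h1.trans ?_
    rw [show ((s + 1 : ℕ) : ℝ) * (l / (32 * n) / (9 * M * l ^ 2)) =
      ((s + 1 : ℕ) : ℝ) / (288 * M * n * l) by field_simp; norm_num,
      div_le_div_iff₀ (by positivity) (by positivity)]
    have h2 : Real.exp 1 * n * H * l ≤ 3 * n * H * l := by gcongr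
    have h3 : 16 * (n * H * l) ≤ M * (n * H * l) := by gcongr
    nlinarith
  have hw2 : w ≤ 1 / 2 := by
    refine hwH.trans ?_
    rw [div_le_div_iff₀ (by positivity) (by norm_num)]; linarith
  have ha1 : 1 ≤ -Real.log α := by
    have h1 : Real.log α ≤ Real.log (Real.exp (-1)) := by
      apply Real.log_le_log hα0
      have := Real.exp_neg_one_gt_d9
      linarith
    rw [Real.log_exp] at h1
    linarith
  have ha2 : -Real.log α ≤ 2 * l := by
    rw [← Real.log_inv, hα, inv_div, hΛ]
    have h1 : G / (l / (32 * n)) ≤ Real.exp l * Real.exp l := by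
      rw [hnexp, div_div_eq_mul_div, div_le_iff₀ hl0]
      calc G * (32 * n) ≤ 17 * M * l ^ 2 * (32 * n) := by gcongr
        _ = (544 * M) * (l * (l * n)) := by ring
        _ ≤ l / 2 * (l * (l * n)) := by gcongr; linarith
        _ = l ^ 2 / 2 * (l * n) := by ring
        _ ≤ n * (l * n) := by
          have := Real.quadratic_le_exp_of_nonneg hl0.le
          gcongr
          linarith
        _ = n * n * l := by ring
    rw [← Real.exp_add] at h1
    have := Real.log_le_log (by positivity) h1
    rw [Real.log_exp] at this
    linarith
  have hlogM : 1 ≤ Real.log M := by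
    rw [Real.le_log_iff_exp_le hM0]; linarith
  have key := h s n N H M α w hN hl16 le_rfl hα0 (by rw [hα, ← hG, div_mul_cancel₀ _ hG0.ne']) hw.symm hw0 hw2 ha1 ?_ ?_
  · refine le_trans (ENNReal.ofReal_le_ofReal ?_) key
    have hwl : 1 / (1088 * M) * (((s + 1 : ℕ) : ℝ) / (n * l)) ≤ w := by
      calc 1 / (1088 * M) * (((s + 1 : ℕ) : ℝ) / (n * l)) ≤ 1 / (1088 * M) * (2 * s / (n * l)) := by
            gcongr
        _ = s * (l / (32 * n) / (17 * M * l ^ 2)) := by field_simp; norm_num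
        _ ≤ w := by rw [hw, hα]; gcongr
    calc (1 / (1088 * M)) ^ 2 / 1024 * (((s + 1 : ℕ) : ℝ) ^ 2 / (n * l) ^ 2)
        = (1 / (1088 * M) * (((s + 1 : ℕ) : ℝ) / (n * l))) ^ 2 / 1024 := by ring
      _ ≤ (w * Real.log M) ^ 2 / 1024 := by
        refine div_le_div_of_nonneg_right (pow_le_pow_left₀ (by positivity) ?_ 2) (by norm_num)
        exact hwl.trans (le_mul_of_one_le_right hw0.le hlogM)
  · have h1 : w * -Real.log α ≤ H / (1536 * ℓ) * (4 * ℓ) := by gcongr; linarith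
    rw [show H / (1536 * ℓ) * (4 * ℓ) = H / 384 by field_simp; norm_num] at h1
    linarith
  · have h1 : Real.log α ^ 2 ≤ (2 * l) ^ 2 := by
      rw [← neg_sq]
      exact pow_le_pow_left₀ (by linarith) ha2 2
    have h4 := hT l hlT
    have h5 : Real.exp (1 / 2 * l) ≤ ((s + 1 : ℕ) : ℝ) := by
      rw [← Real.exp_log (by positivity : (0 : ℝ) < ((s + 1 : ℕ) : ℝ))]
      apply Real.exp_le_exp.2
      linarith
    have h6 : 2 ^ 26 * (17 * M) * l ^ 4 ≤ s := by linarith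
    calc 2 ^ 24 * Λ * Real.log α ^ 2 ≤ 2 ^ 24 * Λ * (2 * l) ^ 2 := by gcongr
      _ = 2 ^ 26 * (17 * M) * l ^ 4 * (Λ / (17 * M * l ^ 2)) := by field_simp
      _ ≤ s * (Λ / G) := by gcongr
      _ = w := rfl
      _ ≤ w * Real.log M ^ 2 := le_mul_of_one_le_right hw0.le (one_le_pow₀ hlogM)

theorem log_alphabet_le_of_dense {S n : ℕ} {H : ℝ} (hS : 1 ≤ S) (hn : 3 ≤ n)
    (hHS : H ≤ Real.log S) (hH : 0 < H)
    (hreg : (S : ℝ) * Real.log S ≤ Real.exp 1 * n * H * Real.log n) :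
    Real.log S ≤ 2 * Real.log n + 1 := by
  have hn0 : (0 : ℝ) < n := by positivity
  have hS0 : (0 : ℝ) < S := by exact_mod_cast hS
  have hn1 : (1 : ℝ) < n := by exact_mod_cast (by omega : 1 < n)
  have hl0 : 0 < Real.log n := Real.log_pos hn1
  have hln : Real.log n ≤ n := by have := Real.log_le_sub_one_of_pos hn0; linarith
  have h1 : (S : ℝ) ≤ Real.exp 1 * n * n := by
    refine le_of_mul_le_mul_right ?_ (hH.trans_le hHS)
    refine hreg.trans ?_
    calc Real.exp 1 * n * H * Real.log n ≤ Real.exp 1 * n * Real.log S * n := by gcongr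
      _ = _ := by ring
  have h2 := Real.log_le_log hS0 h1
  rw [Real.log_mul (by positivity) hn0.ne', Real.log_mul (Real.exp_ne_zero _) hn0.ne',
    Real.log_exp] at h2
  linarith

theorem bias_scale_le_variance_scale {S n : ℕ} {H : ℝ} (hn : 1 ≤ Real.log n)
    (hS : 1 ≤ S) (hH : 1 ≤ H) (hHS : H ≤ Real.log S) (h : 2 * Real.log S ≤ Real.log n) :
    (S : ℝ) ^ 2 / (n * Real.log n) ^ 2 ≤ H * Real.log S / n := by
  have hn0 : (0 : ℝ) < n := by
    rcases Nat.eq_zero_or_pos n with h0 | h0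
    · rw [h0] at hn; simp at hn; linarith
    · exact_mod_cast h0
  have hS0 : (0 : ℝ) < S := by exact_mod_cast hS
  have hSn : (S : ℝ) ^ 2 ≤ n := by
    rw [← Real.log_le_log_iff (by positivity) hn0, Real.log_pow]
    exact_mod_cast h
  have h1 : 1 ≤ Real.log n ^ 2 := one_le_pow₀ hn
  calc (S : ℝ) ^ 2 / (n * Real.log n) ^ 2 ≤ n / (n * Real.log n) ^ 2 := by gcongr
    _ = 1 / Real.log n ^ 2 / n := by field_simp
    _ ≤ H * Real.log S / n := by
      gcongr
      rw [div_le_iff₀ (by positivity)]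
      exact one_le_mul_of_one_le_of_one_le
        (one_le_mul_of_one_le_of_one_le hH (hH.trans hHS)) h1

theorem minimax_risk_characterization :
    ∃ (H₀ c C : ℝ), 0 < H₀ ∧ 0 < c ∧ c ≤ C ∧
      ∀ (S n : ℕ) (H : ℝ), 2 ≤ S → 3 ≤ n → H₀ ≤ H → H ≤ Real.log S →
        (((S : ℝ) * Real.log S ≤ Real.exp 1 * n * H * Real.log n →
          ENNReal.ofReal (c * ((S : ℝ) ^ 2 / ((n : ℝ) * Real.log n) ^ 2
              + H * Real.log S / n)) ≤ minimaxRisk S n H ∧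
            minimaxRisk S n H ≤ ENNReal.ofReal (C * ((S : ℝ) ^ 2 / ((n : ℝ) * Real.log n) ^ 2
              + H * Real.log S / n))) ∧
        ((S : ℝ) * Real.log S > Real.exp 1 * n * H * Real.log n →
          ENNReal.ofReal (c * ((H / Real.log S)
              * Real.log ((S : ℝ) * Real.log S / (n * H * Real.log n))) ^ 2)
              ≤ minimaxRisk S n H ∧
            minimaxRisk S n H ≤ ENNReal.ofReal (C * ((H / Real.log S)
              * Real.log ((S : ℝ) * Real.log S / (n * H * Real.log n))) ^ 2))) := by
  obtain ⟨c1, L1, hc1, h1⟩ := exists_lower_bound_sparse_moderate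
  obtain ⟨c2, L2, hc2, h2⟩ := exists_lower_bound_sparse_small
  obtain ⟨c3, L3, hc3, h3⟩ := exists_lower_bound_dense
  have a1 := le_abs_self L1
  have a2 := le_abs_self L2
  have a3 := le_abs_self L3
  have b1 := abs_nonneg L1
  have b2 := abs_nonneg L2
  have b3 := abs_nonneg L3
  set c := min (min c1 c2) (min c3 (1 / 2000) / 2) with hc
  have hc0 : 0 < c := by rw [hc]; positivity
  have hcc1 : c ≤ c1 := (min_le_left _ _).trans (min_le_left _ _)
  have hcc2 : c ≤ c2 := (min_le_left _ _).trans (min_le_right _ _)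
  have hcm : c ≤ min c3 (1 / 2000) / 2 := min_le_right _ _
  have hcc3 : c ≤ c3 / 2 := hcm.trans (by gcongr; exact min_le_left _ _)
  have hcc4 : c ≤ 1 / 4000 := hcm.trans (by
    have : min c3 (1 / 2000) ≤ 1 / 2000 := min_le_right _ _
    linarith)
  refine ⟨2000 + 8 * |L1| + |L2| + 2 * |L3|, c, 3000000, by positivity, hc0, by linarith, ?_⟩
  intro S n H hS hn hH hHS
  have hn3 : (3 : ℝ) ≤ n := by exact_mod_cast hn
  have hn0 : (0 : ℝ) < n := by linarith
  have hl1 : 1 ≤ Real.log n := by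
    rw [Real.le_log_iff_exp_le hn0]
    have := Real.exp_one_lt_d9
    linarith
  have hS0 : (0 : ℝ) < S := by exact_mod_cast (by omega : 0 < S)
  obtain ⟨s, rfl⟩ : ∃ s, S = s + 1 := ⟨S - 1, by omega⟩
  constructor
  · intro hreg
    have hSn := log_alphabet_le_of_dense (by omega) hn hHS (by linarith) hreg
    refine ⟨?_, minimaxRisk_le_of_large_sample (by linarith) hS (by linarith) hHS⟩
    have hB0 : 0 ≤ H * Real.log ((s + 1 : ℕ) : ℝ) / n := by
      have : 0 ≤ H := by linarith
      have : 0 ≤ Real.log ((s + 1 : ℕ) : ℝ) := by linarith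
      positivity
    have hA0 : 0 ≤ ((s + 1 : ℕ) : ℝ) ^ 2 / ((n : ℝ) * Real.log n) ^ 2 := by positivity
    have hs8 : 8 ≤ s := by
      have := Real.log_le_sub_one_of_pos hS0
      push_cast at this hHS
      have h8 : (8 : ℝ) ≤ s := by linarith
      exact_mod_cast h8
    have hnH : Real.log ((s + 1 : ℕ) : ℝ) ≤ n * H := by
      have := Real.log_le_sub_one_of_pos hn0
      nlinarith
    have hvar := le_minimaxRisk_of_variance hs8 (by omega : 1 ≤ n) (by linarith : 2 ≤ H) hHS hnH
    rcases le_total ((((s + 1 : ℕ) : ℝ) ^ 2 / ((n : ℝ) * Real.log n) ^ 2))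
      (H * Real.log ((s + 1 : ℕ) : ℝ) / n) with hAB | hAB
    · refine le_trans (ENNReal.ofReal_le_ofReal ?_) hvar
      have := mul_le_mul_of_nonneg_right hcc4 hB0
      have := mul_le_mul_of_nonneg_left hAB hc0.le
      linarith
    · rcases le_total (Real.log n) (2 * Real.log ((s + 1 : ℕ) : ℝ)) with hlS | hlS
      · refine le_trans (ENNReal.ofReal_le_ofReal ?_)
          (h3 s n H (by omega) (by linarith) hHS (by linarith) hlS hreg)
        have := mul_le_mul_of_nonneg_right hcc3 hA0
        have := mul_le_mul_of_nonneg_left hAB hc0.le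
        linarith
      · have hBA := bias_scale_le_variance_scale hl1 (by omega : 1 ≤ s + 1) (by linarith) hHS hlS
        refine le_trans (ENNReal.ofReal_le_ofReal ?_) hvar
        have := mul_le_mul_of_nonneg_right hcc4 hB0
        have := mul_le_mul_of_nonneg_left hBA hc0.le
        linarith
  · intro hreg
    constructor
    · rcases le_total (Real.log ((s + 1 : ℕ) : ℝ)) (8 * Real.log n) with hlS | hlS
      · refine le_trans (ENNReal.ofReal_le_ofReal ?_)
          (h1 s n H (by omega) (by linarith) hHS (by linarith) hlS hreg)
        gcongr
      · refine le_trans (ENNReal.ofReal_le_ofReal ?_)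
          (h2 s n H (by omega) hn (by linarith) hHS (by linarith) hlS hreg)
        gcongr
    · refine (minimaxRisk_le_of_small_sample (by linarith) hn (by linarith) hHS hreg).trans
        (ENNReal.ofReal_le_ofReal ?_)
      gcongr
      norm_num
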